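/- There exists a constant C > 0 such that for all Schwartz functions w ∈ 𝒮(ℝ^{2n+1}_{t,x,v}) satisfying supp w(·,x,v) ⊂ [−3,3] for every (x,v) ∈ ℝ^{2n}, one has ‖⟨D_z⟩^{2σ/(2σ+1)} (⟨v⟩^{−1} w)‖_{L²(ℝ^{2n+1})} + ‖⟨D_v⟩^{2σ} w‖_{L²(ℝ^{2n+1})} ≤ C (‖Pw‖_{L²(ℝ^{2n+1})} + ‖w‖_{L²(ℝ^{2n+1})}), where ⟨v⟩^{−1} w denotes the function (t,x,v) ↦ (1+|v|²)^{−1/2} w(t,x,v). -/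

import Mathlib

open MeasureTheory
open scoped ENNReal Real

noncomputable section

/-- `ℝ^n` with the Euclidean norm. -/
abbrev E (n : ℕ) : Type := EuclideanSpace ℝ (Fin n)
/-- `ℝ^{2n+1} = ℝ_t × ℝ^n_x × ℝ^n_v` with the Euclidean norm. -/
abbrev Z (n : ℕ) : Type := EuclideanSpace ℝ (Unit ⊕ Fin n ⊕ Fin n)

variable {n : ℕ}

/-- the `t` (resp. dual `τ`) coordinate -/
def tC (ζ : Z n) : ℝ := ζ (Sum.inl ())
/-- the `x` (resp. dual `ξ`) coordinates -/
def xC (ζ : Z n) : E n := WithLp.toLp 2 fun i => ζ (Sum.inr (Sum.inl i))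
/-- the `v` (resp. dual `η`) coordinates -/
def vC (ζ : Z n) : E n := WithLp.toLp 2 fun i => ζ (Sum.inr (Sum.inr i))

/-- the unit vector in the `t` direction -/
def eT : Z n := EuclideanSpace.single (Sum.inl ()) 1
/-- the unit vector in the `xᵢ` direction -/
def eX (i : Fin n) : Z n := EuclideanSpace.single (Sum.inr (Sum.inl i)) 1

/-- the symbol `F(η) = |η|^{2σ} w(η) + |η|² (1 - w(η))` -/
def Fsym (σ : ℝ) (w : E n → ℝ) (η : E n) : ℝ :=
  ‖η‖ ^ (2 * σ) * w η + ‖η‖ ^ 2 * (1 - w η)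

/-- the fractional Laplacian `(-Δ̃_v)^σ`, the Fourier multiplier with symbol `F(η)` -/
def fracLap (σ : ℝ) (w : E n → ℝ) (u : Z n → ℂ) : Z n → ℂ :=
  FourierTransformInv.fourierInv (fun ζ : Z n => (Fsym σ w (vC ζ) : ℂ) * FourierTransform.fourier u ζ)

/-- the kinetic operator `P = ∂_t + v⋅∂_x + a(t,x,v) (-Δ̃_v)^σ` -/
def Pop (σ : ℝ) (w : E n → ℝ) (a : Z n → ℝ) (u : Z n → ℂ) (z : Z n) : ℂ :=
  fderiv ℝ u z eT + ∑ i : Fin n, (vC z i : ℂ) * fderiv ℝ u z (eX i)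
    + (a z : ℂ) * fracLap σ w u z

open FourierTransform

open FourierTransform

section Generic
variable {V : Type*} [NormedAddCommGroup V] [InnerProductSpace ℝ V] [FiniteDimensional ℝ V]
  [MeasurableSpace V] [BorelSpace V]

/-- The `L²` Fourier transform agrees with the integral one on `L¹ ∩ L²`. -/
theorem fourier_toLp_ae {f : V → ℂ} (h1 : Integrable f) (h2 : MemLp f 2) :
    (𝓕 (h2.toLp f) : Lp ℂ 2 (volume : Measure V)) =ᵐ[volume] 𝓕 f := by
  have hcont : Continuous (𝓕 f) :=
    VectorFourier.fourierIntegral_continuous Real.continuous_fourierChar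
      (by exact continuous_inner) h1
  apply ae_eq_of_integral_contDiff_smul_eq
  · exact (Lp.memLp _).locallyIntegrable (by norm_num)
  · exact hcont.locallyIntegrable
  intro g hg hgc
  have hgC : ContDiff ℝ (⊤ : ℕ∞) (fun x => (g x : ℂ)) := Complex.ofRealCLM.contDiff.comp hg
  have hgcC : HasCompactSupport (fun x => (g x : ℂ)) := hgc.comp_left (g := fun r : ℝ => (r : ℂ)) rfl
  let φ : SchwartzMap V ℂ := hgcC.toSchwartzMap hgC
  have hφ : ∀ x, φ x = (g x : ℂ) := fun x => rfl
  have e1 := congrArg (fun T => T φ) (Lp.fourier_toTemperedDistribution_eq (h2.toLp f))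
  simp only [TemperedDistribution.fourier_apply, Lp.toTemperedDistribution_apply] at e1
  have e2 : ∫ x, (𝓕 φ) x • (h2.toLp f : V → ℂ) x = ∫ x, (𝓕 (φ : V → ℂ)) x * f x := by
    apply integral_congr_ae
    filter_upwards [h2.coeFn_toLp] with x hx
    rw [hx]; rfl
  have e3 := VectorFourier.integral_fourierIntegral_smul_eq_flip (μ := (volume : Measure V))
    (ν := (volume : Measure V)) (L := innerₗ V) (f := (φ : V → ℂ)) (g := f)
    Real.continuous_fourierChar (by exact continuous_inner) φ.integrable h1
  have e4 : ∫ x, (𝓕 (φ : V → ℂ)) x * f x = ∫ x, φ x * 𝓕 f x := by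
    have : (innerₗ V).flip = innerₗ V := flip_innerₗ V
    rw [this] at e3
    exact e3
  calc ∫ x, g x • (𝓕 (h2.toLp f) : Lp ℂ 2 (volume : Measure V)) x
      = ∫ x, φ x • (𝓕 (h2.toLp f) : Lp ℂ 2 (volume : Measure V)) x := by
        simp [hφ]
    _ = ∫ x, φ x * 𝓕 f x := by rw [← e1, e2, e4]
    _ = _ := by simp [hφ]

theorem planch {f : V → ℂ} (h1 : Integrable f) (h2 : MemLp f 2) :
    ∫⁻ ζ, ‖𝓕 f ζ‖ₑ ^ 2 = ∫⁻ x, ‖f x‖ₑ ^ 2 := by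
  have key : eLpNorm (𝓕 f) 2 volume = eLpNorm f 2 volume := by
    rw [← eLpNorm_congr_ae (fourier_toLp_ae h1 h2), ← eLpNorm_congr_ae h2.coeFn_toLp]
    have := Lp.norm_fourier_eq (h2.toLp f)
    rw [Lp.norm_def, Lp.norm_def] at this
    exact (ENNReal.toReal_eq_toReal_iff' (Lp.eLpNorm_ne_top _) (Lp.eLpNorm_ne_top _)).1 this
  have h := congrArg (fun r => r ^ 2) key
  simp only [eLpNorm_eq_lintegral_rpow_enorm_toReal (p := 2) (by norm_num) (by norm_num)] at h
  simp only [ENNReal.toReal_ofNat, ENNReal.rpow_ofNat, one_div] at h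
  simpa only [← ENNReal.rpow_natCast, ← ENNReal.rpow_mul, Nat.cast_ofNat, ne_eq,
    OfNat.ofNat_ne_zero, not_false_eq_true, inv_mul_cancel₀, ENNReal.rpow_one] using h

theorem planchInv {f : V → ℂ} (h1 : Integrable f) (h2 : MemLp f 2) :
    ∫⁻ ζ, ‖𝓕⁻ f ζ‖ₑ ^ 2 = ∫⁻ x, ‖f x‖ₑ ^ 2 := by
  rw [← planch h1 h2]
  simp_rw [Real.fourierInv_eq_fourier_neg]
  exact lintegral_neg_eq_self (fun x => ‖𝓕 f x‖ₑ ^ 2)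

theorem continuous_fourier {f : V → ℂ} (h1 : Integrable f) : Continuous (𝓕 f) :=
    VectorFourier.fourierIntegral_continuous Real.continuous_fourierChar
      (by exact continuous_inner) h1

theorem continuous_fourierInv {f : V → ℂ} (h1 : Integrable f) : Continuous (𝓕⁻ f) := by
  have : 𝓕⁻ f = fun x => 𝓕 f (-x) := by ext x; exact Real.fourierInv_eq_fourier_neg f x
  rw [this]; exact (continuous_fourier h1).comp continuous_neg

theorem eLpNorm_two_sq {f : V → ℂ} : eLpNorm f 2 volume ^ 2 = ∫⁻ x, ‖f x‖ₑ ^ 2 := by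
  rw [eLpNorm_eq_lintegral_rpow_enorm_toReal (p := 2) (by norm_num) (by norm_num)]
  simp only [ENNReal.toReal_ofNat, ENNReal.rpow_ofNat, one_div]
  simp only [← ENNReal.rpow_natCast, ← ENNReal.rpow_mul, Nat.cast_ofNat, ne_eq,
    OfNat.ofNat_ne_zero, not_false_eq_true, inv_mul_cancel₀, ENNReal.rpow_one]

end Generic

section STFT
open FourierTransform
variable {V : Type*} [NormedAddCommGroup V] [InnerProductSpace ℝ V] [FiniteDimensional ℝ V]
  [MeasurableSpace V] [BorelSpace V]

/-- short-time Fourier transform with window `χ` -/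
def STF (χ : SchwartzMap V ℂ) (q : V → ℂ) (p ζ : V) : ℂ := 𝓕 (fun y => χ (y - p) * q y) ζ

theorem STF_fourierInv (χ : SchwartzMap V ℂ) {q : V → ℂ} (hq : Integrable q) (p ζ : V) :
    STF χ (𝓕⁻ q) p ζ = 𝓕 (fun θ => q (ζ - θ) * 𝓕 (χ : V → ℂ) θ) p := by
  let K : V → ℂ := fun y => Real.fourierChar (-inner ℝ y ζ) • χ (y - p)
  have hχp : Integrable (fun y => χ (y - p)) := χ.integrable.comp_sub_right p
  have hK : Integrable K := (Real.fourierIntegral_convergent_iff (μ := volume) ζ).2 hχp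
  have e3 := VectorFourier.integral_fourierIntegral_smul_eq_flip (μ := (volume : Measure V))
    (ν := (volume : Measure V)) (L := -innerₗ V) (f := q) (g := K)
    Real.continuous_fourierChar (by exact (continuous_inner (𝕜 := ℝ) (E := V)).neg) hq hK
  have hfl : (-innerₗ V).flip = -innerₗ V := by
    ext x y; simp [real_inner_comm]
  rw [hfl] at e3
  have eK : ∀ ζ', VectorFourier.fourierIntegral Real.fourierChar volume (-innerₗ V) K ζ'
      = Real.fourierChar (inner ℝ p (ζ' - ζ)) • 𝓕 (χ : V → ℂ) (ζ - ζ') := by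
    intro ζ'
    simp only [VectorFourier.fourierIntegral, K]
    rw [Real.fourier_eq, ← integral_add_right_eq_self _ p, Circle.smul_def, smul_eq_mul,
      ← integral_const_mul]
    congr 1; ext y
    rw [← smul_eq_mul, ← Circle.smul_def]
    simp only [LinearMap.neg_apply, innerₗ_apply_apply, add_sub_cancel_right, neg_neg, smul_smul,
      ← AddChar.map_add_eq_mul]
    congr 2
    simp only [inner_add_left, inner_sub_right]; ring
  have eq : ∀ y, VectorFourier.fourierIntegral Real.fourierChar volume (-innerₗ V) q y = 𝓕⁻ q y := by
    intro y; rw [Real.fourierInv_eq]; simp [VectorFourier.fourierIntegral]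
  simp only [eK, eq] at e3
  calc STF χ (𝓕⁻ q) p ζ = ∫ y, 𝓕⁻ q y • K y := by
        simp only [STF, Real.fourier_eq, K]
        congr 1; ext y
        simp only [Circle.smul_def, smul_eq_mul]; ring
    _ = _ := e3
    _ = _ := by
      rw [← integral_sub_left_eq_self _ volume ζ, Real.fourier_eq]
      congr 1; ext θ
      simp only [Circle.smul_def, smul_eq_mul, sub_sub_cancel, real_inner_comm p]
      rw [show ζ - θ - ζ = -θ by abel, inner_neg_right]; ring

theorem STF_comm_eq (χ : SchwartzMap V ℂ) {q₁ q₂ : V → ℂ} (h1 : Integrable q₁) (h1' : MemLp q₁ 2)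
    (h2 : Integrable q₂) (h2' : MemLp q₂ 2) (ψ : ℂ) (ζ : V) :
    ∫⁻ p, ‖ψ * STF χ (𝓕⁻ q₁) p ζ - STF χ (𝓕⁻ q₂) p ζ‖ₑ ^ 2 =
      ∫⁻ θ, ‖ψ * q₁ (ζ - θ) - q₂ (ζ - θ)‖ₑ ^ 2 * ‖𝓕 (χ : V → ℂ) θ‖ₑ ^ 2 := by
  have hb : ∃ C, ∀ θ, ‖(𝓕 χ : SchwartzMap V ℂ) θ‖ ≤ C :=
    ⟨_, fun θ => SchwartzMap.norm_le_seminorm ℝ _ θ⟩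
  obtain ⟨C, hC⟩ := hb
  have hcoe : ((𝓕 χ : SchwartzMap V ℂ) : V → ℂ) = 𝓕 (χ : V → ℂ) := SchwartzMap.fourier_coe χ
  have hmeas : AEStronglyMeasurable (𝓕 (χ : V → ℂ)) volume :=
    (continuous_fourier χ.integrable).aestronglyMeasurable
  have hC' : ∀ᵐ θ ∂(volume : Measure V), ‖𝓕 (χ : V → ℂ) θ‖ ≤ C := by
    rw [← hcoe]; exact Filter.Eventually.of_forall hC
  have A : ∀ q : V → ℂ, Integrable q → Integrable (fun θ => q (ζ - θ) * 𝓕 (χ : V → ℂ) θ) := by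
    intro q hq
    exact (hq.comp_sub_left ζ).mul_bdd hmeas hC'
  have B : ∀ q : V → ℂ, MemLp q 2 → MemLp (fun θ => q (ζ - θ) * 𝓕 (χ : V → ℂ) θ) 2 := by
    intro q hq
    have hq' : MemLp (fun θ => q (ζ - θ)) 2 :=
      hq.comp_measurePreserving (Measure.measurePreserving_sub_left volume ζ)
    refine hq'.of_le_mul (c := C) (hq'.1.mul hmeas) ?_
    filter_upwards [hC'] with θ h
    rw [norm_mul, mul_comm]
    exact mul_le_mul_of_nonneg_right h (norm_nonneg _)
  have e : ∀ p, ψ * STF χ (𝓕⁻ q₁) p ζ - STF χ (𝓕⁻ q₂) p ζ =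
      𝓕 (fun θ => ψ * (q₁ (ζ - θ) * 𝓕 (χ : V → ℂ) θ) - q₂ (ζ - θ) * 𝓕 (χ : V → ℂ) θ) p := by
    intro p
    rw [STF_fourierInv χ h1, STF_fourierInv χ h2]
    generalize 𝓕 (χ : V → ℂ) = X at A
    simp only [Real.fourier_eq, Circle.smul_def, smul_eq_mul]
    rw [← integral_const_mul, ← integral_sub]
    · congr 1; ext θ; ring
    · have := (Real.fourierIntegral_convergent_iff (μ := volume) p).2 (A q₁ h1)
      simp only [Circle.smul_def, smul_eq_mul] at this
      exact this.const_mul ψ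
    · have := (Real.fourierIntegral_convergent_iff (μ := volume) p).2 (A q₂ h2)
      simpa only [Circle.smul_def, smul_eq_mul] using this
  simp_rw [e]
  have pl := planch (((A q₁ h1).const_mul ψ).sub (A q₂ h2)) (((B q₁ h1').const_mul ψ).sub (B q₂ h2'))
  refine pl.trans ?_
  congr 1; ext θ
  rw [← mul_pow, ← enorm_mul]
  simp only [Pi.sub_apply]
  congr 2; ring

/-- second moment constant of the window -/
def winK (χ : SchwartzMap V ℂ) : ℝ≥0∞ :=
  ∫⁻ θ, ENNReal.ofReal ((1 + ‖θ‖ ^ 2) ^ 2) * ‖𝓕 (χ : V → ℂ) θ‖ₑ ^ 2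

/-- mass of the window -/
def winc (χ : SchwartzMap V ℂ) : ℝ≥0∞ := ∫⁻ y, ‖χ y‖ₑ ^ 2

theorem winc_fourier (χ : SchwartzMap V ℂ) : ∫⁻ θ, ‖𝓕 (χ : V → ℂ) θ‖ₑ ^ 2 = winc χ :=
  planch χ.integrable (χ.memLp 2)

theorem lintegral_conv_sq {r : V → ℝ≥0∞} (hr : Measurable r)
    {k : V → ℝ≥0∞} (hk : Measurable k) :
    ∫⁻ ζ, ∫⁻ θ, r (ζ - θ) * k θ = (∫⁻ θ, k θ) * ∫⁻ ζ, r ζ := by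
  rw [lintegral_lintegral_swap]
  · have : ∀ θ, ∫⁻ ζ, r (ζ - θ) * k θ = (∫⁻ ζ, r ζ) * k θ := by
      intro θ
      have hm : Measurable fun ζ => r (ζ - θ) := hr.comp (measurable_id.sub_const θ)
      rw [lintegral_mul_const _ hm,
        lintegral_sub_right_eq_self r θ]
    simp_rw [this]
    rw [lintegral_const_mul _ hk, mul_comm]
  · exact ((hr.comp (measurable_fst.sub measurable_snd)).mul (hk.comp measurable_snd)).aemeasurable

theorem lintegral_conv_two {r₁ k₁ r₂ k₂ : V → ℝ≥0∞} (hr1 : Measurable r₁) (hk1 : Measurable k₁)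
    (hr2 : Measurable r₂) (hk2 : Measurable k₂) {c₁ c₂ : ℝ≥0∞} :
    ∫⁻ ζ, ∫⁻ θ, (c₁ * (r₁ (ζ - θ) * k₁ θ) + c₂ * (r₂ (ζ - θ) * k₂ θ)) =
      c₁ * ((∫⁻ θ, k₁ θ) * ∫⁻ ζ, r₁ ζ) + c₂ * ((∫⁻ θ, k₂ θ) * ∫⁻ ζ, r₂ ζ) := by
  have m1 : Measurable (fun x : V × V => r₁ (x.1 - x.2) * k₁ x.2) :=
    (hr1.comp (measurable_fst.sub measurable_snd)).mul (hk1.comp measurable_snd)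
  have m2 : Measurable (fun x : V × V => r₂ (x.1 - x.2) * k₂ x.2) :=
    (hr2.comp (measurable_fst.sub measurable_snd)).mul (hk2.comp measurable_snd)
  have a1 : ∀ ζ, ∫⁻ θ, (c₁ * (r₁ (ζ - θ) * k₁ θ) + c₂ * (r₂ (ζ - θ) * k₂ θ)) =
      c₁ * (∫⁻ θ, r₁ (ζ - θ) * k₁ θ) + c₂ * ∫⁻ θ, r₂ (ζ - θ) * k₂ θ := by
    intro ζ
    have n1 : Measurable fun θ => r₁ (ζ - θ) * k₁ θ := m1.comp (measurable_prodMk_left (x := ζ))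
    have n2 : Measurable fun θ => r₂ (ζ - θ) * k₂ θ := m2.comp (measurable_prodMk_left (x := ζ))
    rw [lintegral_add_left (n1.const_mul _), lintegral_const_mul _ n1, lintegral_const_mul _ n2]
  simp_rw [a1]
  have p1 : Measurable fun ζ => ∫⁻ θ, r₁ (ζ - θ) * k₁ θ := m1.lintegral_prod_right'
  have p2 : Measurable fun ζ => ∫⁻ θ, r₂ (ζ - θ) * k₂ θ := m2.lintegral_prod_right'
  rw [lintegral_add_left (p1.const_mul _), lintegral_const_mul _ p1,
        lintegral_const_mul _ p2, lintegral_conv_sq hr1 hk1, lintegral_conv_sq hr2 hk2]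

theorem STF_comm_le (χ : SchwartzMap V ℂ) {q : V → ℂ} (hqc : Continuous q) (h1 : Integrable q)
    (h1' : MemLp q 2) (ψ N : V → ℝ) (hN : Continuous N)
    (h2 : Integrable (fun ζ => (ψ ζ : ℂ) * q ζ)) (h2' : MemLp (fun ζ => (ψ ζ : ℂ) * q ζ) 2)
    (ε C : ℝ) (hε : 0 ≤ ε) (hC : 0 ≤ C) (hN0 : ∀ ζ, 0 ≤ N ζ)
    (hd : ∀ ζ ζ', |ψ ζ - ψ ζ'| ≤ ε * N ζ' + C * (1 + ‖ζ - ζ'‖ ^ 2)) :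
    ∫⁻ ζ, ∫⁻ p, ‖(ψ ζ : ℂ) * STF χ (𝓕⁻ q) p ζ - STF χ (𝓕⁻ (fun ζ => (ψ ζ : ℂ) * q ζ)) p ζ‖ₑ ^ 2 ≤
      ENNReal.ofReal (2 * ε ^ 2) * winc χ * (∫⁻ ζ, ‖(N ζ : ℂ) * q ζ‖ₑ ^ 2) +
      ENNReal.ofReal (2 * C ^ 2) * winK χ * ∫⁻ ζ, ‖q ζ‖ₑ ^ 2 := by
  simp_rw [STF_comm_eq χ h1 h1' h2 h2']
  have hfm : Measurable (fun θ => ‖𝓕 (χ : V → ℂ) θ‖ₑ ^ 2) :=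
    ((continuous_fourier χ.integrable).measurable.enorm).pow_const 2
  have hkm : Measurable (fun θ : V => ENNReal.ofReal ((1 + ‖θ‖ ^ 2) ^ 2) * ‖𝓕 (χ : V → ℂ) θ‖ₑ ^ 2) := by
    refine Measurable.mul ?_ hfm
    exact ENNReal.measurable_ofReal.comp (by fun_prop)
  have hr1 : Measurable (fun ζ => ‖(N ζ : ℂ) * q ζ‖ₑ ^ 2) := by
    have : Continuous fun ζ => (N ζ : ℂ) * q ζ := by fun_prop
    exact this.measurable.enorm.pow_const 2
  have hr2 : Measurable (fun ζ => ‖q ζ‖ₑ ^ 2) := hqc.measurable.enorm.pow_const 2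
  have point : ∀ ζ θ : V, ‖(ψ ζ : ℂ) * q (ζ - θ) - (ψ (ζ - θ) : ℂ) * q (ζ - θ)‖ₑ ^ 2
        * ‖𝓕 (χ : V → ℂ) θ‖ₑ ^ 2 ≤
      ENNReal.ofReal (2 * ε ^ 2) * (‖(N (ζ - θ) : ℂ) * q (ζ - θ)‖ₑ ^ 2 * ‖𝓕 (χ : V → ℂ) θ‖ₑ ^ 2) +
      ENNReal.ofReal (2 * C ^ 2) * (‖q (ζ - θ)‖ₑ ^ 2 *
        (ENNReal.ofReal ((1 + ‖θ‖ ^ 2) ^ 2) * ‖𝓕 (χ : V → ℂ) θ‖ₑ ^ 2)) := by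
    intro ζ θ
    have hr : ‖(ψ ζ : ℂ) * q (ζ - θ) - (ψ (ζ - θ) : ℂ) * q (ζ - θ)‖ ^ 2 ≤
        (2 * ε ^ 2) * ‖(N (ζ - θ) : ℂ) * q (ζ - θ)‖ ^ 2 +
          (2 * C ^ 2) * (‖q (ζ - θ)‖ ^ 2 * (1 + ‖θ‖ ^ 2) ^ 2) := by
      have h := hd ζ (ζ - θ)
      rw [sub_sub_cancel] at h
      rw [← sub_mul, ← Complex.ofReal_sub, norm_mul, norm_mul, Complex.norm_real, Complex.norm_real,
        Real.norm_eq_abs, Real.norm_eq_abs, mul_pow, mul_pow, sq_abs (N _)]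
      have h2 : |ψ ζ - ψ (ζ - θ)| ^ 2 ≤ 2 * ε ^ 2 * N (ζ - θ) ^ 2 + 2 * C ^ 2 * (1 + ‖θ‖ ^ 2) ^ 2 := by
        have := pow_le_pow_left₀ (abs_nonneg _) h 2
        nlinarith [sq_nonneg (ε * N (ζ - θ) - C * (1 + ‖θ‖ ^ 2))]
      nlinarith [mul_le_mul_of_nonneg_right h2 (sq_nonneg ‖q (ζ - θ)‖)]
    have he : ∀ z : ℂ, ‖z‖ₑ ^ 2 = ENNReal.ofReal (‖z‖ ^ 2) := by
      intro z; rw [ENNReal.ofReal_pow (norm_nonneg _), ofReal_norm]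
    have h3 := ENNReal.ofReal_le_ofReal hr
    rw [ENNReal.ofReal_add (by positivity) (by positivity), ENNReal.ofReal_mul (p := 2 * ε ^ 2) (by positivity),
      ENNReal.ofReal_mul (p := 2 * C ^ 2) (by positivity), ENNReal.ofReal_mul (p := ‖q (ζ - θ)‖ ^ 2) (by positivity), ← he, ← he, ← he] at h3
    calc _ ≤ _ := mul_le_mul_left h3 _
      _ = _ := by ring
  calc _ ≤ ∫⁻ ζ, ∫⁻ θ, (ENNReal.ofReal (2 * ε ^ 2) * (‖(N (ζ - θ) : ℂ) * q (ζ - θ)‖ₑ ^ 2 * ‖𝓕 (χ : V → ℂ) θ‖ₑ ^ 2) +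
      ENNReal.ofReal (2 * C ^ 2) * (‖q (ζ - θ)‖ₑ ^ 2 *
        (ENNReal.ofReal ((1 + ‖θ‖ ^ 2) ^ 2) * ‖𝓕 (χ : V → ℂ) θ‖ₑ ^ 2))) :=
        lintegral_mono fun ζ => lintegral_mono fun θ => point ζ θ
    _ = _ := by
      rw [lintegral_conv_two (r₁ := fun ζ => ‖(N ζ : ℂ) * q ζ‖ₑ ^ 2) (r₂ := fun ζ => ‖q ζ‖ₑ ^ 2)
        hr1 hfm hr2 hkm, winc_fourier, winK]
      ring

theorem STF_total (χ : SchwartzMap V ℂ) {q : V → ℂ} (hqc : Continuous q) (h1 : Integrable q)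
    (h1' : MemLp q 2) :
    ∫⁻ ζ, ∫⁻ p, ‖STF χ (𝓕⁻ q) p ζ‖ₑ ^ 2 = winc χ * ∫⁻ ζ, ‖q ζ‖ₑ ^ 2 := by
  have := fun ζ => STF_comm_eq χ (integrable_zero V ℂ volume) MemLp.zero h1 h1' 0 ζ
  simp only [zero_mul, zero_sub, enorm_neg] at this
  simp_rw [this]
  rw [lintegral_conv_sq (hqc.measurable.enorm.pow_const 2)
    ((continuous_fourier χ.integrable).measurable.enorm.pow_const 2), winc_fourier]

theorem STF_window_le (χ : SchwartzMap V ℂ) {F : V → ℂ} (hF : Continuous F) (hF2 : MemLp F 2)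
    {k : V → V → ℂ} (hk : Continuous (Function.uncurry k)) (κ : ℝ) (hκ0 : 0 ≤ κ)
    (hκ : ∀ p y, χ (y - p) ≠ 0 → ‖k p y‖ ≤ κ) :
    ∫⁻ p, ∫⁻ ζ, ‖STF χ (fun y => k p y * F y) p ζ‖ₑ ^ 2 ≤
      ENNReal.ofReal (κ ^ 2) * winc χ * ∫⁻ y, ‖F y‖ₑ ^ 2 := by
  have hb : ∃ C, ∀ θ, ‖χ θ‖ ≤ C := ⟨_, fun θ => SchwartzMap.norm_le_seminorm ℝ _ θ⟩
  obtain ⟨C, hC⟩ := hb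
  have hkp : ∀ p, Continuous (k p) := fun p => hk.comp (Continuous.prodMk_right p)
  have hχp : ∀ p, Continuous fun y => χ (y - p) := fun p => χ.continuous.comp (continuous_id.sub continuous_const)
  have hχk : ∀ p y, ‖χ (y - p) * k p y‖ ≤ κ * ‖χ (y - p)‖ := by
    intro p y
    rw [norm_mul, mul_comm]
    by_cases h : χ (y - p) = 0
    · simp [h]
    · exact mul_le_mul_of_nonneg_right (hκ p y h) (norm_nonneg _)
  have h0 : ∀ p, MemLp (fun y => χ (y - p)) 2 := fun p =>
      (χ.memLp 2).comp_measurePreserving (measurePreserving_sub_right volume p)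
  have h1 : ∀ p, MemLp (fun y => χ (y - p) * k p y) 2 := fun p =>
    (h0 p).of_le_mul (c := κ) ((hχp p).mul (hkp p)).aestronglyMeasurable
      (Filter.Eventually.of_forall (hχk p))
  have hC0 : 0 ≤ C := (norm_nonneg _).trans (hC 0)
  have hI : ∀ p, Integrable (fun y => χ (y - p) * (k p y * F y)) := by
    intro p
    have := (h1 p).integrable_mul hF2
    refine this.congr (Filter.Eventually.of_forall fun y => ?_)
    simp [mul_assoc]
  have hM : ∀ p, MemLp (fun y => χ (y - p) * (k p y * F y)) 2 := by
    intro p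
    refine hF2.of_le_mul (c := κ * C) ((hχp p).mul ((hkp p).mul hF)).aestronglyMeasurable
      (Filter.Eventually.of_forall fun y => ?_)
    rw [← mul_assoc, norm_mul]
    refine mul_le_mul_of_nonneg_right ((hχk p y).trans ?_) (norm_nonneg _)
    exact mul_le_mul_of_nonneg_left (hC _) hκ0
  have hle : ∀ p, ∫⁻ ζ, ‖STF χ (fun y => k p y * F y) p ζ‖ₑ ^ 2 ≤
      ∫⁻ y, ENNReal.ofReal (κ ^ 2) * (‖χ (y - p)‖ₑ ^ 2 * ‖F y‖ₑ ^ 2) := by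
    intro p
    refine (planch (hI p) (hM p)).le.trans (lintegral_mono fun y => ?_)
    rw [← mul_pow, ENNReal.ofReal_pow hκ0, ← mul_pow, ← mul_assoc (χ _), enorm_mul, ← mul_assoc]
    gcongr
    rw [← ofReal_norm, ← ofReal_norm, ← ENNReal.ofReal_mul hκ0]
    exact ENNReal.ofReal_le_ofReal (hχk p y)
  refine (lintegral_mono hle).trans ?_
  have mm : Measurable fun x : V × V => ENNReal.ofReal (κ ^ 2) * (‖χ (x.2 - x.1)‖ₑ ^ 2 * ‖F x.2‖ₑ ^ 2) := by
    have c1 : Continuous fun x : V × V => χ (x.2 - x.1) := χ.continuous.comp (by fun_prop)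
    have c2 : Continuous fun x : V × V => F x.2 := hF.comp (by fun_prop)
    exact ((c1.measurable.enorm.pow_const 2).mul (c2.measurable.enorm.pow_const 2)).const_mul _
  rw [lintegral_lintegral_swap mm.aemeasurable]
  have e : ∀ y, ∫⁻ p, ENNReal.ofReal (κ ^ 2) * (‖χ (y - p)‖ₑ ^ 2 * ‖F y‖ₑ ^ 2) =
      (ENNReal.ofReal (κ ^ 2) * winc χ) * ‖F y‖ₑ ^ 2 := by
    intro y
    have c1 : Measurable fun p : V => ‖χ (y - p)‖ₑ ^ 2 :=
      (χ.continuous.comp (continuous_const.sub continuous_id)).measurable.enorm.pow_const 2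
    rw [lintegral_const_mul _ (c1.mul_const _), lintegral_mul_const _ c1,
      lintegral_sub_left_eq_self (fun y => ‖χ y‖ₑ ^ 2) y, ← mul_assoc]
    rfl
  simp_rw [e]
  rw [lintegral_const_mul _ (hF.measurable.enorm.pow_const 2)]
end STFT

section decay
open FourierTransform
variable {V : Type*} [NormedAddCommGroup V] [InnerProductSpace ℝ V] [FiniteDimensional ℝ V]
  [MeasurableSpace V] [BorelSpace V]

theorem sz_decay {V : Type*} [NormedAddCommGroup V] [NormedSpace ℝ V]
    (f : SchwartzMap V ℂ) (k : ℕ) : ∃ C, 0 ≤ C ∧ ∀ x, (1 + ‖x‖) ^ k * ‖f x‖ ≤ C := by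
  have h := fun x => SchwartzMap.one_add_le_sup_seminorm_apply (𝕜 := ℝ) (m := (k, 0)) (k := k) (n := 0)
    le_rfl le_rfl f x
  simp only [norm_iteratedFDeriv_zero] at h
  exact ⟨_, le_trans (by positivity) (h 0), h⟩

/-- an integrable weight -/
def wt (x : V) : ℝ := ((1 + ‖x‖) ^ (Module.finrank ℝ V + 1))⁻¹

theorem wt_pos (x : V) : 0 < wt x := by unfold wt; positivity

theorem wt_le_one (x : V) : wt x ≤ 1 := by
  unfold wt
  exact inv_le_one_of_one_le₀ (one_le_pow₀ (by linarith [norm_nonneg x]))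

theorem wt_integrable : Integrable (wt : V → ℝ) := by
  have h := integrable_one_add_norm (μ := (volume : Measure V)) (r := (Module.finrank ℝ V + 1 : ℕ))
    (by exact_mod_cast Nat.lt_succ_self _)
  refine h.congr (Filter.Eventually.of_forall fun x => ?_)
  simp only [wt]
  rw [Real.rpow_neg (by positivity), Real.rpow_natCast]

theorem wt_memLp : MemLp (wt : V → ℝ) 2 := by
  have hi := wt_integrable (V := V)
  refine (memLp_two_iff_integrable_sq hi.1).2 (hi.mono' (hi.1.pow 2) (Filter.Eventually.of_forall fun x => ?_))
  rw [Real.norm_eq_abs, abs_of_nonneg (by positivity), sq]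
  exact mul_le_of_le_one_left (wt_pos x).le (wt_le_one x)

theorem sz_mul (f : SchwartzMap V ℂ) {M : V → ℂ} (hM : Continuous M) (C : ℝ) (k : ℕ)
    (h : ∀ x, ‖M x‖ ≤ C * (1 + ‖x‖) ^ k) :
    Integrable (fun x => M x * f x) ∧ MemLp (fun x => M x * f x) 2 := by
  obtain ⟨D, hD, hf⟩ := sz_decay f (k + (Module.finrank ℝ V + 1))
  have key : ∀ x, ‖M x * f x‖ ≤ C * D * ‖wt x‖ := by
    intro x
    have hC : 0 ≤ C := by
      have := (norm_nonneg _).trans (h 0)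
      simpa using this
    rw [norm_mul, Real.norm_eq_abs, abs_of_pos (wt_pos x)]
    unfold wt
    rw [← div_eq_mul_inv, le_div_iff₀ (by positivity)]
    have h1 := hf x
    rw [pow_add] at h1
    calc ‖M x‖ * ‖f x‖ * (1 + ‖x‖) ^ (Module.finrank ℝ V + 1)
        ≤ (C * (1 + ‖x‖) ^ k) * ‖f x‖ * (1 + ‖x‖) ^ (Module.finrank ℝ V + 1) := by
          gcongr; exact h x
      _ = C * ((1 + ‖x‖) ^ k * (1 + ‖x‖) ^ (Module.finrank ℝ V + 1) * ‖f x‖) := by ring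
      _ ≤ C * D := by gcongr
  have hm : AEStronglyMeasurable (fun x => M x * f x) volume := (hM.mul f.continuous).aestronglyMeasurable
  exact ⟨(wt_integrable.norm.const_mul (C * D)).mono' hm (Filter.Eventually.of_forall key),
    wt_memLp.of_le_mul hm (Filter.Eventually.of_forall key)⟩

theorem memLp_lt_top {f : V → ℂ} (h : MemLp f 2) : ∫⁻ x, ‖f x‖ₑ ^ 2 < ∞ := by
  rw [← eLpNorm_two_sq]
  exact ENNReal.pow_lt_top h.2

theorem winc_lt_top (χ : SchwartzMap V ℂ) : winc χ < ∞ := memLp_lt_top (χ.memLp 2)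

theorem winK_lt_top (χ : SchwartzMap V ℂ) : winK χ < ∞ := by
  have h := sz_mul (𝓕 χ : SchwartzMap V ℂ) (M := fun θ => ((1 + ‖θ‖ ^ 2 : ℝ) : ℂ)) (by fun_prop) 1 2 (by
    intro x
    rw [Complex.norm_real, Real.norm_eq_abs, abs_of_pos (by positivity)]
    nlinarith [norm_nonneg x])
  have h2 := memLp_lt_top h.2
  rw [SchwartzMap.fourier_coe] at h2
  refine lt_of_eq_of_lt (lintegral_congr fun θ => ?_) h2
  rw [enorm_mul, mul_pow]
  congr 1
  rw [← ofReal_norm, Complex.norm_real, Real.norm_eq_abs, abs_of_pos (by positivity),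
    ENNReal.ofReal_pow (by positivity)]

theorem continuous_fourier_param {X : Type*} [TopologicalSpace X] [FirstCountableTopology X]
    {f : X → V → ℂ} {ζ : X → V} (hζ : Continuous ζ) (hf : Continuous (Function.uncurry f))
    {bd : V → ℝ} (hbd : Integrable bd) (h : ∀ x a, ‖f x a‖ ≤ bd a) :
    Continuous fun x => 𝓕 (f x) (ζ x) := by
  simp only [Real.fourier_eq]
  have hc : Continuous fun p : X × V => Real.fourierChar (-inner ℝ p.2 (ζ p.1)) • f p.1 p.2 := by
    have h1 : Continuous fun p : X × V => -inner ℝ p.2 (ζ p.1) := by fun_prop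
    exact (Real.continuous_fourierChar.comp h1).smul hf
  refine continuous_of_dominated (bound := bd) ?_ ?_ hbd ?_
  · intro x
    exact (hc.comp (Continuous.prodMk_right x)).aestronglyMeasurable
  · intro x
    refine Filter.Eventually.of_forall fun a => ?_
    rw [Circle.norm_smul]; exact h x a
  · refine Filter.Eventually.of_forall fun a => ?_
    exact hc.comp (Continuous.prodMk_left a)

end decay

section split
open FourierTransform
variable {W₁ W₂ Q : Type*} [NormedAddCommGroup W₁] [InnerProductSpace ℝ W₁] [FiniteDimensional ℝ W₁]
  [MeasurableSpace W₁] [BorelSpace W₁] [NormedAddCommGroup W₂] [InnerProductSpace ℝ W₂]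
  [FiniteDimensional ℝ W₂] [MeasurableSpace W₂] [BorelSpace W₂]
  [NormedAddCommGroup Q] [InnerProductSpace ℝ Q] [FiniteDimensional ℝ Q]
  [MeasurableSpace Q] [BorelSpace Q]

/-- the point with split coordinates `a`, `b` -/
def Jm (J : WithLp 2 (W₁ × W₂) ≃ₗᵢ[ℝ] Q) (a : W₁) (b : W₂) : Q := J (WithLp.toLp 2 (a, b))

/-- first coordinate -/
def J1 (J : WithLp 2 (W₁ × W₂) ≃ₗᵢ[ℝ] Q) (z : Q) : W₁ := (J.symm z).fst

variable (J : WithLp 2 (W₁ × W₂) ≃ₗᵢ[ℝ] Q)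

@[simp] theorem J1_Jm (a : W₁) (b : W₂) : J1 J (Jm J a b) = a := by simp [J1, Jm]

theorem continuous_Jm : Continuous fun p : W₁ × W₂ => Jm J p.1 p.2 :=
  J.continuous.comp (by fun_prop)

theorem continuous_J1 : Continuous (J1 J) := by
  unfold J1
  exact (WithLp.prod_continuous_ofLp 2 W₁ W₂ |>.fst).comp J.symm.continuous

theorem inner_Jm (a c : W₁) (b d : W₂) : inner ℝ (Jm J a b) (Jm J c d) = inner ℝ a c + inner ℝ b d := by
  rw [Jm, Jm, J.inner_map_map, WithLp.prod_inner_apply]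

theorem norm_Jm_sq (a : W₁) (b : W₂) : ‖Jm J a b‖ ^ 2 = ‖a‖ ^ 2 + ‖b‖ ^ 2 := by
  rw [← real_inner_self_eq_norm_sq, inner_Jm, real_inner_self_eq_norm_sq, real_inner_self_eq_norm_sq]

theorem norm_le_Jm_left (a : W₁) (b : W₂) : ‖a‖ ≤ ‖Jm J a b‖ := by
  refine (sq_le_sq₀ (norm_nonneg _) (norm_nonneg _)).1 ?_
  rw [norm_Jm_sq]; nlinarith [sq_nonneg ‖b‖]

theorem norm_le_Jm_right (a : W₁) (b : W₂) : ‖b‖ ≤ ‖Jm J a b‖ := by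
  refine (sq_le_sq₀ (norm_nonneg _) (norm_nonneg _)).1 ?_
  rw [norm_Jm_sq]; nlinarith [sq_nonneg ‖a‖]

theorem mp_Jm : MeasurePreserving (fun p : W₁ × W₂ => Jm J p.1 p.2) (volume.prod volume) volume :=
  J.measurePreserving.comp (WithLp.volume_preserving_toLp W₁ W₂)

theorem lintegral_Jm {f : Q → ℝ≥0∞} (hf : Measurable f) :
    ∫⁻ z, f z = ∫⁻ a, ∫⁻ b, f (Jm J a b) := by
  rw [← (mp_Jm J).lintegral_comp hf]
  exact lintegral_prod _ (hf.comp (continuous_Jm J).measurable).aemeasurable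

theorem lintegral_Jm' {f : Q → ℝ≥0∞} (hf : Measurable f) :
    ∫⁻ z, f z = ∫⁻ b, ∫⁻ a, f (Jm J a b) := by
  rw [← (mp_Jm J).lintegral_comp hf]
  exact lintegral_prod_symm _ (hf.comp (continuous_Jm J).measurable).aemeasurable

theorem measEmb_Jm : MeasurableEmbedding (fun p : W₁ × W₂ => Jm J p.1 p.2) :=
  (J.toHomeomorph.measurableEmbedding).comp (WithLp.homeomorphProd 2 W₁ W₂).symm.measurableEmbedding

theorem integrable_Jm {f : Q → ℂ} (hf : Integrable f) :
    Integrable (fun p : W₁ × W₂ => f (Jm J p.1 p.2)) (volume.prod volume) :=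
  (mp_Jm J).integrable_comp_of_integrable hf

theorem integral_Jm {f : Q → ℂ} (hf : Integrable f) :
    ∫ z, f z = ∫ a, ∫ b, f (Jm J a b) := by
  rw [← (mp_Jm J).integral_comp (measEmb_Jm J)]
  exact integral_prod _ (integrable_Jm J hf)

theorem integral_Jm' {f : Q → ℂ} (hf : Integrable f) :
    ∫ z, f z = ∫ b, ∫ a, f (Jm J a b) := by
  rw [← (mp_Jm J).integral_comp (measEmb_Jm J)]
  exact integral_prod_symm _ (integrable_Jm J hf)
end split

section split2
open FourierTransform
variable {W₁ W₂ Q : Type*} [NormedAddCommGroup W₁] [InnerProductSpace ℝ W₁] [FiniteDimensional ℝ W₁]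
  [MeasurableSpace W₁] [BorelSpace W₁] [NormedAddCommGroup W₂] [InnerProductSpace ℝ W₂]
  [FiniteDimensional ℝ W₂] [MeasurableSpace W₂] [BorelSpace W₂]
  [NormedAddCommGroup Q] [InnerProductSpace ℝ Q] [FiniteDimensional ℝ Q]
  [MeasurableSpace Q] [BorelSpace Q]
variable (J : WithLp 2 (W₁ × W₂) ≃ₗᵢ[ℝ] Q)

theorem slice_tg (b : W₂) : Function.HasTemperateGrowth (fun a : W₁ => Jm J a b) := by
  have e : (fun a : W₁ => Jm J a b) = fun a => (J.toContinuousLinearEquiv.toContinuousLinearMap ∘L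
      ((WithLp.prodContinuousLinearEquiv 2 ℝ W₁ W₂).symm.toContinuousLinearMap ∘L
        ContinuousLinearMap.inl ℝ W₁ W₂)) a + Jm J 0 b := by
    ext1 a
    simp only [Jm, ContinuousLinearMap.comp_apply, ContinuousLinearMap.inl_apply]
    change _ = J (WithLp.toLp 2 (a, 0)) + _
    rw [← map_add, ← WithLp.toLp_add]; simp
  rw [e]
  exact (ContinuousLinearMap.hasTemperateGrowth _).add (Function.HasTemperateGrowth.const _)

theorem slice_tg' (a : W₁) : Function.HasTemperateGrowth (fun b : W₂ => Jm J a b) := by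
  have e : (fun b : W₂ => Jm J a b) = fun b => (J.toContinuousLinearEquiv.toContinuousLinearMap ∘L
      ((WithLp.prodContinuousLinearEquiv 2 ℝ W₁ W₂).symm.toContinuousLinearMap ∘L
        ContinuousLinearMap.inr ℝ W₁ W₂)) b + Jm J a 0 := by
    ext1 b
    simp only [Jm, ContinuousLinearMap.comp_apply, ContinuousLinearMap.inr_apply]
    change _ = J (WithLp.toLp 2 (0, b)) + _
    rw [← map_add, ← WithLp.toLp_add]; simp
  rw [e]
  exact (ContinuousLinearMap.hasTemperateGrowth _).add (Function.HasTemperateGrowth.const _)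

/-- restriction to the slice of second coordinate `b` -/
def slice (u : SchwartzMap Q ℂ) (b : W₂) : SchwartzMap W₁ ℂ :=
  SchwartzMap.compCLM ℝ (slice_tg J b)
    ⟨1, 1, fun a => by have := norm_le_Jm_left J a b; simp; linarith⟩ u

/-- restriction to the slice of first coordinate `a` -/
def slice' (u : SchwartzMap Q ℂ) (a : W₁) : SchwartzMap W₂ ℂ :=
  SchwartzMap.compCLM ℝ (slice_tg' J a)
    ⟨1, 1, fun b => by have := norm_le_Jm_right J a b; simp; linarith⟩ u

@[simp] theorem slice_apply (u : SchwartzMap Q ℂ) (a : W₁) (b : W₂) : slice J u b a = u (Jm J a b) := rfl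
@[simp] theorem slice'_apply (u : SchwartzMap Q ℂ) (a : W₁) (b : W₂) : slice' J u a b = u (Jm J a b) := rfl

/-- partial Fourier transform in the first variable -/
def PF (u : SchwartzMap Q ℂ) (α : W₁) (b : W₂) : ℂ := 𝓕 (fun a => u (Jm J a b)) α

theorem PF_bound (u : SchwartzMap Q ℂ) : ∃ C, ∀ a b, ‖u (Jm J a b)‖ ≤ C * (wt a) := by
  obtain ⟨C, hC0, hC⟩ := sz_decay u (Module.finrank ℝ W₁ + 1)
  refine ⟨C, fun a b => ?_⟩
  rw [wt, ← div_eq_mul_inv, le_div_iff₀ (by positivity), mul_comm]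
  refine le_trans ?_ (hC (Jm J a b))
  have := norm_le_Jm_left J a b
  gcongr

theorem PF_continuous (u : SchwartzMap Q ℂ) : Continuous (Function.uncurry (PF J u)) := by
  obtain ⟨C, hC⟩ := PF_bound J u
  exact continuous_fourier_param (X := W₁ × W₂) (f := fun x a => u (Jm J a x.2)) (ζ := Prod.fst)
    continuous_fst (u.continuous.comp ((continuous_Jm J).comp
      (continuous_snd.prodMk continuous_fst.snd))) (wt_integrable.const_mul C) (fun x a => hC a x.2)

theorem PF_norm_le (u : SchwartzMap Q ℂ) (α : W₁) (b : W₂) : ‖PF J u α b‖ ≤ ∫ a, ‖u (Jm J a b)‖ := by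
  rw [PF, Real.fourier_eq]
  refine (norm_integral_le_integral_norm _).trans (le_of_eq ?_)
  simp

theorem PF_integrable (u : SchwartzMap Q ℂ) (α : W₁) : Integrable (PF J u α) := by
  have h := (integrable_Jm J u.integrable).swap.norm.integral_prod_left
  refine h.mono' ((PF_continuous J u).comp (Continuous.prodMk_right α)).aestronglyMeasurable
    (Filter.Eventually.of_forall fun b => PF_norm_le J u α b)

theorem PF_memLp (u : SchwartzMap Q ℂ) (α : W₁) : MemLp (PF J u α) 2 := by
  obtain ⟨C, hC⟩ := PF_bound J u
  have hb : ∀ b, ‖PF J u α b‖ ≤ ∫ a : W₁, C * wt a := fun b =>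
    (PF_norm_le J u α b).trans (integral_mono (slice J u b).integrable.norm (wt_integrable.const_mul C)
      (fun a => hC a b))
  have hi := PF_integrable J u α
  refine (memLp_two_iff_integrable_sq_norm hi.1).2
    ((hi.norm.const_mul (∫ a : W₁, C * wt a)).mono' (hi.1.norm.pow 2) (Filter.Eventually.of_forall fun b => ?_))
  rw [Real.norm_eq_abs, abs_of_nonneg (by positivity), sq]
  exact mul_le_mul_of_nonneg_right (hb b) (norm_nonneg _)

theorem fourier_Jm (u : SchwartzMap Q ℂ) (α : W₁) (θ : W₂) :
    𝓕 (u : Q → ℂ) (Jm J α θ) = 𝓕 (PF J u α) θ := by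
  rw [Real.fourier_eq, integral_Jm' J ((Real.fourierIntegral_convergent_iff (μ := volume) _).2 u.integrable),
    Real.fourier_eq]
  congr 1; ext b
  rw [PF, Real.fourier_eq, Circle.smul_def, smul_eq_mul, ← integral_const_mul]
  congr 1; ext a
  rw [← smul_eq_mul, ← Circle.smul_def, smul_smul, ← AddChar.map_add_eq_mul, inner_Jm]
  congr 2; ring

/-- partial Plancherel -/
theorem partial_planch (u : SchwartzMap Q ℂ) {ω : W₁ → ℝ≥0∞} (hω : Measurable ω) :
    ∫⁻ ζ, ω (J1 J ζ) * ‖𝓕 (u : Q → ℂ) ζ‖ₑ ^ 2 = ∫⁻ b, ∫⁻ α, ω α * ‖PF J u α b‖ₑ ^ 2 := by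
  have m1 : Measurable fun ζ => ω (J1 J ζ) * ‖𝓕 (u : Q → ℂ) ζ‖ₑ ^ 2 :=
    (hω.comp (continuous_J1 J).measurable).mul
      ((continuous_fourier u.integrable).measurable.enorm.pow_const 2)
  rw [lintegral_Jm J m1]
  simp only [J1_Jm, fourier_Jm]
  have e : ∀ α, ∫⁻ θ, ω α * ‖𝓕 (PF J u α) θ‖ₑ ^ 2 = ∫⁻ b, ω α * ‖PF J u α b‖ₑ ^ 2 := by
    intro α
    have c1 : Measurable fun θ => ‖𝓕 (PF J u α) θ‖ₑ ^ 2 :=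
      (continuous_fourier (PF_integrable J u α)).measurable.enorm.pow_const 2
    have c2 : Measurable fun b => ‖PF J u α b‖ₑ ^ 2 :=
      ((PF_continuous J u).comp (Continuous.prodMk_right α)).measurable.enorm.pow_const 2
    rw [lintegral_const_mul _ c1, lintegral_const_mul _ c2, planch (PF_integrable J u α) (PF_memLp J u α)]
  simp_rw [e]
  rw [lintegral_lintegral_swap]
  exact ((hω.comp measurable_fst).mul ((PF_continuous J u).measurable.enorm.pow_const 2)).aemeasurable

/-- partial multiplier identity -/
theorem partial_mult (u : SchwartzMap Q ℂ) {M : W₁ → ℂ} (hM : Continuous M) (C : ℝ) (k : ℕ)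
    (h : ∀ x, ‖M x‖ ≤ C * (1 + ‖x‖) ^ k) (a : W₁) (b : W₂) :
    𝓕⁻ (fun ζ => M (J1 J ζ) * 𝓕 (u : Q → ℂ) ζ) (Jm J a b) = 𝓕⁻ (fun α => M α * PF J u α b) a := by
  have hC : 0 ≤ C := by
    have := (norm_nonneg _).trans (h 0)
    simpa using this
  have hI : Integrable (fun ζ => M (J1 J ζ) * 𝓕 (u : Q → ℂ) ζ) := by
    have := (sz_mul (𝓕 u : SchwartzMap Q ℂ) (M := fun ζ => M (J1 J ζ)) (hM.comp (continuous_J1 J)) C k (by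
      intro ζ
      refine (h _).trans ?_
      have h1 : ‖J1 J ζ‖ ≤ ‖ζ‖ := by
        have := norm_le_Jm_left J (J1 J ζ) (J.symm ζ).snd
        have e : Jm J (J1 J ζ) (J.symm ζ).snd = ζ := J.apply_symm_apply ζ
        rwa [e] at this
      gcongr)).1
    rwa [SchwartzMap.fourier_coe] at this
  have hI2 : Integrable fun ζ => Real.fourierChar (inner ℝ ζ (Jm J a b)) • (M (J1 J ζ) * 𝓕 (u : Q → ℂ) ζ) := by
    have := (Real.fourierIntegral_convergent_iff (μ := volume) (-Jm J a b)).2 hI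
    simpa using this
  rw [Real.fourierInv_eq, integral_Jm J hI2, Real.fourierInv_eq]
  congr 1; ext α
  have inv : PF J u α b = ∫ θ, Real.fourierChar (inner ℝ θ b) • 𝓕 (PF J u α) θ := by
    have hc : Continuous (PF J u α) := (PF_continuous J u).comp (Continuous.prodMk_right α)
    have hF : Integrable (𝓕 (PF J u α)) := by
      have e : 𝓕 (PF J u α) = fun θ => (slice' J (𝓕 u : SchwartzMap Q ℂ) α) θ := by
        ext θ; rw [slice'_apply, SchwartzMap.fourier_coe, fourier_Jm]
      rw [e]; exact SchwartzMap.integrable _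
    have := hc.fourierInv_fourier_eq (PF_integrable J u α) hF
    conv_lhs => rw [← this]
    rw [Real.fourierInv_eq]
  rw [inv, Circle.smul_def, smul_eq_mul, ← mul_assoc, ← integral_const_mul]
  congr 1; ext θ
  rw [J1_Jm, fourier_Jm, inner_Jm, AddChar.map_add_eq_mul]
  simp only [Circle.smul_def, smul_eq_mul, Circle.coe_mul]
  ring
end split2

/-- phase space `ℝ^n_x × ℝ^n_v` -/
abbrev Y (n : ℕ) : Type := WithLp 2 (E n × E n)

/-- the point of `ℝ^{2n+1}` with given coordinates -/
def mkZ (t : ℝ) (x v : E n) : Z n :=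
  WithLp.toLp 2 (Sum.elim (fun _ => t) (Sum.elim (fun i => x i) (fun i => v i)))

/-- the point of `Y n` with given coordinates -/
def mkY (x v : E n) : Y n := WithLp.toLp 2 (x, v)

@[simp] theorem mkY_fst (x v : E n) : (mkY x v).fst = x := rfl
@[simp] theorem mkY_snd (x v : E n) : (mkY x v).snd = v := rfl
@[simp] theorem tC_mkZ (t : ℝ) (x v : E n) : tC (mkZ t x v) = t := rfl
@[simp] theorem xC_mkZ (t : ℝ) (x v : E n) : xC (mkZ t x v) = x := rfl
@[simp] theorem vC_mkZ (t : ℝ) (x v : E n) : vC (mkZ t x v) = v := rfl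
theorem mkZ_eta (z : Z n) : mkZ (tC z) (xC z) (vC z) = z := by
  ext i; rcases i with i | i | i <;> rfl

theorem mkZ_norm_sq (t : ℝ) (x v : E n) : ‖mkZ t x v‖ ^ 2 = t ^ 2 + ‖x‖ ^ 2 + ‖v‖ ^ 2 := by
  simp only [EuclideanSpace.real_norm_sq_eq, Fintype.sum_sum_type]
  simp [mkZ, add_assoc]

theorem Z_norm_sq (z : Z n) : ‖z‖ ^ 2 = tC z ^ 2 + ‖xC z‖ ^ 2 + ‖vC z‖ ^ 2 := by
  conv_lhs => rw [← mkZ_eta z, mkZ_norm_sq]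

theorem Y_norm_sq (y : Y n) : ‖y‖ ^ 2 = ‖y.fst‖ ^ 2 + ‖y.snd‖ ^ 2 := WithLp.prod_norm_sq_eq_of_L2 y

theorem mkZ_add (t t' : ℝ) (x v x' v' : E n) :
    mkZ (t + t') (x + x') (v + v') = mkZ t x v + mkZ t' x' v' := by
  ext i; rcases i with i | i | i <;> rfl
theorem mkZ_smul (c t : ℝ) (x v : E n) : mkZ (c * t) (c • x) (c • v) = c • mkZ t x v := by
  ext i; rcases i with i | i | i <;> rfl

theorem tC_add (z w : Z n) : tC (z + w) = tC z + tC w := rfl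
theorem xC_add (z w : Z n) : xC (z + w) = xC z + xC w := rfl
theorem vC_add (z w : Z n) : vC (z + w) = vC z + vC w := rfl

/-- splitting `((x,v),t)` -/
def Jt (n : ℕ) : WithLp 2 (Y n × ℝ) ≃ₗᵢ[ℝ] Z n where
  toFun p := mkZ p.snd p.fst.fst p.fst.snd
  invFun z := WithLp.toLp 2 (mkY (xC z) (vC z), tC z)
  left_inv p := rfl
  right_inv z := mkZ_eta z
  map_add' p q := mkZ_add _ _ _ _ _ _
  map_smul' c p := mkZ_smul _ _ _ _
  norm_map' p := by
    refine (sq_eq_sq₀ (norm_nonneg _) (norm_nonneg _)).1 ?_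
    change ‖mkZ p.snd p.fst.fst p.fst.snd‖ ^ 2 = _
    rw [mkZ_norm_sq, WithLp.prod_norm_sq_eq_of_L2, Y_norm_sq, Real.norm_eq_abs, sq_abs]
    ring

/-- splitting `((t,x),v)` -/
def Jx (n : ℕ) : WithLp 2 (WithLp 2 (ℝ × E n) × E n) ≃ₗᵢ[ℝ] Z n where
  toFun p := mkZ p.fst.fst p.fst.snd p.snd
  invFun z := WithLp.toLp 2 (WithLp.toLp 2 (tC z, xC z), vC z)
  left_inv p := rfl
  right_inv z := mkZ_eta z
  map_add' p q := mkZ_add _ _ _ _ _ _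
  map_smul' c p := mkZ_smul _ _ _ _
  norm_map' p := by
    refine (sq_eq_sq₀ (norm_nonneg _) (norm_nonneg _)).1 ?_
    change ‖mkZ p.fst.fst p.fst.snd p.snd‖ ^ 2 = _
    rw [mkZ_norm_sq, WithLp.prod_norm_sq_eq_of_L2, WithLp.prod_norm_sq_eq_of_L2, Real.norm_eq_abs, sq_abs]

theorem Jm_Jt (y : Y n) (t : ℝ) : Jm (Jt n) y t = mkZ t y.fst y.snd := rfl
theorem Jm_Jx (q : WithLp 2 (ℝ × E n)) (v : E n) : Jm (Jx n) q v = mkZ q.fst q.snd v := rfl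
theorem J1_Jt (z : Z n) : J1 (Jt n) z = mkY (xC z) (vC z) := rfl
theorem J1_Jx (z : Z n) : J1 (Jx n) z = WithLp.toLp 2 (tC z, xC z) := rfl

theorem continuous_Yfst : Continuous fun y : Y n => y.fst := (WithLp.prod_continuous_ofLp 2 _ _).fst
theorem continuous_Ysnd : Continuous fun y : Y n => y.snd := (WithLp.prod_continuous_ofLp 2 _ _).snd
theorem continuous_mkY {X : Type*} [TopologicalSpace X] {f g : X → E n} (hf : Continuous f) (hg : Continuous g) :
    Continuous fun x => mkY (f x) (g x) :=
  (WithLp.prod_continuous_toLp 2 _ _).comp (hf.prodMk hg)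
theorem continuous_tC : Continuous (tC : Z n → ℝ) := by
  exact (continuous_apply _).comp (PiLp.continuous_ofLp 2 _)
theorem continuous_J1t : Continuous fun z : Z n => mkY (xC z) (vC z) := continuous_J1 (Jt n)
theorem continuous_xC : Continuous (xC : Z n → E n) := continuous_Yfst.comp continuous_J1t
theorem continuous_vC : Continuous (vC : Z n → E n) := continuous_Ysnd.comp continuous_J1t
theorem continuous_mkZ {X : Type*} [TopologicalSpace X] {t : X → ℝ} {f g : X → E n} (ht : Continuous t)
    (hf : Continuous f) (hg : Continuous g) :
    Continuous fun x => mkZ (t x) (f x) (g x) :=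
  (continuous_Jm (Jt n)).comp ((continuous_mkY hf hg).prodMk ht)

/-- spatial shear `(y,v) ↦ (y+tv,v)` -/
def shS (t : ℝ) (y : Y n) : Y n := mkY (y.fst + t • y.snd) y.snd
/-- frequency shear `(ξ,η) ↦ (ξ,η-tξ)` -/
def shT (t : ℝ) (y : Y n) : Y n := mkY y.fst (y.snd - t • y.fst)

theorem shS_neg (t : ℝ) (y : Y n) : shS (-t) (shS t y) = y := by
  show mkY _ _ = mkY y.fst y.snd
  simp [shS]
theorem shS_neg' (t : ℝ) (y : Y n) : shS t (shS (-t) y) = y := by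
  show mkY _ _ = mkY y.fst y.snd
  simp [shS]
theorem shT_neg (t : ℝ) (y : Y n) : shT (-t) (shT t y) = y := by
  show mkY _ _ = mkY y.fst y.snd
  simp [shT]
theorem shT_neg' (t : ℝ) (y : Y n) : shT t (shT (-t) y) = y := by
  show mkY _ _ = mkY y.fst y.snd
  simp [shT]

theorem continuous_shS : Continuous fun p : ℝ × Y n => shS p.1 p.2 :=
  continuous_mkY ((continuous_Yfst.comp continuous_snd).add
    (continuous_fst.smul (continuous_Ysnd.comp continuous_snd))) (continuous_Ysnd.comp continuous_snd)
theorem continuous_shT : Continuous fun p : ℝ × Y n => shT p.1 p.2 :=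
  continuous_mkY (continuous_Yfst.comp continuous_snd) ((continuous_Ysnd.comp continuous_snd).sub
    (continuous_fst.smul (continuous_Yfst.comp continuous_snd)))
theorem continuous_shS' (t : ℝ) : Continuous (shS (n := n) t) := continuous_shS.comp (Continuous.prodMk_right t)
theorem continuous_shT' (t : ℝ) : Continuous (shT (n := n) t) := continuous_shT.comp (Continuous.prodMk_right t)

theorem inner_Y (y z : Y n) : inner ℝ y z = inner ℝ y.fst z.fst + inner ℝ y.snd z.snd :=
  WithLp.prod_inner_apply y z

theorem inner_shS (t : ℝ) (y ζ : Y n) : inner ℝ (shS (-t) y) ζ = inner ℝ y (shT t ζ) := by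
  simp only [inner_Y, shS, shT, mkY_fst, mkY_snd, inner_add_left, inner_sub_right, inner_smul_left,
    inner_smul_right]
  simp; ring

theorem mp_shT (t : ℝ) : MeasurePreserving (shT (n := n) t) := by
  have h : MeasurePreserving (fun p : E n × E n => (p.1, p.2 - t • p.1)) (volume.prod volume) (volume.prod volume) := by
    refine MeasurePreserving.skew_product (g := fun a b => b - t • a) (MeasurePreserving.id _) (by fun_prop) ?_
    exact Filter.Eventually.of_forall fun a => (measurePreserving_sub_right volume (t • a)).map_eq
  exact ((WithLp.volume_preserving_toLp (E n) (E n)).comp h).comp (WithLp.volume_preserving_ofLp (E n) (E n))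

theorem mp_shS (t : ℝ) : MeasurePreserving (shS (n := n) t) := by
  have h : MeasurePreserving (fun p : E n × E n => (p.1, p.2 + t • p.1)) (volume.prod volume) (volume.prod volume) := by
    refine MeasurePreserving.skew_product (g := fun a b => b + t • a) (MeasurePreserving.id _) (by fun_prop) ?_
    exact Filter.Eventually.of_forall fun a => (measurePreserving_add_right volume (t • a)).map_eq
  have sw := Measure.measurePreserving_swap (μ := (volume : Measure (E n))) (ν := (volume : Measure (E n)))
  exact ((WithLp.volume_preserving_toLp (E n) (E n)).comp ((sw.comp h).comp sw)).comp
    (WithLp.volume_preserving_ofLp (E n) (E n))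

/-- `shS` as a homeomorphism -/
def shSh (t : ℝ) : Y n ≃ₜ Y n where
  toFun := shS t
  invFun := shS (-t)
  left_inv := shS_neg t
  right_inv := shS_neg' t
  continuous_toFun := continuous_shS' t
  continuous_invFun := continuous_shS' (-t)
/-- `shT` as a homeomorphism -/
def shTh (t : ℝ) : Y n ≃ₜ Y n where
  toFun := shT t
  invFun := shT (-t)
  left_inv := shT_neg t
  right_inv := shT_neg' t
  continuous_toFun := continuous_shT' t
  continuous_invFun := continuous_shT' (-t)

theorem integral_shS (t : ℝ) (f : Y n → ℂ) : ∫ y, f (shS t y) = ∫ y, f y :=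
  (mp_shS t).integral_comp (shSh t).measurableEmbedding f
theorem integral_shT (t : ℝ) (f : Y n → ℂ) : ∫ y, f (shT t y) = ∫ y, f y :=
  (mp_shT t).integral_comp (shTh t).measurableEmbedding f
theorem lintegral_shS (t : ℝ) (f : Y n → ℝ≥0∞) : ∫⁻ y, f (shS t y) = ∫⁻ y, f y :=
  (mp_shS t).lintegral_comp_emb (shSh t).measurableEmbedding f
theorem lintegral_shT (t : ℝ) (f : Y n → ℝ≥0∞) : ∫⁻ y, f (shT t y) = ∫⁻ y, f y :=
  (mp_shT t).lintegral_comp_emb (shTh t).measurableEmbedding f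

/-- characteristic flow coordinates -/
def jt (t : ℝ) (y : Y n) : Z n := mkZ t (y.fst + t • y.snd) y.snd

theorem jt_eq (t : ℝ) (y : Y n) : jt t y = Jm (Jt n) (shS t y) t := rfl
@[simp] theorem tC_jt (t : ℝ) (y : Y n) : tC (jt t y) = t := rfl
@[simp] theorem vC_jt (t : ℝ) (y : Y n) : vC (jt t y) = y.snd := rfl

theorem continuous_jt : Continuous fun p : ℝ × Y n => jt p.1 p.2 :=
  (continuous_Jm (Jt n)).comp (continuous_shS.prodMk continuous_fst)

theorem lintegral_jt {f : Z n → ℝ≥0∞} (hf : Measurable f) : ∫⁻ t, ∫⁻ y, f (jt t y) = ∫⁻ z, f z := by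
  rw [lintegral_Jm' (Jt n) hf]
  congr 1; ext t
  simp_rw [jt_eq]
  exact lintegral_shS t (fun y => f (Jm (Jt n) y t))

/-- `û_t` along the flow -/
def Gh (u : SchwartzMap (Z n) ℂ) (t : ℝ) : Y n → ℂ := 𝓕 (fun y => u (jt t y))

theorem Gh_eq (u : SchwartzMap (Z n) ℂ) (t : ℝ) (ζ : Y n) : Gh u t ζ = PF (Jt n) u (shT t ζ) t := by
  rw [Gh, PF, Real.fourier_eq, Real.fourier_eq, ← integral_shS (-t)]
  congr 1; ext y
  rw [jt_eq, shS_neg', inner_shS]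

theorem Gh_continuous (u : SchwartzMap (Z n) ℂ) : Continuous fun p : ℝ × Y n => Gh u p.1 p.2 := by
  simp_rw [Gh_eq]
  have h : Continuous fun p : ℝ × Y n => (shT p.1 p.2, p.1) := continuous_shT.prodMk continuous_fst
  have h2 := (PF_continuous (Jt n) u).comp h
  simpa only [Function.comp_def, Function.uncurry] using h2

theorem lintegral_Gh (u : SchwartzMap (Z n) ℂ) {ω : Y n → ℝ≥0∞} (hω : Measurable ω) :
    ∫⁻ t, ∫⁻ ζ, ω (shT t ζ) * ‖Gh u t ζ‖ₑ ^ 2 =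
      ∫⁻ ζ, ω (mkY (xC ζ) (vC ζ)) * ‖𝓕 (u : Z n → ℂ) ζ‖ₑ ^ 2 := by
  have := partial_planch (Jt n) u hω
  simp_rw [J1_Jt] at this
  rw [this]
  congr 1; ext t
  simp_rw [Gh_eq]
  exact lintegral_shT t (fun α => ω α * ‖PF (Jt n) u α t‖ₑ ^ 2)

theorem mult_jt (u : SchwartzMap (Z n) ℂ) {M : Y n → ℂ} (hM : Continuous M) (C : ℝ) (k : ℕ)
    (h : ∀ x, ‖M x‖ ≤ C * (1 + ‖x‖) ^ k) (t : ℝ) (y : Y n) :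
    𝓕⁻ (fun ζ => M (mkY (xC ζ) (vC ζ)) * 𝓕 (u : Z n → ℂ) ζ) (jt t y) =
      𝓕⁻ (fun ζ => M (shT t ζ) * Gh u t ζ) y := by
  have := partial_mult (Jt n) u hM C k h (shS t y) t
  simp_rw [J1_Jt] at this
  rw [jt_eq, this, Real.fourierInv_eq, Real.fourierInv_eq, ← integral_shT t]
  congr 1; ext ζ
  have e : inner ℝ (shT t ζ) (shS t y) = inner ℝ ζ y := by
    rw [real_inner_comm, ← inner_shS, shS_neg, real_inner_comm]
  rw [e, Gh_eq]

/-- `u` along the flow at fixed time, as a Schwartz function -/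
theorem exists_gs (u : SchwartzMap (Z n) ℂ) (t : ℝ) : ∃ g : SchwartzMap (Y n) ℂ, ∀ y, g y = u (jt t y) := by
  let L : Y n ≃L[ℝ] Y n :=
    { toFun := shS t
      invFun := shS (-t)
      left_inv := shS_neg t
      right_inv := shS_neg' t
      map_add' := fun a b => by
        show mkY ((a.fst + b.fst) + t • (a.snd + b.snd)) (a.snd + b.snd) =
          mkY ((a.fst + t • a.snd) + (b.fst + t • b.snd)) (a.snd + b.snd)
        congr 1
        rw [smul_add]; abel
      map_smul' := fun c a => by
        show mkY (c • a.fst + t • (c • a.snd)) (c • a.snd) =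
          mkY (c • (a.fst + t • a.snd)) (c • a.snd)
        congr 1
        rw [smul_add, smul_comm t c]
      continuous_toFun := continuous_shS' t
      continuous_invFun := continuous_shS' (-t) }
  exact ⟨SchwartzMap.compCLMOfContinuousLinearEquiv ℝ L (slice (Jt n) u t), fun y => rfl⟩

section ode

theorem energy_zero {G G' H : ℝ → ℂ} {β k k' : ℝ → ℝ} (hG : ∀ t, HasDerivAt G (G' t) t)
    (hG' : Continuous G') (hβ : Continuous β) (hH : ∀ t, H t = G' t + (β t : ℂ) * G t)
    (h0 : G (-4) = 0) (h1 : G 4 = 0) (hk : ∀ t, HasDerivAt k (k' t) t) (hk' : Continuous k') :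
    (Continuous fun t => k' t * ‖G t‖ ^ 2 + 2 * k t * inner ℝ (G t) (H t) - 2 * k t * β t * ‖G t‖ ^ 2) ∧
    ∫ t in (-4 : ℝ)..4, (k' t * ‖G t‖ ^ 2 + 2 * k t * inner ℝ (G t) (H t)
      - 2 * k t * β t * ‖G t‖ ^ 2) = 0 := by
  have cG : Continuous G := continuous_iff_continuousAt.2 fun t => (hG t).continuousAt
  have ck : Continuous k := continuous_iff_continuousAt.2 fun t => (hk t).continuousAt
  have cH : Continuous H := by
    have : H = fun t => G' t + (β t : ℂ) * G t := funext hH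
    rw [this]; fun_prop
  have hc : Continuous fun t => k' t * ‖G t‖ ^ 2 + 2 * k t * inner ℝ (G t) (H t)
      - 2 * k t * β t * ‖G t‖ ^ 2 := by fun_prop
  refine ⟨hc, ?_⟩
  have hd : ∀ t, HasDerivAt (fun t => k t * ‖G t‖ ^ 2) (k' t * ‖G t‖ ^ 2 + 2 * k t * inner ℝ (G t) (H t)
      - 2 * k t * β t * ‖G t‖ ^ 2) t := by
    intro t
    have h := (hk t).mul (hG t).norm_sq
    have e : G' t = H t - (β t) • G t := by rw [hH]; simp
    have e2 : k' t * ‖G t‖ ^ 2 + 2 * k t * inner ℝ (G t) (H t) - 2 * k t * β t * ‖G t‖ ^ 2 =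
        k' t * ‖G t‖ ^ 2 + k t * (2 * inner ℝ (G t) (G' t)) := by
      rw [e, inner_sub_right, inner_smul_right, real_inner_self_eq_norm_sq]
      ring
    rw [e2]; exact h
  rw [intervalIntegral.integral_eq_sub_of_hasDerivAt (fun t _ => hd t) (hc.intervalIntegrable _ _), h0, h1]
  simp

theorem int_le_of {f g D : ℝ → ℝ} (hf : Continuous f) (hg : Continuous g) (hD : Continuous D)
    (h0 : ∫ t in (-4 : ℝ)..4, D t = 0) (h : ∀ t, f t ≤ g t + D t) :
    ∫ t in (-4 : ℝ)..4, f t ≤ ∫ t in (-4 : ℝ)..4, g t := by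
  have : ∫ t in (-4 : ℝ)..4, (g t + D t) = ∫ t in (-4 : ℝ)..4, g t := by
    rw [intervalIntegral.integral_add (hg.intervalIntegrable _ _) (hD.intervalIntegrable _ _), h0, add_zero]
  rw [← this]
  exact intervalIntegral.integral_mono (by norm_num) (hf.intervalIntegrable _ _)
    ((hg.add hD).intervalIntegrable _ _) h

theorem ode_one {G G' H : ℝ → ℂ} {al ph : ℝ → ℝ} (hG : ∀ t, HasDerivAt G (G' t) t)
    (hG' : Continuous G') (hal : Continuous al) (hph : Continuous ph)
    (hH : ∀ t, H t = G' t + ((al t * ph t : ℝ) : ℂ) * G t)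
    (h0 : G (-4) = 0) (h1 : G 4 = 0) {a₀ M : ℝ} (ha₀ : 0 < a₀) (hlo : ∀ t, a₀ ≤ al t) (hhi : ∀ t, al t ≤ M)
    (hp0 : ∀ t, 0 ≤ ph t) {ρ t₀ : ℝ} (hρ : 0 < ρ)
    (hfar : ∀ t, 1 < ρ * |t - t₀| → ρ ≤ ph t) :
    ∫ t in (-4 : ℝ)..4, ρ ^ 2 * ‖G t‖ ^ 2 ≤
      ∫ t in (-4 : ℝ)..4, 4 * (4 + (1 + 4 * M) / a₀) ^ 2 * ‖H t‖ ^ 2 := by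
  have cG : Continuous G := continuous_iff_continuousAt.2 fun t => (hG t).continuousAt
  have cH : Continuous H := by
    have : H = fun t => G' t + ((al t * ph t : ℝ) : ℂ) * G t := funext hH
    rw [this]; fun_prop
  have hk : ∀ t, HasDerivAt (fun t => Real.arctan (ρ * (t - t₀))) (1 / (1 + (ρ * (t - t₀)) ^ 2) * ρ) t := by
    intro t
    have h : HasDerivAt (fun t => ρ * (t - t₀)) ρ t := by
      simpa using ((hasDerivAt_id t).sub_const t₀).const_mul ρ
    exact h.arctan
  have hk' : Continuous fun t => 1 / (1 + (ρ * (t - t₀)) ^ 2) * ρ := by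
    have : ∀ t, 1 + (ρ * (t - t₀)) ^ 2 ≠ 0 := fun t => by positivity
    fun_prop (disch := assumption)
  obtain ⟨cb, eb⟩ := energy_zero (β := fun t => al t * ph t) hG hG' (by fun_prop) hH h0 h1 hk hk'
  obtain ⟨c1, e1⟩ := energy_zero (β := fun t => al t * ph t) hG hG' (by fun_prop) hH h0 h1 (k := fun _ => 1) (k' := fun _ => 0)
    (fun t => hasDerivAt_const t 1) continuous_const
  set lam := (1 + 4 * M) / (2 * a₀) with hlam
  refine int_le_of (D := fun t => 4 * ρ * ((1 / (1 + (ρ * (t - t₀)) ^ 2) * ρ * ‖G t‖ ^ 2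
      + 2 * Real.arctan (ρ * (t - t₀)) * inner ℝ (G t) (H t)
      - 2 * Real.arctan (ρ * (t - t₀)) * (al t * ph t) * ‖G t‖ ^ 2) - lam *
      (0 * ‖G t‖ ^ 2 + 2 * 1 * inner ℝ (G t) (H t) - 2 * 1 * (al t * ph t) * ‖G t‖ ^ 2)))
    (by fun_prop) (by fun_prop) ((cb.sub (c1.const_mul lam)).const_mul _) ?_ ?_
  · rw [intervalIntegral.integral_const_mul, intervalIntegral.integral_sub (cb.intervalIntegrable _ _)
      ((c1.const_mul lam).intervalIntegrable _ _), intervalIntegral.integral_const_mul]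
    rw [eb, e1]; simp
  · intro t
    have hM : 0 < M := lt_of_lt_of_le ha₀ ((hlo 0).trans (hhi 0))
    have hkb : |Real.arctan (ρ * (t - t₀))| ≤ 2 := by
      have h1 := Real.arctan_lt_pi_div_two (ρ * (t - t₀))
      have h2 := Real.neg_pi_div_two_lt_arctan (ρ * (t - t₀))
      have h3 := Real.pi_le_four
      rw [abs_le]; constructor <;> linarith
    have hkl : ρ / 2 ≤ 1 / (1 + (ρ * (t - t₀)) ^ 2) * ρ + ph t := by
      by_cases h : 1 < ρ * |t - t₀|
      · have := hfar t h
        have h2 : 0 ≤ 1 / (1 + (ρ * (t - t₀)) ^ 2) * ρ := by positivity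
        linarith
      · push Not at h
        have h2 : (ρ * (t - t₀)) ^ 2 ≤ 1 := by
          rw [← sq_abs, abs_mul, abs_of_pos hρ]
          exact pow_le_one₀ (by positivity) h
        have h3 : 1 / 2 ≤ 1 / (1 + (ρ * (t - t₀)) ^ 2) :=
          one_div_le_one_div_of_le (by positivity) (by linarith)
        have h4 := mul_le_mul_of_nonneg_right h3 hρ.le
        have h5 := hp0 t
        linarith
    have hR := abs_real_inner_le_norm (G t) (H t)
    generalize Real.arctan (ρ * (t - t₀)) = k at *
    generalize 1 / (1 + (ρ * (t - t₀)) ^ 2) * ρ = k1 at *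
    generalize (inner ℝ (G t) (H t) : ℝ) = R at *
    have hg0 := norm_nonneg (G t)
    have hh0 := norm_nonneg (H t)
    generalize ‖G t‖ = g at *
    generalize ‖H t‖ = h at *
    have ha1 := hlo t
    have ha2 := hhi t
    have hp := hp0 t
    generalize al t = α at *
    generalize ph t = p at *
    have lamp : 0 < lam := by rw [hlam]; positivity
    have e2 : 2 * lam * a₀ = 1 + 4 * M := by rw [hlam]; field_simp
    have e3 : (1 + 4 * M) / a₀ = 2 * lam := by rw [hlam]; field_simp
    rw [e3]
    have i1 : -(4 * (g * h)) ≤ 2 * k * R := by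
      have : |2 * k * R| ≤ 4 * (g * h) := by
        rw [abs_mul, abs_mul, abs_two]
        calc 2 * |k| * |R| ≤ 2 * 2 * (g * h) := by gcongr
          _ = _ := by ring
      exact (abs_le.1 this).1
    have i2 : 2 * k * (α * p) * g ^ 2 ≤ 4 * M * p * g ^ 2 := by
      have h1 : k ≤ 2 := (abs_le.1 hkb).2
      have : 2 * k * (α * p) ≤ 2 * 2 * (M * p) := by
        have hα : 0 ≤ α := ha₀.le.trans ha1
        gcongr
      calc _ ≤ (2 * 2 * (M * p)) * g ^ 2 := by gcongr
        _ = _ := by ring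
    have i3 : lam * (2 * R) ≤ lam * (2 * (g * h)) := by
      have := (abs_le.1 hR).2
      gcongr
    have i4 : lam * (2 * (a₀ * p) * g ^ 2) ≤ lam * (2 * (α * p) * g ^ 2) := by gcongr
    have i5 : ρ / 2 * g ^ 2 ≤ (k1 + p) * g ^ 2 := by gcongr
    have i6 : lam * (2 * (a₀ * p) * g ^ 2) = (1 + 4 * M) * p * g ^ 2 := by rw [← e2]; ring
    have tot : ρ / 2 * g ^ 2 ≤ (k1 * g ^ 2 + 2 * k * R - 2 * k * (α * p) * g ^ 2 -
        lam * (0 * g ^ 2 + 2 * 1 * R - 2 * 1 * (α * p) * g ^ 2)) + (4 + 2 * lam) * (g * h) := by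
      nlinarith
    have t2 := mul_le_mul_of_nonneg_left tot (by positivity : 0 ≤ 4 * ρ)
    nlinarith [sq_nonneg (ρ * g - 2 * (4 + 2 * lam) * h)]

theorem ode_two {G G' H : ℝ → ℂ} {al ph m m' : ℝ → ℝ} (hG : ∀ t, HasDerivAt G (G' t) t)
    (hG' : Continuous G') (hal : Continuous al) (hph : Continuous ph)
    (hH : ∀ t, H t = G' t + ((al t * ph t : ℝ) : ℂ) * G t)
    (h0 : G (-4) = 0) (h1 : G 4 = 0) {a₀ : ℝ} (ha₀ : 0 < a₀) (hlo : ∀ t, a₀ ≤ al t)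
    (hp0 : ∀ t, 0 ≤ ph t) {ρ : ℝ} (hρ : 0 ≤ ρ) (hm : ∀ t, HasDerivAt m (m' t) t) (hm' : Continuous m')
    (hm0 : ∀ t, 0 ≤ m t) (hmm : ∀ t, |m' t| ≤ 2 * m t * ρ) (hmp : ∀ t, m t ≤ 2 + ρ + ph t) :
    ∫ t in (-4 : ℝ)..4, a₀ * (m t ^ 2 * ‖G t‖ ^ 2) ≤
      ∫ t in (-4 : ℝ)..4, (4 / a₀ * ‖H t‖ ^ 2 + 16 * a₀ * ‖G t‖ ^ 2 +
        (4 * (1 + a₀) ^ 2 / a₀) * (ρ ^ 2 * ‖G t‖ ^ 2)) := by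
  have cG : Continuous G := continuous_iff_continuousAt.2 fun t => (hG t).continuousAt
  have cm : Continuous m := continuous_iff_continuousAt.2 fun t => (hm t).continuousAt
  have cH : Continuous H := by
    have : H = fun t => G' t + ((al t * ph t : ℝ) : ℂ) * G t := funext hH
    rw [this]; fun_prop
  obtain ⟨cb, eb⟩ := energy_zero (β := fun t => al t * ph t) hG hG' (by fun_prop) hH h0 h1 hm hm'
  refine int_le_of (D := fun t => -(m' t * ‖G t‖ ^ 2 + 2 * m t * inner ℝ (G t) (H t) -
      2 * m t * (al t * ph t) * ‖G t‖ ^ 2)) (by fun_prop) (by fun_prop) cb.neg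
    (by rw [intervalIntegral.integral_neg, eb, neg_zero]) ?_
  intro t
  have hR := abs_real_inner_le_norm (G t) (H t)
  have q1 := hmm t
  have q2 := hmp t
  have q3 := hm0 t
  have q4 := hp0 t
  have q5 := hlo t
  generalize (inner ℝ (G t) (H t) : ℝ) = R at *
  have hg0 := norm_nonneg (G t)
  have hh0 := norm_nonneg (H t)
  generalize ‖G t‖ = g at *
  generalize ‖H t‖ = h at *
  generalize al t = α at *
  generalize ph t = p at *
  generalize m' t = k1 at *
  generalize m t = k at *
  have r1 : 2 * k * R ≤ a₀ / 4 * k ^ 2 * g ^ 2 + 4 / a₀ * h ^ 2 := by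
    have : 2 * k * R ≤ 2 * k * (g * h) := by
      have := (abs_le.1 hR).2
      gcongr
    have y : 2 * k * (g * h) ≤ a₀ / 4 * k ^ 2 * g ^ 2 + 4 / a₀ * h ^ 2 := by
      have : a₀ / 4 * k ^ 2 * g ^ 2 + 4 / a₀ * h ^ 2 - 2 * k * (g * h) =
        a₀ / 4 * (k * g - 4 / a₀ * h) ^ 2 := by field_simp; ring
      have h2 : 0 ≤ a₀ / 4 * (k * g - 4 / a₀ * h) ^ 2 := by positivity
      linarith
    linarith
  have r2 : k1 * g ^ 2 ≤ 2 * k * ρ * g ^ 2 := by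
    have := (abs_le.1 q1).2
    gcongr
  have r3 : 2 * k * (a₀ * (k - 2 - ρ)) * g ^ 2 ≤ 2 * k * (α * p) * g ^ 2 := by
    have : a₀ * (k - 2 - ρ) ≤ α * p := by
      calc a₀ * (k - 2 - ρ) ≤ a₀ * p := by gcongr; linarith
        _ ≤ α * p := by gcongr
    gcongr
  have r4 : (2 + 2 * a₀) * k * ρ * g ^ 2 ≤ (a₀ / 4 * k ^ 2 + 4 * (1 + a₀) ^ 2 / a₀ * ρ ^ 2) * g ^ 2 := by
    have : (2 + 2 * a₀) * k * ρ ≤ a₀ / 4 * k ^ 2 + 4 * (1 + a₀) ^ 2 / a₀ * ρ ^ 2 := by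
      have e : a₀ / 4 * k ^ 2 + 4 * (1 + a₀) ^ 2 / a₀ * ρ ^ 2 - (2 + 2 * a₀) * k * ρ =
        a₀ / 4 * (k - 4 * (1 + a₀) / a₀ * ρ) ^ 2 := by field_simp; ring
      have h2 : 0 ≤ a₀ / 4 * (k - 4 * (1 + a₀) / a₀ * ρ) ^ 2 := by positivity
      linarith
    gcongr
  have r5 : 4 * a₀ * k * g ^ 2 ≤ (a₀ / 4 * k ^ 2 + 16 * a₀) * g ^ 2 := by
    have : 4 * a₀ * k ≤ a₀ / 4 * k ^ 2 + 16 * a₀ := by nlinarith [mul_nonneg ha₀.le (sq_nonneg (k - 8))]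
    gcongr
  have r6 : 0 ≤ a₀ / 4 * k ^ 2 * g ^ 2 := by positivity
  nlinarith

theorem Fsym_ge {σ : ℝ} (hσ1 : σ < 1) {w : E n → ℝ} (hw1 : ∀ η, 0 ≤ w η ∧ w η ≤ 1) {η : E n}
    (h : 1 ≤ ‖η‖) : ‖η‖ ^ (2 * σ) ≤ Fsym σ w η := by
  have h1 : ‖η‖ ^ (2 * σ) ≤ ‖η‖ ^ 2 := by
    rw [← Real.rpow_natCast]
    exact Real.rpow_le_rpow_of_exponent_le h (by push_cast; linarith)
  unfold Fsym
  nlinarith [hw1 η, mul_le_mul_of_nonneg_right h1 (sub_nonneg.2 (hw1 η).2)]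

theorem Fsym_nonneg {σ : ℝ} {w : E n → ℝ} (hw1 : ∀ η, 0 ≤ w η ∧ w η ≤ 1) (η : E n) :
    0 ≤ Fsym σ w η := by
  unfold Fsym
  have := (hw1 η).1
  have := sub_nonneg.2 (hw1 η).2
  positivity

theorem Fsym_ge' {σ : ℝ} (hσ0 : 0 < σ) (hσ1 : σ < 1) {w : E n → ℝ} (hw1 : ∀ η, 0 ≤ w η ∧ w η ≤ 1)
    (η : E n) : ‖η‖ ^ (2 * σ) ≤ Fsym σ w η + 1 := by
  by_cases h : 1 ≤ ‖η‖
  · linarith [Fsym_ge hσ1 hw1 h]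
  · have := Real.rpow_le_one (norm_nonneg η) (not_le.1 h).le (by positivity : 0 ≤ 2 * σ)
    linarith [Fsym_nonneg (σ := σ) hw1 η]

theorem Fsym_le' {σ : ℝ} (hσ0 : 0 < σ) {w : E n → ℝ} (hw1 : ∀ η, 0 ≤ w η ∧ w η ≤ 1)
    (hout : ∀ η : E n, 2 ≤ ‖η‖ → w η = 1) (η : E n) : Fsym σ w η ≤ ‖η‖ ^ (2 * σ) + 4 := by
  by_cases h : 2 ≤ ‖η‖
  · unfold Fsym; rw [hout η h]; simp
  · push Not at h
    have h0 := norm_nonneg η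
    have h1 : 0 ≤ ‖η‖ ^ (2 * σ) := by positivity
    have h2 : ‖η‖ ^ 2 ≤ 4 := by nlinarith
    unfold Fsym
    have := mul_le_mul_of_nonneg_left (hw1 η).2 h1
    have := mul_le_mul h2 (by linarith [(hw1 η).1] : 1 - w η ≤ 1) (by linarith [(hw1 η).2]) (by norm_num)
    linarith

theorem continuous_Fsym {σ : ℝ} (hσ0 : 0 < σ) {w : E n → ℝ} (hw : Continuous w) :
    Continuous (Fsym σ w) := by
  unfold Fsym
  have : Continuous fun η : E n => ‖η‖ ^ (2 * σ) := continuous_norm.rpow_const fun _ => Or.inr (by positivity)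
  fun_prop

theorem ode_main {σ : ℝ} (hσ0 : 0 < σ) (hσ1 : σ < 1) {w : E n → ℝ} (hw : Continuous w)
    (hw1 : ∀ η, 0 ≤ w η ∧ w η ≤ 1) {a₀ M : ℝ} (ha₀ : 0 < a₀) (haM : a₀ ≤ M) :
    ∃ C0 : ℝ, 0 ≤ C0 ∧ ∀ (ξ η : E n) (G G' H : ℝ → ℂ) (al : ℝ → ℝ), (∀ t, HasDerivAt G (G' t) t) →
      Continuous G' → Continuous al →
      (∀ t, H t = G' t + ((al t * Fsym σ w (η - t • ξ) : ℝ) : ℂ) * G t) →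
      G (-4) = 0 → G 4 = 0 → (∀ t, a₀ ≤ al t) → (∀ t, al t ≤ M) →
      ∫ t in (-4 : ℝ)..4, (‖ξ‖ ^ (2 * σ / (2 * σ + 1)) + ‖η - t • ξ‖ ^ (2 * σ)) ^ 2 * ‖G t‖ ^ 2 ≤
        ∫ t in (-4 : ℝ)..4, C0 * (‖H t‖ ^ 2 + ‖G t‖ ^ 2) := by
  have hMp : 0 < M := lt_of_lt_of_le ha₀ haM
  set K := 4 * (4 + (1 + 4 * M) / a₀) ^ 2 with hK
  have hKp : 0 ≤ K := by positivity
  refine ⟨4 / a₀ * (4 / a₀ + 16 * a₀ + (4 * (1 + a₀) ^ 2 / a₀) * (K + 1)), by positivity, ?_⟩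
  intro ξ η G G' H al hG hG' hal hH h0 h1 hlo hhi
  have cG : Continuous G := continuous_iff_continuousAt.2 fun t => (hG t).continuousAt
  have cF : Continuous fun t : ℝ => Fsym σ w (η - t • ξ) :=
    (continuous_Fsym hσ0 hw).comp (by fun_prop)
  have cH : Continuous H := by
    have : H = fun t => G' t + ((al t * Fsym σ w (η - t • ξ) : ℝ) : ℂ) * G t := funext hH
    rw [this]; fun_prop
  have cN : Continuous fun t : ℝ => ‖η - t • ξ‖ ^ (2 * σ) :=
    Continuous.rpow_const (by fun_prop) fun _ => Or.inr (by positivity)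
  set s := 2 * σ / (2 * σ + 1) with hs
  set ρ := ‖ξ‖ ^ s with hρ
  have hs0 : 0 < s := by positivity
  have hρ0 : 0 ≤ ρ := by positivity
  -- step 1
  have st1 : ∫ t in (-4 : ℝ)..4, ρ ^ 2 * ‖G t‖ ^ 2 ≤ ∫ t in (-4 : ℝ)..4, (K * ‖H t‖ ^ 2 + ‖G t‖ ^ 2) := by
    by_cases hx : 1 ≤ ‖ξ‖
    · have hx0 : 0 < ‖ξ‖ := by linarith
      refine (ode_one (t₀ := inner ℝ η ξ / ‖ξ‖ ^ 2) hG hG' hal cF hH h0 h1 ha₀ hlo hhi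
        (fun t => Fsym_nonneg hw1 _) (ρ := ρ) (by positivity) ?_).trans ?_
      · intro t ht
        set t₀ := inner ℝ η ξ / ‖ξ‖ ^ 2 with ht0
        have e1 : |t - t₀| * ‖ξ‖ ≤ ‖η - t • ξ‖ := by
          have h2 : inner ℝ (η - t • ξ) ξ = (t₀ - t) * ‖ξ‖ ^ 2 := by
            rw [inner_sub_left, real_inner_smul_left, real_inner_self_eq_norm_sq, ht0]
            field_simp
          have h3 := abs_real_inner_le_norm (η - t • ξ) ξ
          rw [h2, abs_mul, abs_sub_comm, abs_of_nonneg (by positivity : 0 ≤ ‖ξ‖ ^ 2)] at h3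
          have : (|t - t₀| * ‖ξ‖) * ‖ξ‖ ≤ ‖η - t • ξ‖ * ‖ξ‖ := by linarith
          exact le_of_mul_le_mul_right this hx0
        have e2 : ‖ξ‖ ^ (1 / (2 * σ + 1)) ≤ ‖η - t • ξ‖ := by
          refine le_trans ?_ e1
          have h4 : ‖ξ‖ ^ (1 / (2 * σ + 1)) * ρ = ‖ξ‖ := by
            rw [hρ, ← Real.rpow_add hx0]
            have : 1 / (2 * σ + 1) + s = 1 := by rw [hs]; field_simp; ring
            rw [this, Real.rpow_one]
          have h5 : 0 < ‖ξ‖ ^ (1 / (2 * σ + 1)) := by positivity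
          calc ‖ξ‖ ^ (1 / (2 * σ + 1)) ≤ ‖ξ‖ ^ (1 / (2 * σ + 1)) * (ρ * |t - t₀|) := by nlinarith
            _ = |t - t₀| * (‖ξ‖ ^ (1 / (2 * σ + 1)) * ρ) := by ring
            _ = _ := by rw [h4]
        have e3 : 1 ≤ ‖η - t • ξ‖ := (Real.one_le_rpow hx (by positivity)).trans e2
        refine le_trans ?_ (Fsym_ge hσ1 hw1 e3)
        calc ρ = (‖ξ‖ ^ (1 / (2 * σ + 1))) ^ (2 * σ) := by
              rw [← Real.rpow_mul hx0.le, hρ, hs]; congr 1; ring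
          _ ≤ _ := by gcongr
      · refine intervalIntegral.integral_mono (by norm_num) (Continuous.intervalIntegrable (by fun_prop) _ _)
          (Continuous.intervalIntegrable (by fun_prop) _ _) fun t => ?_
        have : 0 ≤ ‖G t‖ ^ 2 := by positivity
        simp only [← hK]
        linarith
    · push Not at hx
      refine intervalIntegral.integral_mono (by norm_num) (Continuous.intervalIntegrable (by fun_prop) _ _)
          (Continuous.intervalIntegrable (by fun_prop) _ _) fun t => ?_
      have h3 : ρ ≤ 1 := Real.rpow_le_one (norm_nonneg ξ) hx.le hs0.le
      have h4 : ρ ^ 2 ≤ 1 := pow_le_one₀ hρ0 h3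
      have h5 : 0 ≤ K * ‖H t‖ ^ 2 := by positivity
      have h6 : 0 ≤ ‖G t‖ ^ 2 := by positivity
      simp only
      nlinarith
  -- step 2
  set X := ‖ξ‖ ^ (2 / (2 * σ + 1)) with hX
  have hX0 : 0 ≤ X := by positivity
  have hXρ : X ^ σ = ρ := by
    rw [hX, hρ, ← Real.rpow_mul (norm_nonneg _)]; congr 1; rw [hs]; ring
  have hXξ : ‖ξ‖ = ρ * X ^ (1 / 2 : ℝ) := by
    rw [hX, hρ, ← Real.rpow_mul (norm_nonneg _), ← Real.rpow_add_of_nonneg (norm_nonneg _) hs0.le (by positivity)]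
    have : s + 2 / (2 * σ + 1) * (1 / 2) = 1 := by rw [hs]; field_simp
    rw [this, Real.rpow_one]
  let B : ℝ → ℝ := fun t => 1 + X + ‖η - t • ξ‖ ^ 2
  have hBp : ∀ t, 0 < B t := fun t => by simp only [B]; positivity
  have cB : Continuous B := by simp only [B]; fun_prop
  have hBd : ∀ t, HasDerivAt B (2 * inner ℝ (η - t • ξ) (-ξ)) t := by
    intro t
    have h2 : HasDerivAt (fun t : ℝ => η - t • ξ) (-ξ) t := by
      simpa using ((hasDerivAt_id t).smul_const ξ).const_sub η
    exact h2.norm_sq.const_add (1 + X)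
  have st2 := ode_two (m := fun t => B t ^ σ) (m' := fun t => 2 * inner ℝ (η - t • ξ) (-ξ) * σ * B t ^ (σ - 1))
    hG hG' hal cF hH h0 h1 ha₀ hlo (fun t => Fsym_nonneg hw1 _) hρ0
    (fun t => (hBd t).rpow_const (Or.inl (hBp t).ne')) ?_ (fun t => by have := hBp t; positivity) ?_ ?_
  rotate_left
  · have : Continuous fun t => B t ^ (σ - 1) := cB.rpow_const fun t => Or.inl (hBp t).ne'
    fun_prop
  · intro t
    have hb := hBp t
    have a1 : |inner ℝ (η - t • ξ) (-ξ)| ≤ B t ^ (1 / 2 : ℝ) * (ρ * B t ^ (1 / 2 : ℝ)) := by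
      refine (abs_real_inner_le_norm _ _).trans ?_
      rw [norm_neg]
      gcongr
      · rw [← Real.sqrt_eq_rpow]
        apply Real.le_sqrt_of_sq_le
        simp only [B]; linarith
      · conv_lhs => rw [hXξ]
        gcongr
        simp only [B]; nlinarith [sq_nonneg ‖η - t • ξ‖]
    have a2 : B t ^ (1 / 2 : ℝ) * B t ^ (1 / 2 : ℝ) * B t ^ (σ - 1) = B t ^ σ := by
      rw [← Real.rpow_add hb, ← Real.rpow_add hb]; congr 1; ring
    have a3 : 0 < B t ^ (σ - 1) := by positivity
    have a4 : 0 < B t ^ (1 / 2 : ℝ) := by positivity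
    rw [abs_mul, abs_mul, abs_mul, abs_two, abs_of_pos hσ0, abs_of_pos a3]
    calc 2 * |inner ℝ (η - t • ξ) (-ξ)| * σ * B t ^ (σ - 1)
        ≤ 2 * (B t ^ (1 / 2 : ℝ) * (ρ * B t ^ (1 / 2 : ℝ))) * 1 * B t ^ (σ - 1) := by gcongr
      _ = 2 * (B t ^ (1 / 2 : ℝ) * B t ^ (1 / 2 : ℝ) * B t ^ (σ - 1)) * ρ := by ring
      _ = _ := by rw [a2]
  · intro t
    have b1 : B t ^ σ ≤ (1 + X) ^ σ + (‖η - t • ξ‖ ^ 2) ^ σ :=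
      Real.rpow_add_le_add_rpow (by positivity) (by positivity) hσ0.le hσ1.le
    have b2 : (1 + X) ^ σ ≤ 1 ^ σ + X ^ σ :=
      Real.rpow_add_le_add_rpow (by positivity) (by positivity) hσ0.le hσ1.le
    rw [Real.one_rpow, hXρ] at b2
    have b3 : (‖η - t • ξ‖ ^ 2) ^ σ = ‖η - t • ξ‖ ^ (2 * σ) := by
      rw [← Real.rpow_natCast, ← Real.rpow_mul (norm_nonneg _)]; norm_num
    have b4 := Fsym_ge' hσ0 hσ1 hw1 (η - t • ξ)
    linarith
  have cm : Continuous fun t => B t ^ σ := cB.rpow_const fun t => Or.inr hσ0.le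
  have st3 : ∫ t in (-4 : ℝ)..4, (ρ + ‖η - t • ξ‖ ^ (2 * σ)) ^ 2 * ‖G t‖ ^ 2 ≤
      ∫ t in (-4 : ℝ)..4, 4 / a₀ * (a₀ * ((B t ^ σ) ^ 2 * ‖G t‖ ^ 2)) := by
    refine intervalIntegral.integral_mono (by norm_num) (Continuous.intervalIntegrable (by fun_prop) _ _)
          (Continuous.intervalIntegrable (by fun_prop) _ _) fun t => ?_
    have c1 : ρ ≤ B t ^ σ := by
      rw [← hXρ]; gcongr; simp only [B]; nlinarith [sq_nonneg ‖η - t • ξ‖]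
    have c2 : ‖η - t • ξ‖ ^ (2 * σ) ≤ B t ^ σ := by
      have b3 : (‖η - t • ξ‖ ^ 2) ^ σ = ‖η - t • ξ‖ ^ (2 * σ) := by
        rw [← Real.rpow_natCast, ← Real.rpow_mul (norm_nonneg _)]; norm_num
      rw [← b3]; gcongr; simp only [B]; linarith
    have c3 : 4 / a₀ * (a₀ * ((B t ^ σ) ^ 2 * ‖G t‖ ^ 2)) = (B t ^ σ + B t ^ σ) ^ 2 * ‖G t‖ ^ 2 := by
      field_simp; ring
    simp only
    rw [c3]
    gcongr
  refine st3.trans ?_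
  rw [intervalIntegral.integral_const_mul]
  have st4 : ∫ t in (-4 : ℝ)..4, (4 / a₀ * ‖H t‖ ^ 2 + 16 * a₀ * ‖G t‖ ^ 2 +
        (4 * (1 + a₀) ^ 2 / a₀) * (ρ ^ 2 * ‖G t‖ ^ 2)) ≤ ∫ t in (-4 : ℝ)..4, (4 / a₀ * ‖H t‖ ^ 2 + 16 * a₀ * ‖G t‖ ^ 2 +
        (4 * (1 + a₀) ^ 2 / a₀) * (K * ‖H t‖ ^ 2 + ‖G t‖ ^ 2)) := by
    have hq : 0 ≤ 4 * (1 + a₀) ^ 2 / a₀ := by positivity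
    generalize 4 * (1 + a₀) ^ 2 / a₀ = Q at hq ⊢
    have i1 : ∀ f : ℝ → ℝ, Continuous f → ∫ t in (-4 : ℝ)..4, (4 / a₀ * ‖H t‖ ^ 2 + 16 * a₀ * ‖G t‖ ^ 2 +
        Q * f t) = (∫ t in (-4 : ℝ)..4, (4 / a₀ * ‖H t‖ ^ 2 + 16 * a₀ * ‖G t‖ ^ 2)) +
        Q * ∫ t in (-4 : ℝ)..4, f t := by
      intro f hf
      rw [intervalIntegral.integral_add, intervalIntegral.integral_const_mul Q]
      all_goals exact Continuous.intervalIntegrable (by fun_prop) _ _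
    rw [i1 _ (by fun_prop), i1 (fun t => K * ‖H t‖ ^ 2 + ‖G t‖ ^ 2) (by fun_prop)]
    gcongr
  refine (mul_le_mul_of_nonneg_left (st2.trans st4) (by positivity)).trans ?_
  rw [← intervalIntegral.integral_const_mul]
  refine intervalIntegral.integral_mono (by norm_num) (Continuous.intervalIntegrable (by fun_prop) _ _)
    (Continuous.intervalIntegrable (by fun_prop) _ _) fun t => ?_
  simp only
  rw [mul_assoc (4 / a₀) (4 / a₀ + 16 * a₀ + 4 * (1 + a₀) ^ 2 / a₀ * (K + 1))]
  refine mul_le_mul_of_nonneg_left ?_ (by positivity : (0:ℝ) ≤ 4 / a₀)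
  have d1 : 0 ≤ ‖H t‖ ^ 2 := by positivity
  have d2 : 0 ≤ ‖G t‖ ^ 2 := by positivity
  have hq : 0 ≤ 4 * (1 + a₀) ^ 2 / a₀ := by positivity
  have hr : 0 ≤ 4 / a₀ := by positivity
  generalize 4 * (1 + a₀) ^ 2 / a₀ = Q at hq ⊢
  generalize 4 / a₀ = r at hr ⊢
  generalize ‖H t‖ ^ 2 = h at d1 ⊢
  generalize ‖G t‖ ^ 2 = g at d2 ⊢
  have d3 : 0 ≤ 16 * a₀ * h := by positivity
  have d4 : 0 ≤ r * g := by positivity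
  have d5 : 0 ≤ Q * h := by positivity
  have d6 : 0 ≤ Q * K * g := by positivity
  clear_value K
  nlinarith
end ode

section symbols

theorem rpow_pert {q : ℝ} (hq : 0 < q) {ε : ℝ} (hε : 0 < ε) :
    ∃ C : ℝ, 0 ≤ C ∧ ∀ x x' y : ℝ, 0 ≤ x → 0 ≤ x' → |x' - x| ≤ y → |x' ^ q - x ^ q| ≤ ε * x ^ q + C * y ^ q := by
  have hc : ContinuousAt (fun z : ℝ => z ^ q) 1 := Real.continuousAt_rpow_const 1 q (Or.inl one_ne_zero)
  obtain ⟨κ, hκ, h⟩ := Metric.continuousAt_iff.1 hc ε hε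
  refine ⟨(1 / κ + 1) ^ q, by positivity, fun x x' y hx hx' hy => ?_⟩
  have hy0 : 0 ≤ y := (abs_nonneg _).trans hy
  by_cases hc : y < κ * x
  · have hx0 : 0 < x := by
      rcases hx.eq_or_lt with h0 | h0
      · rw [← h0] at hc; linarith
      · exact h0
    have h1 : dist (x' / x) 1 < κ := by
      rw [Real.dist_eq]
      have : x' / x - 1 = (x' - x) / x := by field_simp
      rw [this, abs_div, abs_of_pos hx0, div_lt_iff₀ hx0]
      linarith
    have h2 := h h1
    rw [Real.dist_eq] at h2
    have h3 : x' ^ q - x ^ q = ((x' / x) ^ q - 1 ^ q) * x ^ q := by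
      rw [Real.div_rpow hx' hx, Real.one_rpow]
      have : x ^ q ≠ 0 := by positivity
      field_simp
    rw [h3, abs_mul, abs_of_nonneg (by positivity : 0 ≤ x ^ q)]
    have : 0 ≤ (1 / κ + 1) ^ q * y ^ q := by positivity
    have h4 := mul_le_mul_of_nonneg_right h2.le (by positivity : 0 ≤ x ^ q)
    linarith
  · push Not at hc
    have h1 : x ≤ 1 / κ * y := by
      rw [one_div, inv_mul_eq_div, le_div_iff₀ hκ]; linarith
    have h2 : x' ≤ (1 / κ + 1) * y := by
      have := (abs_le.1 hy).2
      linarith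
    have h3 : x ≤ (1 / κ + 1) * y := by linarith
    have e1 : x ^ q ≤ (1 / κ + 1) ^ q * y ^ q := by
      rw [← Real.mul_rpow (by positivity) hy0]; gcongr
    have e2 : x' ^ q ≤ (1 / κ + 1) ^ q * y ^ q := by
      rw [← Real.mul_rpow (by positivity) hy0]; gcongr
    have e3 : 0 ≤ x ^ q := by positivity
    have e4 : 0 ≤ x' ^ q := by positivity
    have e5 : 0 ≤ ε * x ^ q := by positivity
    rw [abs_le]; constructor <;> linarith

theorem rpow_le_one_add_sq {q r : ℝ} (hq : 0 < q) (hq2 : q ≤ 2) (hr : 0 ≤ r) : r ^ q ≤ 1 + r ^ 2 := by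
  by_cases h : r ≤ 1
  · have := Real.rpow_le_one hr h hq.le
    nlinarith
  · push Not at h
    have : r ^ q ≤ r ^ (2 : ℝ) := Real.rpow_le_rpow_of_exponent_le h.le hq2
    rw [Real.rpow_two] at this
    linarith

/-- the weight `|ξ|^s + |η|^{2σ}` -/
def Nsym (σ : ℝ) (α : Y n) : ℝ := ‖α.fst‖ ^ (2 * σ / (2 * σ + 1)) + ‖α.snd‖ ^ (2 * σ)

theorem Nsym_nonneg (σ : ℝ) (α : Y n) : 0 ≤ Nsym σ α := by unfold Nsym; positivity

theorem continuous_Nsym {σ : ℝ} (hσ0 : 0 < σ) : Continuous (Nsym (n := n) σ) := by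
  unfold Nsym
  exact (continuous_Yfst.norm.rpow_const fun _ => Or.inr (by positivity)).add
    (continuous_Ysnd.norm.rpow_const fun _ => Or.inr (by positivity))

theorem Yfst_le (y : Y n) : ‖y.fst‖ ≤ ‖y‖ := by
  apply le_of_sq_le_sq _ (norm_nonneg _)
  rw [Y_norm_sq]; nlinarith [sq_nonneg ‖y.snd‖]
theorem Ysnd_le (y : Y n) : ‖y.snd‖ ≤ ‖y‖ := by
  apply le_of_sq_le_sq _ (norm_nonneg _)
  rw [Y_norm_sq]; nlinarith [sq_nonneg ‖y.fst‖]

theorem sexp_pos {σ : ℝ} (hσ0 : 0 < σ) : 0 < 2 * σ / (2 * σ + 1) := by positivity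
theorem sexp_lt {σ : ℝ} (hσ0 : 0 < σ) : 2 * σ / (2 * σ + 1) < 1 := by
  rw [div_lt_one (by positivity)]; linarith

theorem Nsym_le {σ : ℝ} (hσ0 : 0 < σ) (hσ1 : σ < 1) (α : Y n) : Nsym σ α ≤ 2 * (1 + ‖α‖) ^ 2 := by
  have h1 := rpow_le_one_add_sq (sexp_pos hσ0) (by linarith [sexp_lt hσ0]) (norm_nonneg α.fst)
  have h2 := rpow_le_one_add_sq (q := 2 * σ) (by positivity) (by linarith) (norm_nonneg α.snd)
  unfold Nsym
  nlinarith [Y_norm_sq α, norm_nonneg α]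

theorem shT_fst (t : ℝ) (y : Y n) : (shT t y).fst = y.fst := rfl
theorem shT_snd (t : ℝ) (y : Y n) : (shT t y).snd = y.snd - t • y.fst := rfl

theorem shT_diff {t : ℝ} (ht : |t| ≤ 4) (ζ ζ' : Y n) :
    |‖(shT t ζ).fst‖ - ‖(shT t ζ').fst‖| ≤ ‖ζ - ζ'‖ ∧
    |‖(shT t ζ).snd‖ - ‖(shT t ζ').snd‖| ≤ 5 * ‖ζ - ζ'‖ := by
  constructor
  · refine (abs_norm_sub_norm_le _ _).trans ?_
    exact Yfst_le (ζ - ζ')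
  · refine (abs_norm_sub_norm_le _ _).trans ?_
    have e : (shT t ζ).snd - (shT t ζ').snd = (ζ - ζ').snd - t • (ζ - ζ').fst := by
      rw [shT_snd, shT_snd, WithLp.sub_fst, WithLp.sub_snd, smul_sub]; abel
    rw [e]
    refine (norm_sub_le _ _).trans ?_
    rw [norm_smul, Real.norm_eq_abs]
    have h1 := Yfst_le (ζ - ζ')
    have h2 := Ysnd_le (ζ - ζ')
    have := mul_le_mul ht h1 (norm_nonneg _) (by norm_num)
    linarith

theorem symb_snd {σ : ℝ} (hσ0 : 0 < σ) (hσ1 : σ < 1) {ε : ℝ} (hε : 0 < ε) :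
    ∃ C : ℝ, 0 ≤ C ∧ ∀ t : ℝ, |t| ≤ 4 → ∀ ζ ζ' : Y n,
      |‖(shT t ζ).snd‖ ^ (2 * σ) - ‖(shT t ζ').snd‖ ^ (2 * σ)| ≤
        ε * ‖(shT t ζ').snd‖ ^ (2 * σ) + C * (1 + ‖ζ - ζ'‖ ^ 2) := by
  obtain ⟨C, hC, h⟩ := rpow_pert (q := 2 * σ) (by positivity) hε
  refine ⟨25 * C, by positivity, fun t ht ζ ζ' => ?_⟩
  refine (h _ _ _ (norm_nonneg _) (norm_nonneg _) (shT_diff ht ζ ζ').2).trans ?_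
  have h2 := rpow_le_one_add_sq (q := 2 * σ) (by positivity) (by linarith) (by positivity : 0 ≤ 5 * ‖ζ - ζ'‖)
  have h3 : C * (5 * ‖ζ - ζ'‖) ^ (2 * σ) ≤ 25 * C * (1 + ‖ζ - ζ'‖ ^ 2) := by
    calc _ ≤ C * (1 + (5 * ‖ζ - ζ'‖) ^ 2) := by gcongr
      _ ≤ _ := by nlinarith
  linarith

theorem symb_N {σ : ℝ} (hσ0 : 0 < σ) (hσ1 : σ < 1) {ε : ℝ} (hε : 0 < ε) :
    ∃ C : ℝ, 0 ≤ C ∧ ∀ t : ℝ, |t| ≤ 4 → ∀ ζ ζ' : Y n,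
      |Nsym σ (shT t ζ) - Nsym σ (shT t ζ')| ≤ ε * Nsym σ (shT t ζ') + C * (1 + ‖ζ - ζ'‖ ^ 2) := by
  obtain ⟨C1, hC1, h1⟩ := symb_snd (n := n) hσ0 hσ1 hε
  obtain ⟨C2, hC2, h2⟩ := rpow_pert (sexp_pos hσ0) hε
  refine ⟨C1 + C2, by positivity, fun t ht ζ ζ' => ?_⟩
  have a1 := h1 t ht ζ ζ'
  have a2 := h2 _ _ _ (norm_nonneg _) (norm_nonneg _) (shT_diff ht ζ ζ').1
  have a3 := rpow_le_one_add_sq (sexp_pos hσ0) (by linarith [sexp_lt hσ0]) (norm_nonneg (ζ - ζ'))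
  have a4 := mul_le_mul_of_nonneg_left a3 hC2
  unfold Nsym
  rw [abs_le] at *
  constructor <;> linarith

theorem symb_F {σ : ℝ} (hσ0 : 0 < σ) (hσ1 : σ < 1) {w : E n → ℝ} (hw1 : ∀ η, 0 ≤ w η ∧ w η ≤ 1)
    (hout : ∀ η : E n, 2 ≤ ‖η‖ → w η = 1) {ε : ℝ} (hε : 0 < ε) :
    ∃ C : ℝ, 0 ≤ C ∧ ∀ t : ℝ, |t| ≤ 4 → ∀ ζ ζ' : Y n,
      |Fsym σ w (shT t ζ).snd - Fsym σ w (shT t ζ').snd| ≤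
        ε * Nsym σ (shT t ζ') + C * (1 + ‖ζ - ζ'‖ ^ 2) := by
  obtain ⟨C1, hC1, h1⟩ := symb_snd (n := n) hσ0 hσ1 hε
  refine ⟨C1 + 5, by positivity, fun t ht ζ ζ' => ?_⟩
  have a1 := h1 t ht ζ ζ'
  have b1 := Fsym_ge' hσ0 hσ1 hw1 (shT t ζ).snd
  have b2 := Fsym_ge' hσ0 hσ1 hw1 (shT t ζ').snd
  have b3 := Fsym_le' hσ0 hw1 hout (shT t ζ).snd
  have b4 := Fsym_le' hσ0 hw1 hout (shT t ζ').snd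
  have b5 : 0 ≤ ε * ‖(shT t ζ').fst‖ ^ (2 * σ / (2 * σ + 1)) := by positivity
  have b6 := sq_nonneg ‖ζ - ζ'‖
  unfold Nsym
  rw [abs_le] at *
  constructor <;> linarith

theorem Fsym_le_N {σ : ℝ} (hσ0 : 0 < σ) {w : E n → ℝ} (hw1 : ∀ η, 0 ≤ w η ∧ w η ≤ 1)
    (hout : ∀ η : E n, 2 ≤ ‖η‖ → w η = 1) (α : Y n) : Fsym σ w α.snd ≤ Nsym σ α + 4 := by
  have := Fsym_le' hσ0 hw1 hout α.snd
  have b5 : 0 ≤ ‖α.fst‖ ^ (2 * σ / (2 * σ + 1)) := by positivity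
  unfold Nsym
  linarith

theorem Fsym_growth {σ : ℝ} (hσ0 : 0 < σ) (hσ1 : σ < 1) {w : E n → ℝ} (hw1 : ∀ η, 0 ≤ w η ∧ w η ≤ 1)
    (hout : ∀ η : E n, 2 ≤ ‖η‖ → w η = 1) (α : Y n) : Fsym σ w α.snd ≤ 6 * (1 + ‖α‖) ^ 2 := by
  have := Fsym_le_N hσ0 hw1 hout α
  have := Nsym_le hσ0 hσ1 α
  nlinarith [norm_nonneg α]

theorem shT_norm_le (t : ℝ) (ζ : Y n) : ‖shT t ζ‖ ≤ (2 + |t|) * ‖ζ‖ := by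
  have h1 := Yfst_le ζ
  have h2 := Ysnd_le ζ
  have h3 : ‖(shT t ζ).snd‖ ≤ (1 + |t|) * ‖ζ‖ := by
    rw [shT_snd]
    refine (norm_sub_le _ _).trans ?_
    rw [norm_smul, Real.norm_eq_abs]
    have := mul_le_mul_of_nonneg_left h1 (abs_nonneg t)
    linarith
  have h4 : ‖(shT t ζ).fst‖ ≤ ‖ζ‖ := h1
  have h5 : ‖shT t ζ‖ ≤ ‖(shT t ζ).fst‖ + ‖(shT t ζ).snd‖ := by
    apply le_of_sq_le_sq _ (by positivity)
    rw [Y_norm_sq]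
    nlinarith [norm_nonneg (shT t ζ).fst, norm_nonneg (shT t ζ).snd]
  linarith

end symbols

section flow

theorem STF_continuous {V : Type*} [NormedAddCommGroup V] [InnerProductSpace ℝ V] [FiniteDimensional ℝ V]
    [MeasurableSpace V] [BorelSpace V] {X : Type*} [TopologicalSpace X] [FirstCountableTopology X]
    (χ : SchwartzMap V ℂ) {q : X → V → ℂ} {p ζ : X → V} (hp : Continuous p) (hζ : Continuous ζ)
    (hq : Continuous (Function.uncurry q)) (B : ℝ) (hB : ∀ x y, ‖q x y‖ ≤ B) :
    Continuous fun x => STF χ (q x) (p x) (ζ x) := by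
  have e : ∀ x, STF χ (q x) (p x) (ζ x) =
      (Real.fourierChar (-inner ℝ (p x) (ζ x)) : ℂ) * 𝓕 (fun y => χ y * q x (y + p x)) (ζ x) := by
    intro x
    rw [STF, Real.fourier_eq, Real.fourier_eq, ← integral_const_mul,
      ← integral_add_right_eq_self _ (p x)]
    congr 1; ext y
    simp only [add_sub_cancel_right, Circle.smul_def, smul_eq_mul]
    rw [inner_add_left, neg_add, AddChar.map_add_eq_mul]
    push_cast
    ring
  simp_rw [e]
  refine Continuous.mul ?_ ?_
  · exact continuous_induced_dom.comp (Real.continuous_fourierChar.comp (by fun_prop))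
  · refine continuous_fourier_param (bd := fun y => ‖χ y‖ * B) hζ ?_ (χ.integrable.norm.mul_const B) ?_
    · have h1 : Continuous fun z : X × V => q z.1 (z.2 + p z.1) :=
        hq.comp (f := fun z : X × V => (z.1, z.2 + p z.1)) (by fun_prop)
      have h2 : Continuous fun z : X × V => χ z.2 := χ.continuous.comp continuous_snd
      exact h2.mul h1
    · intro x y
      rw [norm_mul]
      gcongr
      exact hB x _

theorem sz_bdd {V : Type*} [NormedAddCommGroup V] [NormedSpace ℝ V] (f : SchwartzMap V ℂ) :
    ∃ C, 0 ≤ C ∧ ∀ x, ‖f x‖ ≤ C := by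
  obtain ⟨C, hC, h⟩ := sz_decay f 0
  exact ⟨C, hC, fun x => by simpa using h x⟩

/-- `vC` as a coordinate is a continuous linear map -/
def vCL (i : Fin n) : Z n →L[ℝ] ℝ := EuclideanSpace.proj (Sum.inr (Sum.inr i))

theorem vCL_apply (i : Fin n) (z : Z n) : vCL i z = vC z i := rfl

theorem exists_L (u : SchwartzMap (Z n) ℂ) : ∃ Lu : SchwartzMap (Z n) ℂ, ∀ z,
    Lu z = fderiv ℝ u z eT + ∑ i : Fin n, (vC z i : ℂ) * fderiv ℝ u z (eX i) := by
  let D : Z n → SchwartzMap (Z n) ℂ := fun m => LineDeriv.lineDerivOp m u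
  have hD : ∀ m z, D m z = fderiv ℝ u z m := fun m z => SchwartzMap.lineDerivOp_apply_eq_fderiv m u z
  refine ⟨D eT + ∑ i : Fin n, SchwartzMap.smulLeftCLM ℂ (fun z => vCL i z) (D (eX i)), fun z => ?_⟩
  have hg : ∀ i : Fin n, Function.HasTemperateGrowth (fun z : Z n => vCL i z) :=
    fun i => (vCL i).hasTemperateGrowth
  rw [SchwartzMap.add_apply, hD, SchwartzMap.sum_apply]
  congr 1
  refine Finset.sum_congr rfl fun i _ => ?_
  rw [SchwartzMap.smulLeftCLM_apply_apply (hg i), hD, vCL_apply, Complex.real_smul]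

theorem mkZ_one_eq (v : E n) : mkZ 1 v 0 = eT + ∑ i : Fin n, v i • eX i := by
  ext j
  rcases j with j | j | j
  · simp [mkZ, eT, eX]
  · simp [mkZ, eT, eX, Finset.sum_apply, Pi.single_apply]
  · simp [mkZ, eT, eX]

theorem hasDerivAt_jt (u : SchwartzMap (Z n) ℂ) {Lu : Z n → ℂ} (hL : ∀ z,
    Lu z = fderiv ℝ u z eT + ∑ i : Fin n, (vC z i : ℂ) * fderiv ℝ u z (eX i)) (y : Y n) (t : ℝ) :
    HasDerivAt (fun t => u (jt t y)) (Lu (jt t y)) t := by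
  have h1 : HasDerivAt (fun t => jt t y) (mkZ 1 y.snd 0) t := by
    have e : (fun t => jt t y) = fun t => mkZ 0 y.fst y.snd + t • mkZ 1 y.snd 0 := by
      ext1 t
      rw [← mkZ_smul, ← mkZ_add, jt]; simp
    rw [e]
    simpa using ((hasDerivAt_id t).smul_const (mkZ 1 y.snd 0)).const_add (mkZ 0 y.fst y.snd)
  have h2 := (u.hasFDerivAt (jt t y)).comp_hasDerivAt t h1
  rw [hL]
  have e2 : fderiv ℝ u (jt t y) (mkZ 1 y.snd 0) = fderiv ℝ u (jt t y) eT +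
      ∑ i : Fin n, (vC (jt t y) i : ℂ) * fderiv ℝ u (jt t y) (eX i) := by
    rw [mkZ_one_eq, map_add, map_sum]
    congr 1
    refine Finset.sum_congr rfl fun i _ => ?_
    rw [map_smul, Complex.real_smul]; rfl
  rw [← e2]; exact h2

theorem hasDerivAt_STF (χ : SchwartzMap (Y n) ℂ) (u Lu : SchwartzMap (Z n) ℂ) (hL : ∀ z,
    Lu z = fderiv ℝ u z eT + ∑ i : Fin n, (vC z i : ℂ) * fderiv ℝ u z (eX i)) (p ζ : Y n) (t : ℝ) :
    HasDerivAt (fun t => STF χ (fun y => u (jt t y)) p ζ) (STF χ (fun y => Lu (jt t y)) p ζ) t := by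
  obtain ⟨B, hB0, hB⟩ := sz_bdd Lu
  obtain ⟨B', hB0', hB'⟩ := sz_bdd u
  simp only [STF, Real.fourier_eq]
  have cj : ∀ t, Continuous fun y : Y n => jt t y := fun t => continuous_jt.comp (Continuous.prodMk_right t)
  have hχp : Integrable (fun y => χ (y - p)) := χ.integrable.comp_sub_right p
  have cχ : Continuous fun y => χ (y - p) := χ.continuous.comp (by fun_prop)
  have ce : Continuous fun y : Y n => Real.fourierChar (-inner ℝ y ζ) :=
    Real.continuous_fourierChar.comp (by fun_prop)
  have cu : ∀ (f : SchwartzMap (Z n) ℂ) t, Continuous fun y => Real.fourierChar (-inner ℝ y ζ) • (χ (y - p) * f (jt t y)) :=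
    fun f t => ce.smul (cχ.mul (f.continuous.comp (cj t)))
  refine (hasDerivAt_integral_of_dominated_loc_of_deriv_le (μ := volume) (bound := fun y => ‖χ (y - p)‖ * B)
    (F := fun t y => Real.fourierChar (-inner ℝ y ζ) • (χ (y - p) * u (jt t y)))
    (F' := fun t y => Real.fourierChar (-inner ℝ y ζ) • (χ (y - p) * Lu (jt t y))) (s := Set.univ)
    Filter.univ_mem ?_ ?_ ?_ ?_ ?_ ?_).2
  · exact Filter.Eventually.of_forall fun t => (cu u t).aestronglyMeasurable
  · refine Integrable.mono' (hχp.norm.mul_const B') (cu u t).aestronglyMeasurable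
      (Filter.Eventually.of_forall fun y => ?_)
    rw [Circle.norm_smul, norm_mul]
    gcongr
    exact hB' _
  · exact (cu Lu t).aestronglyMeasurable
  · refine Filter.Eventually.of_forall fun y t _ => ?_
    rw [Circle.norm_smul, norm_mul]
    gcongr
    exact hB _
  · exact hχp.norm.mul_const B
  · refine Filter.Eventually.of_forall fun y t _ => ?_
    have := ((hasDerivAt_jt u hL y t).const_mul (χ (y - p))).const_smul (Real.fourierChar (-inner ℝ y ζ))
    exact this

theorem exists_window (δ : ℝ) (hδ : 0 < δ) : ∃ χ : SchwartzMap (Y n) ℂ, winc χ ≠ 0 ∧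
    ∀ y, χ y ≠ 0 → ‖y‖ ≤ δ := by
  let f : ContDiffBump (0 : Y n) := ⟨δ / 2, δ, by positivity, by linarith⟩
  let g : Y n → ℂ := fun y => ((f y : ℝ) : ℂ)
  have hgs : HasCompactSupport g := f.hasCompactSupport.comp_left (g := fun x : ℝ => (x : ℂ)) (by simp)
  have hgc : ContDiff ℝ (⊤ : ℕ∞) g := Complex.ofRealCLM.contDiff.comp f.contDiff
  refine ⟨hgs.toSchwartzMap hgc, ?_, ?_⟩
  · intro h0
    unfold winc at h0
    have hc : Continuous fun y => (hgs.toSchwartzMap hgc) y := SchwartzMap.continuous _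
    rw [lintegral_eq_zero_iff (hc.measurable.enorm.pow_const 2)] at h0
    have h1 : (fun y => (hgs.toSchwartzMap hgc) y) =ᵐ[volume] fun _ => (0 : ℂ) := by
      filter_upwards [h0] with y hy
      simpa using hy
    have h2 := (Continuous.ae_eq_iff_eq volume hc continuous_const).1 h1
    have h3 := congrFun h2 0
    have h4 : f 0 = 1 := f.one_of_mem_closedBall (by simp; positivity)
    have h5 : g 0 = 0 := h3
    simp [g, h4] at h5
  · intro y hy
    have h1 : g y ≠ 0 := hy
    by_contra hc
    push Not at hc
    apply h1
    have : f y = 0 := f.zero_of_le_dist (by simpa using hc.le)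
    simp [g, this]

end flow

section fraclap

theorem enorm_sq_eq (z : ℂ) : ‖z‖ₑ ^ 2 = ENNReal.ofReal (‖z‖ ^ 2) := by
  rw [← ofReal_norm, ENNReal.ofReal_pow (norm_nonneg _)]

theorem ens2 {z a b : ℂ} {c d : ℝ} (hc : 0 ≤ c) (hd : 0 ≤ d) (h : ‖z‖ ^ 2 ≤ c * ‖a‖ ^ 2 + d * ‖b‖ ^ 2) :
    ‖z‖ₑ ^ 2 ≤ ENNReal.ofReal c * ‖a‖ₑ ^ 2 + ENNReal.ofReal d * ‖b‖ₑ ^ 2 := by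
  simp only [enorm_sq_eq]
  rw [← ENNReal.ofReal_mul hc, ← ENNReal.ofReal_mul hd, ← ENNReal.ofReal_add (by positivity) (by positivity)]
  exact ENNReal.ofReal_le_ofReal h

theorem memLp_of_lt_top {V : Type*} [NormedAddCommGroup V] [InnerProductSpace ℝ V] [FiniteDimensional ℝ V]
    [MeasurableSpace V] [BorelSpace V] {f : V → ℂ} (hc : Continuous f) (h : ∫⁻ x, ‖f x‖ₑ ^ 2 < ∞) :
    MemLp f 2 := by
  refine ⟨hc.aestronglyMeasurable, ?_⟩
  rw [← eLpNorm_two_sq] at h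
  by_contra h2
  rw [not_lt, top_le_iff] at h2
  rw [h2] at h
  simp at h

theorem norm_fourierInv_le {V : Type*} [NormedAddCommGroup V] [InnerProductSpace ℝ V] [FiniteDimensional ℝ V]
    [MeasurableSpace V] [BorelSpace V] (f : V → ℂ) (x : V) : ‖𝓕⁻ f x‖ ≤ ∫ y, ‖f y‖ := by
  rw [Real.fourierInv_eq]
  refine (norm_integral_le_integral_norm _).trans (le_of_eq ?_)
  congr 1; ext y
  rw [Circle.norm_smul]

theorem slice_mul (u : SchwartzMap (Z n) ℂ) {M : Y n → ℂ} (hM : Continuous M) (C : ℝ) (k : ℕ)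
    (h : ∀ x, ‖M x‖ ≤ C * (1 + ‖x‖) ^ k) (t : ℝ) :
    Integrable (fun ζ => M (shT t ζ) * Gh u t ζ) ∧ MemLp (fun ζ => M (shT t ζ) * Gh u t ζ) 2 := by
  obtain ⟨g, hg⟩ := exists_gs u t
  have e : Gh u t = ((𝓕 g : SchwartzMap (Y n) ℂ) : Y n → ℂ) := by
    rw [SchwartzMap.fourier_coe, Gh]
    congr 1; ext y; exact (hg y).symm
  have hC : 0 ≤ C := by
    have := (norm_nonneg _).trans (h 0)
    simpa using this
  rw [e]
  refine sz_mul (𝓕 g) (hM.comp (continuous_shT' t)) (C * (2 + |t|) ^ k) k fun x => ?_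
  refine (h _).trans ?_
  rw [mul_assoc, ← mul_pow]
  gcongr
  have := shT_norm_le t x
  nlinarith [abs_nonneg t]

theorem slice_Gh (u : SchwartzMap (Z n) ℂ) (t : ℝ) : Integrable (Gh u t) ∧ MemLp (Gh u t) 2 := by
  have := slice_mul u (M := fun _ => 1) continuous_const 1 0 (by simp) t
  simpa using this

theorem Gh_inv (u : SchwartzMap (Z n) ℂ) (t : ℝ) : (fun y => u (jt t y)) = 𝓕⁻ (Gh u t) := by
  obtain ⟨g, hg⟩ := exists_gs u t
  have e : (fun y => u (jt t y)) = (g : Y n → ℂ) := by ext y; exact (hg y).symm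
  rw [Gh, e]
  rw [← SchwartzMap.fourier_coe]
  have := SchwartzMap.fourierInv_coe (𝓕 g : SchwartzMap (Y n) ℂ)
  rw [← this]
  simp

variable {σ : ℝ} (hσ0 : 0 < σ) (hσ1 : σ < 1) {w : E n → ℝ} (hw : Continuous w)
  (hw1 : ∀ η, 0 ≤ w η ∧ w η ≤ 1) (hout : ∀ η : E n, 2 ≤ ‖η‖ → w η = 1)

theorem Fsym_norm_le (hσ0 : 0 < σ) (hσ1 : σ < 1)
  (hw1 : ∀ η, 0 ≤ w η ∧ w η ≤ 1) (hout : ∀ η : E n, 2 ≤ ‖η‖ → w η = 1) (α : Y n) :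
    ‖(Fsym σ w α.snd : ℂ)‖ ≤ 6 * (1 + ‖α‖) ^ 2 := by
  rw [Complex.norm_real, Real.norm_eq_abs, abs_of_nonneg (Fsym_nonneg hw1 _)]
  exact Fsym_growth hσ0 hσ1 hw1 hout α

theorem Nsym_norm_le (hσ0 : 0 < σ) (hσ1 : σ < 1) (α : Y n) :
    ‖(Nsym σ α : ℂ)‖ ≤ 2 * (1 + ‖α‖) ^ 2 := by
  rw [Complex.norm_real, Real.norm_eq_abs, abs_of_nonneg (Nsym_nonneg _ _)]
  exact Nsym_le hσ0 hσ1 α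

theorem continuous_FsymC (hσ0 : 0 < σ) (hw : Continuous w) :
    Continuous fun α : Y n => (Fsym σ w α.snd : ℂ) :=
  Complex.continuous_ofReal.comp ((continuous_Fsym hσ0 hw).comp continuous_Ysnd)

theorem J1_norm_le (ζ : Z n) : ‖mkY (xC ζ) (vC ζ)‖ ≤ ‖ζ‖ := by
  apply le_of_sq_le_sq _ (norm_nonneg _)
  rw [Y_norm_sq, Z_norm_sq]
  show ‖xC ζ‖ ^ 2 + ‖vC ζ‖ ^ 2 ≤ _
  nlinarith [sq_nonneg (tC ζ)]

theorem mul_fourier_mem (u : SchwartzMap (Z n) ℂ) {M : Y n → ℂ} (hM : Continuous M) (C : ℝ) (k : ℕ)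
    (h : ∀ x, ‖M x‖ ≤ C * (1 + ‖x‖) ^ k) :
    Integrable (fun ζ => M (mkY (xC ζ) (vC ζ)) * 𝓕 (u : Z n → ℂ) ζ) ∧
      MemLp (fun ζ => M (mkY (xC ζ) (vC ζ)) * 𝓕 (u : Z n → ℂ) ζ) 2 := by
  have hC : 0 ≤ C := by
    have := (norm_nonneg _).trans (h 0)
    simpa using this
  rw [← SchwartzMap.fourier_coe]
  refine sz_mul (𝓕 u) (hM.comp continuous_J1t) C k fun x => ?_
  refine (h _).trans ?_
  gcongr
  exact J1_norm_le x

theorem fl_jt (hσ0 : 0 < σ) (hσ1 : σ < 1) (hw : Continuous w)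
    (hw1 : ∀ η, 0 ≤ w η ∧ w η ≤ 1) (hout : ∀ η : E n, 2 ≤ ‖η‖ → w η = 1) (u : SchwartzMap (Z n) ℂ) (t : ℝ) :
    (fun y => fracLap σ w u (jt t y)) = 𝓕⁻ (fun ζ => (Fsym σ w (shT t ζ).snd : ℂ) * Gh u t ζ) := by
  ext y
  exact mult_jt u (continuous_FsymC hσ0 hw) 6 2 (Fsym_norm_le hσ0 hσ1 hw1 hout) t y

theorem fl_cont (hσ0 : 0 < σ) (hσ1 : σ < 1) (hw : Continuous w)
    (hw1 : ∀ η, 0 ≤ w η ∧ w η ≤ 1) (hout : ∀ η : E n, 2 ≤ ‖η‖ → w η = 1) (u : SchwartzMap (Z n) ℂ) :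
    Continuous (fracLap σ w u) :=
  continuous_fourierInv (mul_fourier_mem u (continuous_FsymC hσ0 hw) 6 2 (Fsym_norm_le hσ0 hσ1 hw1 hout)).1

theorem fl_bdd (u : SchwartzMap (Z n) ℂ) : ∃ C, 0 ≤ C ∧ ∀ z, ‖fracLap σ w u z‖ ≤ C :=
  ⟨_, (norm_nonneg _).trans (norm_fourierInv_le _ 0), fun z => norm_fourierInv_le _ z⟩

theorem fl_lint (hσ0 : 0 < σ) (hσ1 : σ < 1) (hw : Continuous w)
    (hw1 : ∀ η, 0 ≤ w η ∧ w η ≤ 1) (hout : ∀ η : E n, 2 ≤ ‖η‖ → w η = 1) (u : SchwartzMap (Z n) ℂ) :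
    ∫⁻ z, ‖fracLap σ w u z‖ₑ ^ 2 = ∫⁻ ζ, ‖(Fsym σ w (vC ζ) : ℂ) * 𝓕 (u : Z n → ℂ) ζ‖ₑ ^ 2 := by
  have := mul_fourier_mem u (continuous_FsymC hσ0 hw) 6 2 (Fsym_norm_le hσ0 hσ1 hw1 hout)
  exact planchInv this.1 this.2

theorem fl_memLp (hσ0 : 0 < σ) (hσ1 : σ < 1) (hw : Continuous w)
    (hw1 : ∀ η, 0 ≤ w η ∧ w η ≤ 1) (hout : ∀ η : E n, 2 ≤ ‖η‖ → w η = 1) (u : SchwartzMap (Z n) ℂ) :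
    MemLp (fracLap σ w u) 2 := by
  refine memLp_of_lt_top (fl_cont hσ0 hσ1 hw hw1 hout u) ?_
  rw [fl_lint hσ0 hσ1 hw hw1 hout]
  exact memLp_lt_top (mul_fourier_mem u (continuous_FsymC hσ0 hw) 6 2 (Fsym_norm_le hσ0 hσ1 hw1 hout)).2

theorem fl_slice_memLp (hσ0 : 0 < σ) (hσ1 : σ < 1) (hw : Continuous w)
    (hw1 : ∀ η, 0 ≤ w η ∧ w η ≤ 1) (hout : ∀ η : E n, 2 ≤ ‖η‖ → w η = 1) (u : SchwartzMap (Z n) ℂ) (t : ℝ) :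
    MemLp (fun y => fracLap σ w u (jt t y)) 2 := by
  have h := slice_mul u (continuous_FsymC hσ0 hw) 6 2 (Fsym_norm_le hσ0 hσ1 hw1 hout) t
  rw [fl_jt hσ0 hσ1 hw hw1 hout]
  refine memLp_of_lt_top (continuous_fourierInv h.1) ?_
  rw [planchInv h.1 h.2]
  exact memLp_lt_top h.2

theorem sz_slice_memLp (u : SchwartzMap (Z n) ℂ) (t : ℝ) : MemLp (fun y => u (jt t y)) 2 := by
  obtain ⟨g, hg⟩ := exists_gs u t
  have e : (fun y => u (jt t y)) = (g : Y n → ℂ) := by ext y; exact (hg y).symm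
  rw [e]; exact g.memLp 2

/-- `|F û|² ≤ 2|N û|² + 32 |û|²` integrated -/
theorem fl_lint_le (hσ0 : 0 < σ) (hσ1 : σ < 1) (hw : Continuous w)
    (hw1 : ∀ η, 0 ≤ w η ∧ w η ≤ 1) (hout : ∀ η : E n, 2 ≤ ‖η‖ → w η = 1) (u : SchwartzMap (Z n) ℂ) :
    ∫⁻ z, ‖fracLap σ w u z‖ₑ ^ 2 ≤
      ENNReal.ofReal 2 * (∫⁻ ζ, ‖(Nsym σ (mkY (xC ζ) (vC ζ)) : ℂ) * 𝓕 (u : Z n → ℂ) ζ‖ₑ ^ 2) + ENNReal.ofReal 32 * ∫⁻ z, ‖u z‖ₑ ^ 2 := by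
  rw [fl_lint hσ0 hσ1 hw hw1 hout, ← planch u.integrable (u.memLp 2)]
  have c2 := (continuous_fourier u.integrable).measurable.enorm.pow_const 2
  have c1 : Continuous fun ζ => (Nsym σ (mkY (xC ζ) (vC ζ)) : ℂ) * 𝓕 (u : Z n → ℂ) ζ :=
    (Complex.continuous_ofReal.comp ((continuous_Nsym hσ0).comp continuous_J1t)).mul (continuous_fourier u.integrable)
  rw [← lintegral_const_mul _ (c1.measurable.enorm.pow_const 2), ← lintegral_const_mul _ c2,
    ← lintegral_add_right _ (c2.const_mul _)]
  refine lintegral_mono fun ζ => ?_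
  have h1 := Fsym_le_N hσ0 hw1 hout (mkY (xC ζ) (vC ζ))
  have h2 := Fsym_nonneg (σ := σ) hw1 (vC ζ)
  have h3 := Nsym_nonneg σ (mkY (xC ζ) (vC ζ))
  have h4 : Fsym σ w (mkY (xC ζ) (vC ζ)).snd = Fsym σ w (vC ζ) := rfl
  rw [h4] at h1
  refine ens2 (by norm_num) (by norm_num) ?_
  simp only [norm_mul, Complex.norm_real, Real.norm_eq_abs, abs_of_nonneg h2, abs_of_nonneg h3, mul_pow]
  have : Fsym σ w (vC ζ) ^ 2 ≤ 2 * Nsym σ (mkY (xC ζ) (vC ζ)) ^ 2 + 32 := by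
    nlinarith [sq_nonneg (Nsym σ (mkY (xC ζ) (vC ζ)) - 4)]
  have h6 := mul_le_mul_of_nonneg_right this (sq_nonneg ‖𝓕 (u : Z n → ℂ) ζ‖)
  linarith

end fraclap

section combine

/-- the time interval measure -/
def muT : Measure ℝ := volume.restrict (Set.Icc (-4) 4)

instance : SFinite muT := by unfold muT; infer_instance

theorem tri {X : Type*} [MeasurableSpace X] {ν : Measure X} [SFinite ν] {W : ℝ × X × X → ℝ≥0∞} (hW : Measurable W) :
    ∫⁻ x, W x ∂(muT.prod (ν.prod ν)) = ∫⁻ t, (∫⁻ ζ, ∫⁻ p, W (t, ζ, p) ∂ν ∂ν) ∂muT := by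
  rw [lintegral_prod _ hW.aemeasurable]
  congr 1; ext t
  exact lintegral_prod (fun y => W (t, y)) (hW.comp measurable_prodMk_left).aemeasurable

theorem tri' {X : Type*} [MeasurableSpace X] {ν : Measure X} [SFinite ν] {W : ℝ × X × X → ℝ≥0∞} (hW : Measurable W) :
    ∫⁻ x, W x ∂(muT.prod (ν.prod ν)) = ∫⁻ ζ, ∫⁻ p, (∫⁻ t, W (t, ζ, p) ∂muT) ∂ν ∂ν := by
  rw [lintegral_prod_symm _ hW.aemeasurable, lintegral_prod]
  exact hW.lintegral_prod_left'.aemeasurable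

theorem lint_of_int {f : ℝ → ℝ} (hf : Continuous f) (h0 : ∀ t, 0 ≤ f t) :
    ∫⁻ t, ENNReal.ofReal (f t) ∂muT = ENNReal.ofReal (∫ t in (-4 : ℝ)..4, f t) := by
  rw [intervalIntegral.integral_of_le (by norm_num), ← integral_Icc_eq_integral_Ioc, muT,
    ofReal_integral_eq_lintegral_ofReal]
  · exact hf.integrableOn_Icc
  · exact Filter.Eventually.of_forall h0

theorem STF_int {V : Type*} [NormedAddCommGroup V] [InnerProductSpace ℝ V] [FiniteDimensional ℝ V]
    [MeasurableSpace V] [BorelSpace V] (χ : SchwartzMap V ℂ) {q : V → ℂ} (hq : Continuous q) (B : ℝ)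
    (hB : ∀ y, ‖q y‖ ≤ B) (p ζ : V) :
    Integrable fun y => Real.fourierChar (-inner ℝ y ζ) • (χ (y - p) * q y) := by
  have hχp : Integrable (fun y => χ (y - p)) := χ.integrable.comp_sub_right p
  have cχ : Continuous fun y => χ (y - p) := χ.continuous.comp (by fun_prop)
  have ce : Continuous fun y : V => Real.fourierChar (-inner ℝ y ζ) :=
    Real.continuous_fourierChar.comp (by fun_prop)
  refine Integrable.mono' (hχp.norm.mul_const B) (ce.smul (cχ.mul hq)).aestronglyMeasurable
      (Filter.Eventually.of_forall fun y => ?_)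
  rw [Circle.norm_smul, norm_mul]
  gcongr
  exact hB _

theorem STF_lin {V : Type*} [NormedAddCommGroup V] [InnerProductSpace ℝ V] [FiniteDimensional ℝ V]
    [MeasurableSpace V] [BorelSpace V] (χ : SchwartzMap V ℂ) {q₁ q₂ q₃ : V → ℂ} (h1 : Continuous q₁)
    (h2 : Continuous q₂) (h3 : Continuous q₃) (B₁ B₂ B₃ : ℝ) (b1 : ∀ y, ‖q₁ y‖ ≤ B₁) (b2 : ∀ y, ‖q₂ y‖ ≤ B₂)
    (b3 : ∀ y, ‖q₃ y‖ ≤ B₃) (c : ℂ) (p ζ : V) :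
    STF χ (fun y => q₁ y + q₂ y - c * q₃ y) p ζ = STF χ q₁ p ζ + STF χ q₂ p ζ - c * STF χ q₃ p ζ := by
  have i1 := STF_int χ h1 B₁ b1 p ζ
  have i2 := STF_int χ h2 B₂ b2 p ζ
  have i3 := STF_int χ h3 B₃ b3 p ζ
  have i12 : Integrable fun y => Real.fourierChar (-inner ℝ y ζ) • (χ (y - p) * q₁ y) +
      Real.fourierChar (-inner ℝ y ζ) • (χ (y - p) * q₂ y) := i1.add i2
  have i3' : Integrable fun y => c * (Real.fourierChar (-inner ℝ y ζ) • (χ (y - p) * q₃ y)) := i3.const_mul c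
  simp only [STF, Real.fourier_eq]
  rw [← integral_add i1 i2, ← integral_const_mul, ← integral_sub i12 i3']
  congr 1; ext y
  simp only [Circle.smul_def, smul_eq_mul]
  ring

theorem STF_window_le' {V : Type*} [NormedAddCommGroup V] [InnerProductSpace ℝ V] [FiniteDimensional ℝ V]
    [MeasurableSpace V] [BorelSpace V] (χ : SchwartzMap V ℂ) {F : V → ℂ} (hF : Continuous F) (hF2 : MemLp F 2)
    {k : V → V → ℂ} (hk : Continuous (Function.uncurry k)) (κ : ℝ) (hκ0 : 0 ≤ κ)
    (hκ : ∀ p y, χ (y - p) ≠ 0 → ‖k p y‖ ≤ κ) (B : ℝ) (hB : ∀ p y, ‖k p y * F y‖ ≤ B) :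
    ∫⁻ ζ, ∫⁻ p, ‖STF χ (fun y => k p y * F y) p ζ‖ₑ ^ 2 ≤
      ENNReal.ofReal (κ ^ 2) * winc χ * ∫⁻ y, ‖F y‖ₑ ^ 2 := by
  rw [lintegral_lintegral_swap]
  · exact STF_window_le χ hF hF2 hk κ hκ0 hκ
  · have : Continuous fun x : V × V => STF χ (fun y => k x.2 y * F y) x.2 x.1 := by
      refine STF_continuous χ (q := fun x : V × V => fun y => k x.2 y * F y) continuous_snd continuous_fst ?_ B
        (fun x y => hB x.2 y)
      have h1 : Continuous fun z : (V × V) × V => k z.1.2 z.2 :=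
        hk.comp (f := fun z : (V × V) × V => (z.1.2, z.2)) (by fun_prop)
      exact h1.mul (hF.comp continuous_snd)
    exact (this.measurable.enorm.pow_const 2).aemeasurable

variable {σ : ℝ} {w : E n → ℝ}

theorem Nsym_shT_cont (hσ0 : 0 < σ) : Continuous fun x : ℝ × Y n => (Nsym σ (shT x.1 x.2) : ℂ) :=
  Complex.continuous_ofReal.comp ((continuous_Nsym hσ0).comp continuous_shT)

theorem GG_cont (χ : SchwartzMap (Y n) ℂ) {F : Z n → ℂ} (hF : Continuous F) (B : ℝ) (hB : ∀ z, ‖F z‖ ≤ B) :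
    Continuous fun x : ℝ × Y n × Y n => STF χ (fun y => F (jt x.1 y)) x.2.2 x.2.1 := by
  refine STF_continuous χ (q := fun (x : ℝ × Y n × Y n) y => F (jt x.1 y)) (by fun_prop) (by fun_prop) ?_ B
    (fun x y => hB _)
  exact hF.comp (continuous_jt.comp (f := fun z : (ℝ × Y n × Y n) × Y n => (z.1.1, z.2)) (by fun_prop))

/-- the weighted mass at time `t` -/
def At (σ : ℝ) (u : SchwartzMap (Z n) ℂ) (t : ℝ) : ℝ≥0∞ :=
  ∫⁻ ζ, ‖(Nsym σ (shT t ζ) : ℂ) * Gh u t ζ‖ₑ ^ 2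
/-- the mass at time `t` -/
def Bt (u : SchwartzMap (Z n) ℂ) (t : ℝ) : ℝ≥0∞ := ∫⁻ ζ, ‖Gh u t ζ‖ₑ ^ 2

theorem At_meas (hσ0 : 0 < σ) (u : SchwartzMap (Z n) ℂ) : Measurable (At σ u) := by
  have : Measurable fun x : ℝ × Y n => ‖(Nsym σ (shT x.1 x.2) : ℂ) * Gh u x.1 x.2‖ₑ ^ 2 :=
    ((Nsym_shT_cont hσ0).mul (Gh_continuous u)).measurable.enorm.pow_const 2
  exact this.lintegral_prod_right'

theorem Bt_meas (u : SchwartzMap (Z n) ℂ) : Measurable (Bt u) := by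
  have : Measurable fun x : ℝ × Y n => ‖Gh u x.1 x.2‖ₑ ^ 2 :=
    (Gh_continuous u).measurable.enorm.pow_const 2
  exact this.lintegral_prod_right'

theorem At_total (hσ0 : 0 < σ) (u : SchwartzMap (Z n) ℂ) :
    ∫⁻ t, At σ u t = ∫⁻ ζ, ‖(Nsym σ (mkY (xC ζ) (vC ζ)) : ℂ) * 𝓕 (u : Z n → ℂ) ζ‖ₑ ^ 2 := by
  have := lintegral_Gh u (ω := fun α => ‖(Nsym σ α : ℂ)‖ₑ ^ 2)
    ((Complex.continuous_ofReal.comp (continuous_Nsym hσ0)).measurable.enorm.pow_const 2)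
  simp only [At, enorm_mul, mul_pow]
  exact this

theorem Bt_total (u : SchwartzMap (Z n) ℂ) : ∫⁻ t, Bt u t = ∫⁻ z, ‖u z‖ₑ ^ 2 := by
  have := lintegral_Gh u (ω := fun α => 1) measurable_const
  simp only [one_mul] at this
  simp only [Bt]
  rw [this, planch u.integrable (u.memLp 2)]

theorem u_jt_zero {u : SchwartzMap (Z n) ℂ} (hu : ∀ z, u z ≠ 0 → tC z ∈ Set.Icc (-3 : ℝ) 3) {t : ℝ}
    (ht : t ∉ Set.Icc (-3 : ℝ) 3) (y : Y n) : u (jt t y) = 0 := by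
  by_contra h
  exact ht (hu _ h)

theorem At_mu (u : SchwartzMap (Z n) ℂ) (hu : ∀ z, u z ≠ 0 → tC z ∈ Set.Icc (-3 : ℝ) 3) :
    ∫⁻ t, At σ u t ∂muT = ∫⁻ t, At σ u t := by
  rw [muT, ← lintegral_indicator measurableSet_Icc]
  congr 1; ext t
  by_cases ht : t ∈ Set.Icc (-4 : ℝ) 4
  · rw [Set.indicator_of_mem ht]
  · rw [Set.indicator_of_notMem ht]
    have h0 : Gh u t = 0 := by
      have : (fun y => u (jt t y)) = 0 := by
        ext y
        exact u_jt_zero hu (fun h => ht ⟨by linarith [h.1], by linarith [h.2]⟩) y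
      ext ζ
      rw [Gh, this, Real.fourier_eq]
      simp
    simp [At, h0]

theorem dbl_le {X : Type*} [MeasurableSpace X] {ν : Measure X} [SFinite ν] {f g k : X → X → ℂ}
    (hf : Measurable fun x : X × X => f x.1 x.2) (c d : ℝ) (hc : 0 ≤ c) (hd : 0 ≤ d)
    (h : ∀ x y, ‖k x y‖ ^ 2 ≤ c * ‖f x y‖ ^ 2 + d * ‖g x y‖ ^ 2) :
    ∫⁻ x, ∫⁻ y, ‖k x y‖ₑ ^ 2 ∂ν ∂ν ≤ ENNReal.ofReal c * (∫⁻ x, ∫⁻ y, ‖f x y‖ₑ ^ 2 ∂ν ∂ν) +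
      ENNReal.ofReal d * (∫⁻ x, ∫⁻ y, ‖g x y‖ₑ ^ 2 ∂ν ∂ν) := by
  have mS : Measurable fun x : X × X => ‖f x.1 x.2‖ₑ ^ 2 := hf.enorm.pow_const 2
  rw [← lintegral_const_mul _ mS.lintegral_prod_right', ← lintegral_const_mul' _ _ ENNReal.ofReal_ne_top,
    ← lintegral_add_left (mS.lintegral_prod_right'.const_mul _)]
  refine lintegral_mono fun x => ?_
  have mSζ : Measurable fun y => ‖f x y‖ₑ ^ 2 := mS.comp measurable_prodMk_left
  simp only
  rw [← lintegral_const_mul _ mSζ, ← lintegral_const_mul' _ _ ENNReal.ofReal_ne_top,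
    ← lintegral_add_left (mSζ.const_mul _)]
  exact lintegral_mono fun y => ens2 hc hd (h x y)

theorem tri_norm (x y : ℂ) : ‖y‖ ^ 2 ≤ 2 * ‖x‖ ^ 2 + 2 * ‖x - y‖ ^ 2 := by
  have : ‖y‖ ≤ ‖x‖ + ‖x - y‖ := by
    have := norm_sub_le x (x - y)
    rwa [sub_sub_cancel] at this
  nlinarith [norm_nonneg x, norm_nonneg (x - y), norm_nonneg y, sq_nonneg (‖x‖ - ‖x - y‖)]

theorem low_t (hσ0 : 0 < σ) (hσ1 : σ < 1) (χ : SchwartzMap (Y n) ℂ) (u : SchwartzMap (Z n) ℂ) (t ε C : ℝ)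
    (hε : 0 ≤ ε) (hC : 0 ≤ C)
    (hd : ∀ ζ ζ' : Y n, |Nsym σ (shT t ζ) - Nsym σ (shT t ζ')| ≤ ε * Nsym σ (shT t ζ') + C * (1 + ‖ζ - ζ'‖ ^ 2)) :
    winc χ * At σ u t ≤
      ENNReal.ofReal 2 * (∫⁻ ζ, ∫⁻ p, ‖(Nsym σ (shT t ζ) : ℂ) * STF χ (fun y => u (jt t y)) p ζ‖ₑ ^ 2) +
      ENNReal.ofReal 2 * (ENNReal.ofReal (2 * ε ^ 2) * winc χ * At σ u t +
        ENNReal.ofReal (2 * C ^ 2) * winK χ * Bt u t) := by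
  have cN : Continuous fun ζ : Y n => Nsym σ (shT t ζ) := (continuous_Nsym hσ0).comp (continuous_shT' t)
  have cG : Continuous (Gh u t) := Continuous.comp (g := fun x : ℝ × Y n => Gh u x.1 x.2)
    (f := fun ζ => (t, ζ)) (Gh_continuous u) (by fun_prop)
  have m := slice_mul u (Complex.continuous_ofReal.comp (continuous_Nsym hσ0)) 2 2 (Nsym_norm_le hσ0 hσ1) t
  have m1 := slice_Gh u t
  have h1 := STF_comm_le χ cG m1.1 m1.2 _ (fun ζ => Nsym σ (shT t ζ)) cN m.1 m.2 ε C hε hC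
    (fun ζ => Nsym_nonneg _ _) hd
  have h2 := STF_total χ ((Complex.continuous_ofReal.comp cN).mul cG) m.1 m.2
  have e : winc χ * At σ u t = ∫⁻ ζ, ∫⁻ p, ‖STF χ (𝓕⁻ (fun ζ => (Nsym σ (shT t ζ) : ℂ) * Gh u t ζ)) p ζ‖ₑ ^ 2 := h2.symm
  have e3 : (fun y => u (jt t y)) = 𝓕⁻ (Gh u t) := Gh_inv u t
  obtain ⟨B, hB0, hB⟩ := sz_bdd u
  have cS : Continuous fun x : Y n × Y n => (Nsym σ (shT t x.1) : ℂ) * STF χ (fun y => u (jt t y)) x.2 x.1 := by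
    refine Continuous.mul ?_ ?_
    · exact (Complex.continuous_ofReal.comp cN).comp continuous_fst
    · exact Continuous.comp (g := fun x : ℝ × Y n × Y n => STF χ (fun y => u (jt x.1 y)) x.2.2 x.2.1)
        (f := fun ζ : Y n × Y n => (t, ζ)) (GG_cont χ u.continuous B hB) (by fun_prop)
  have h5 := dbl_le (ν := (volume : Measure (Y n)))
    (f := fun ζ p => (Nsym σ (shT t ζ) : ℂ) * STF χ (fun y => u (jt t y)) p ζ)
    (k := fun ζ p => STF χ (𝓕⁻ (fun ζ => (Nsym σ (shT t ζ) : ℂ) * Gh u t ζ)) p ζ)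
    (g := fun ζ p => (Nsym σ (shT t ζ) : ℂ) * STF χ (𝓕⁻ (Gh u t)) p ζ -
      STF χ (𝓕⁻ (fun ζ => (Nsym σ (shT t ζ) : ℂ) * Gh u t ζ)) p ζ) cS.measurable 2 2 (by norm_num) (by norm_num) ?_
  · rw [e]
    refine h5.trans ?_
    gcongr
    exact h1
  · intro ζ p
    rw [e3]
    exact tri_norm _ _

end combine

section mainest
variable {σ : ℝ} {w : E n → ℝ}

/-- windowed transform along the flow -/
def GG (χ : SchwartzMap (Y n) ℂ) (F : Z n → ℂ) (t : ℝ) (ζ p : Y n) : ℂ := STF χ (fun y => F (jt t y)) p ζ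

theorem GG_cont' (χ : SchwartzMap (Y n) ℂ) {F : Z n → ℂ} (hF : Continuous F) (B : ℝ) (hB : ∀ z, ‖F z‖ ≤ B) :
    Continuous fun x : ℝ × Y n × Y n => GG χ F x.1 x.2.1 x.2.2 := GG_cont χ hF B hB

theorem GG_cont_sz (χ : SchwartzMap (Y n) ℂ) (u : SchwartzMap (Z n) ℂ) :
    Continuous fun x : ℝ × Y n × Y n => GG χ u x.1 x.2.1 x.2.2 := by
  obtain ⟨B, hB0, hB⟩ := sz_bdd u
  exact GG_cont χ u.continuous B hB

/-- the frozen forcing term -/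
def HH (χ : SchwartzMap (Y n) ℂ) (σ : ℝ) (w : E n → ℝ) (a : Z n → ℝ) (u Lu : SchwartzMap (Z n) ℂ) (t : ℝ) (ζ p : Y n) : ℂ :=
  GG χ Lu t ζ p + ((a (jt t p) * Fsym σ w (shT t ζ).snd : ℝ) : ℂ) * GG χ u t ζ p

theorem HH_cont (hσ0 : 0 < σ) (hw : Continuous w) (χ : SchwartzMap (Y n) ℂ) {a : Z n → ℝ} (hac : Continuous a)
    (u Lu : SchwartzMap (Z n) ℂ) : Continuous fun x : ℝ × Y n × Y n => HH χ σ w a u Lu x.1 x.2.1 x.2.2 := by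
  unfold HH
  refine (GG_cont_sz χ Lu).add (Continuous.mul (Complex.continuous_ofReal.comp (Continuous.mul ?_ ?_)) (GG_cont_sz χ u))
  · exact hac.comp (continuous_jt.comp (f := fun x : ℝ × Y n × Y n => (x.1, x.2.2)) (by fun_prop))
  · refine (continuous_Fsym hσ0 hw).comp ?_
    have h1 : Continuous fun x : ℝ × Y n × Y n => shT x.1 x.2.1 :=
      continuous_shT.comp (f := fun x : ℝ × Y n × Y n => (x.1, x.2.1)) (by fun_prop)
    exact (WithLp.prod_continuous_ofLp 2 _ _).comp h1 |>.snd

theorem NG_cont (hσ0 : 0 < σ) (χ : SchwartzMap (Y n) ℂ) (u : SchwartzMap (Z n) ℂ) :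
    Continuous fun x : ℝ × Y n × Y n => (Nsym σ (shT x.1 x.2.1) : ℂ) * GG χ u x.1 x.2.1 x.2.2 := by
  refine Continuous.mul ?_ (GG_cont_sz χ u)
  exact (Nsym_shT_cont hσ0).comp (f := fun x : ℝ × Y n × Y n => (x.1, x.2.1)) (by fun_prop)

theorem slice_t {X Y' : Type*} [TopologicalSpace X] [TopologicalSpace Y'] {f : ℝ → X → X → Y'}
    (hf : Continuous fun x : ℝ × X × X => f x.1 x.2.1 x.2.2) (ζ p : X) : Continuous fun t => f t ζ p :=
  hf.comp (f := fun t : ℝ => (t, ζ, p)) (by fun_prop)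

theorem slice_x {X Y' : Type*} [TopologicalSpace X] [TopologicalSpace Y'] {f : ℝ → X → X → Y'}
    (hf : Continuous fun x : ℝ × X × X => f x.1 x.2.1 x.2.2) (t : ℝ) : Continuous fun x : X × X => f t x.1 x.2 :=
  hf.comp (f := fun x : X × X => (t, x.1, x.2)) (by fun_prop)

theorem GG_zero (χ : SchwartzMap (Y n) ℂ) {u : SchwartzMap (Z n) ℂ}
    (hu : ∀ z, u z ≠ 0 → tC z ∈ Set.Icc (-3 : ℝ) 3) {t : ℝ}
    (ht : t ∉ Set.Icc (-3 : ℝ) 3) (ζ p : Y n) : GG χ u t ζ p = 0 := by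
  have : (fun y => u (jt t y)) = fun _ => 0 := by
    ext y; exact u_jt_zero hu ht y
  rw [GG, this, STF, Real.fourier_eq]
  simp

theorem ode_int (hσ0 : 0 < σ) (hσ1 : σ < 1) (hw : Continuous w)
    (hw1 : ∀ η, 0 ≤ w η ∧ w η ≤ 1) {a₀ M : ℝ} (ha₀ : 0 < a₀) (haM : a₀ ≤ M) :
    ∃ C0 : ℝ, 0 ≤ C0 ∧ ∀ (a : Z n → ℝ) (_ : Continuous a) (_ : ∀ z, a₀ ≤ a z) (_ : ∀ z, a z ≤ M)
      (χ : SchwartzMap (Y n) ℂ) (u Lu : SchwartzMap (Z n) ℂ)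
      (_ : ∀ z, u z ≠ 0 → tC z ∈ Set.Icc (-3 : ℝ) 3)
      (_ : ∀ z, Lu z = fderiv ℝ u z eT + ∑ i : Fin n, (vC z i : ℂ) * fderiv ℝ u z (eX i)),
      ∫⁻ t, (∫⁻ ζ, ∫⁻ p, ‖(Nsym σ (shT t ζ) : ℂ) * GG χ u t ζ p‖ₑ ^ 2) ∂muT ≤
        ENNReal.ofReal C0 * ∫⁻ t, ((∫⁻ ζ, ∫⁻ p, ‖HH χ σ w a u Lu t ζ p‖ₑ ^ 2) + ∫⁻ ζ, ∫⁻ p, ‖GG χ u t ζ p‖ₑ ^ 2) ∂muT := by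
  obtain ⟨C0, hC0, hode⟩ := ode_main (n := n) hσ0 hσ1 hw hw1 ha₀ haM
  refine ⟨C0, hC0, fun a hac hal haM' χ u Lu hu hL => ?_⟩
  have cN := NG_cont hσ0 χ u
  have cH := HH_cont hσ0 hw χ hac u Lu
  have cG := GG_cont_sz χ u
  have cG' := GG_cont_sz χ Lu
  have mN := cN.measurable.enorm.pow_const 2
  have mH := cH.measurable.enorm.pow_const 2
  have mG := cG.measurable.enorm.pow_const 2
  have e1 := (tri (ν := (volume : Measure (Y n))) mN).symm.trans (tri' mN)
  have e2 := (tri (ν := (volume : Measure (Y n))) mH)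
  have e3 := (tri (ν := (volume : Measure (Y n))) mG)
  simp only at e1 e2 e3
  have mH' : Measurable fun t => ∫⁻ ζ, ∫⁻ p, ‖HH χ σ w a u Lu t ζ p‖ₑ ^ 2 := by
    have h1 : Measurable fun x : (ℝ × Y n) × Y n => ‖HH χ σ w a u Lu x.1.1 x.1.2 x.2‖ₑ ^ 2 :=
      mH.comp (g := fun x : ℝ × Y n × Y n => _) (f := fun x : (ℝ × Y n) × Y n => (x.1.1, x.1.2, x.2)) (by fun_prop)
    exact h1.lintegral_prod_right'.lintegral_prod_right'
  have mHG : Measurable fun x : ℝ × Y n × Y n => ‖HH χ σ w a u Lu x.1 x.2.1 x.2.2‖ₑ ^ 2 +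
      ‖GG χ u x.1 x.2.1 x.2.2‖ₑ ^ 2 := mH.add mG
  rw [lintegral_add_left mH', ← e2, ← e3, ← lintegral_add_left mH, e1,
    ← lintegral_const_mul _ mHG, tri' (mHG.const_mul _)]
  refine lintegral_mono fun ζ => lintegral_mono fun p => ?_
  simp only
  have key := hode ζ.fst ζ.snd (fun t => GG χ u t ζ p) (fun t => GG χ Lu t ζ p) (fun t => HH χ σ w a u Lu t ζ p)
    (fun t => a (jt t p)) (fun t => hasDerivAt_STF χ u Lu hL p ζ t) (slice_t cG' ζ p)
    (hac.comp (continuous_jt.comp (f := fun x : ℝ => (x, p)) (by fun_prop))) (fun t => rfl)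
    (GG_zero χ hu (by norm_num) ζ p) (GG_zero χ hu (by norm_num) ζ p) (fun t => hal _) (fun t => haM' _)
  have cN1 : Continuous fun t => (Nsym σ (shT t ζ) : ℂ) * GG χ u t ζ p :=
    slice_t (f := fun t ζ p => (Nsym σ (shT t ζ) : ℂ) * GG χ u t ζ p) cN ζ p
  have cH1 : Continuous fun t => HH χ σ w a u Lu t ζ p := slice_t cH ζ p
  have cG1 : Continuous fun t => GG χ u t ζ p := slice_t cG ζ p
  have q1 := lint_of_int (f := fun t => ‖(Nsym σ (shT t ζ) : ℂ) * GG χ u t ζ p‖ ^ 2) (by fun_prop)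
    (fun t => by positivity)
  have q2 := lint_of_int (f := fun t => C0 * (‖HH χ σ w a u Lu t ζ p‖ ^ 2 + ‖GG χ u t ζ p‖ ^ 2))
    (by fun_prop)
    (fun t => by positivity)
  have r1 : ∀ t, ‖(Nsym σ (shT t ζ) : ℂ) * GG χ u t ζ p‖ₑ ^ 2 =
      ENNReal.ofReal (‖(Nsym σ (shT t ζ) : ℂ) * GG χ u t ζ p‖ ^ 2) := fun t => enorm_sq_eq _
  have r2 : ∀ t, ENNReal.ofReal C0 * (‖HH χ σ w a u Lu t ζ p‖ₑ ^ 2 + ‖GG χ u t ζ p‖ₑ ^ 2) =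
      ENNReal.ofReal (C0 * (‖HH χ σ w a u Lu t ζ p‖ ^ 2 + ‖GG χ u t ζ p‖ ^ 2)) := fun t => by
    rw [enorm_sq_eq, enorm_sq_eq, ← ENNReal.ofReal_add (by positivity) (by positivity), ← ENNReal.ofReal_mul hC0]
  simp only [r1, r2]
  rw [q1, q2]
  refine ENNReal.ofReal_le_ofReal (le_trans (le_of_eq ?_) key)
  congr 1; ext t
  rw [norm_mul, mul_pow, Complex.norm_real, Real.norm_of_nonneg (Nsym_nonneg _ _)]
  rfl

theorem jt_lip {t : ℝ} (ht : |t| ≤ 4) (p y : Y n) : ‖jt t p - jt t y‖ ≤ 6 * ‖y - p‖ := by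
  have e : jt t p - jt t y = mkZ 0 ((p.fst - y.fst) + t • (p.snd - y.snd)) (p.snd - y.snd) := by
    rw [sub_eq_iff_eq_add, jt, jt, ← mkZ_add]
    congr 1
    · simp
    · module
    · module
  have h1 : ‖p.fst - y.fst‖ ≤ ‖y - p‖ := by
    rw [norm_sub_rev]; exact Yfst_le (y - p)
  have h2 : ‖p.snd - y.snd‖ ≤ ‖y - p‖ := by
    rw [norm_sub_rev]; exact Ysnd_le (y - p)
  have h3 : ‖(p.fst - y.fst) + t • (p.snd - y.snd)‖ ≤ 5 * ‖y - p‖ := by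
    refine (norm_add_le _ _).trans ?_
    rw [norm_smul, Real.norm_eq_abs]
    nlinarith [norm_nonneg (p.snd - y.snd), abs_nonneg t]
  refine abs_le_of_sq_le_sq' ?_ (by positivity) |>.2
  rw [e, mkZ_norm_sq]
  nlinarith [norm_nonneg (p.snd - y.snd), norm_nonneg ((p.fst - y.fst) + t • (p.snd - y.snd)), norm_nonneg (y - p)]

theorem H_split (hσ0 : 0 < σ) (hσ1 : σ < 1) (hw : Continuous w)
    (hw1 : ∀ η, 0 ≤ w η ∧ w η ≤ 1) (hout : ∀ η : E n, 2 ≤ ‖η‖ → w η = 1)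
    {a : Z n → ℝ} (hac : Continuous a) {M : ℝ} (haM : ∀ z, |a z| ≤ M) (χ : SchwartzMap (Y n) ℂ)
    (u Lu : SchwartzMap (Z n) ℂ) (t : ℝ) (ζ p : Y n) :
    HH χ σ w a u Lu t ζ p = GG χ (fun z => Lu z + (a z : ℂ) * fracLap σ w u z) t ζ p +
      STF χ (fun y => ((a (jt t p) - a (jt t y) : ℝ) : ℂ) * fracLap σ w u (jt t y)) p ζ +
      (a (jt t p) : ℂ) * ((Fsym σ w (shT t ζ).snd : ℂ) * GG χ u t ζ p - GG χ (fracLap σ w u) t ζ p) := by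
  obtain ⟨B, hB0, hB⟩ := sz_bdd Lu
  obtain ⟨B', hB0', hB'⟩ := fl_bdd (σ := σ) (w := w) u
  have ch := fl_cont hσ0 hσ1 hw hw1 hout u
  have cj : Continuous fun y : Y n => jt t y := continuous_jt.comp (f := fun y : Y n => (t, y)) (by fun_prop)
  have cf : Continuous fun z => Lu z + (a z : ℂ) * fracLap σ w u z :=
    Lu.continuous.add ((Complex.continuous_ofReal.comp hac).mul ch)
  have hM0 : 0 ≤ M := (abs_nonneg _).trans (haM 0)
  have := STF_lin χ (q₁ := fun y => Lu (jt t y) + (a (jt t y) : ℂ) * fracLap σ w u (jt t y))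
    (q₂ := fun y => ((a (jt t p) - a (jt t y) : ℝ) : ℂ) * fracLap σ w u (jt t y))
    (q₃ := fun y => fracLap σ w u (jt t y)) (cf.comp cj)
    ((Complex.continuous_ofReal.comp (continuous_const.sub (hac.comp cj))).mul (ch.comp cj)) (ch.comp cj)
    (B + M * B') ((M + M) * B') B'
    (fun y => (norm_add_le _ _).trans (add_le_add (hB _) (by
      rw [norm_mul, Complex.norm_real]
      exact mul_le_mul (haM _) (hB' _) (norm_nonneg _) hM0)))
    (fun y => by
      rw [norm_mul, Complex.norm_real]
      exact mul_le_mul ((abs_sub _ _).trans (add_le_add (haM _) (haM _))) (hB' _) (norm_nonneg _) (by positivity))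
    (fun y => hB' _) (a (jt t p) : ℂ) p ζ
  have e : (fun y => Lu (jt t y) + (a (jt t y) : ℂ) * fracLap σ w u (jt t y) +
      ((a (jt t p) - a (jt t y) : ℝ) : ℂ) * fracLap σ w u (jt t y) - (a (jt t p) : ℂ) * fracLap σ w u (jt t y)) =
      fun y => Lu (jt t y) := by
    ext y; push_cast; ring
  rw [e] at this
  simp only [HH, GG]
  rw [this]
  push_cast
  ring

theorem H_t (hσ0 : 0 < σ) (hσ1 : σ < 1) (hw : Continuous w)
    (hw1 : ∀ η, 0 ≤ w η ∧ w η ≤ 1) (hout : ∀ η : E n, 2 ≤ ‖η‖ → w η = 1)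
    {a : Z n → ℝ} (hac : Continuous a) {M : ℝ} (haM : ∀ z, |a z| ≤ M) (χ : SchwartzMap (Y n) ℂ)
    (u Lu : SchwartzMap (Z n) ℂ) (t κ ε C : ℝ) (hκ0 : 0 ≤ κ)
    (hκ : ∀ p y, χ (y - p) ≠ 0 → |a (jt t p) - a (jt t y)| ≤ κ) (hε : 0 ≤ ε) (hC : 0 ≤ C)
    (hd : ∀ ζ ζ' : Y n, |Fsym σ w (shT t ζ).snd - Fsym σ w (shT t ζ').snd| ≤
        ε * Nsym σ (shT t ζ') + C * (1 + ‖ζ - ζ'‖ ^ 2)) :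
    ∫⁻ ζ, ∫⁻ p, ‖HH χ σ w a u Lu t ζ p‖ₑ ^ 2 ≤
      ENNReal.ofReal 2 * (winc χ * ∫⁻ y, ‖Lu (jt t y) + (a (jt t y) : ℂ) * fracLap σ w u (jt t y)‖ₑ ^ 2) +
      ENNReal.ofReal 2 * (ENNReal.ofReal (2 * M ^ 2) * (ENNReal.ofReal (2 * ε ^ 2) * winc χ * At σ u t +
          ENNReal.ofReal (2 * C ^ 2) * winK χ * Bt u t) +
        ENNReal.ofReal 2 * (ENNReal.ofReal (κ ^ 2) * winc χ * ∫⁻ y, ‖fracLap σ w u (jt t y)‖ₑ ^ 2)) := by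
  obtain ⟨B, hB0, hB⟩ := sz_bdd Lu
  obtain ⟨B', hB0', hB'⟩ := fl_bdd (σ := σ) (w := w) u
  have hM0 : 0 ≤ M := (abs_nonneg _).trans (haM 0)
  have ch := fl_cont hσ0 hσ1 hw hw1 hout u
  have cj : Continuous fun y : Y n => jt t y := continuous_jt.comp (f := fun y : Y n => (t, y)) (by fun_prop)
  have cf : Continuous fun z => Lu z + (a z : ℂ) * fracLap σ w u z :=
    Lu.continuous.add ((Complex.continuous_ofReal.comp hac).mul ch)
  have bf : ∀ z, ‖Lu z + (a z : ℂ) * fracLap σ w u z‖ ≤ B + M * B' := fun y =>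
    (norm_add_le _ _).trans (add_le_add (hB _) (by
      rw [norm_mul, Complex.norm_real]
      exact mul_le_mul (haM _) (hB' _) (norm_nonneg _) hM0))
  have mh := fl_slice_memLp hσ0 hσ1 hw hw1 hout u t
  have mf : MemLp (fun y => Lu (jt t y) + (a (jt t y) : ℂ) * fracLap σ w u (jt t y)) 2 := by
    refine (sz_slice_memLp Lu t).add (MemLp.of_le_mul (c := M) mh
      ((Complex.continuous_ofReal.comp (hac.comp cj)).mul (ch.comp cj)).aestronglyMeasurable
      (Filter.Eventually.of_forall fun y => ?_))
    rw [norm_mul, Complex.norm_real]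
    exact mul_le_mul_of_nonneg_right (haM _) (norm_nonneg _)
  have w1 := STF_window_le' χ (cf.comp cj) mf (k := fun _ _ => 1) continuous_const 1 (by norm_num)
    (fun _ _ _ => by simp) (B + M * B') (fun p y => by rw [one_mul]; exact bf _)
  have w2 := STF_window_le' χ (ch.comp cj) mh (k := fun p y => ((a (jt t p) - a (jt t y) : ℝ) : ℂ))
    (Complex.continuous_ofReal.comp (((hac.comp cj).comp continuous_fst).sub ((hac.comp cj).comp continuous_snd)))
    κ hκ0 (fun p y h => by rw [Complex.norm_real]; exact hκ p y h) ((M + M) * B') (fun p y => by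
      rw [norm_mul, Complex.norm_real]
      exact mul_le_mul ((abs_sub _ _).trans (add_le_add (haM _) (haM _))) (hB' _) (norm_nonneg _) (by positivity))
  have cGh : Continuous (Gh u t) := Continuous.comp (g := fun x : ℝ × Y n => Gh u x.1 x.2)
    (f := fun ζ => (t, ζ)) (Gh_continuous u) (by fun_prop)
  have cN : Continuous fun ζ : Y n => Nsym σ (shT t ζ) := (continuous_Nsym hσ0).comp (continuous_shT' t)
  have m := slice_mul u (continuous_FsymC hσ0 hw) 6 2 (Fsym_norm_le hσ0 hσ1 hw1 hout) t
  have m1 := slice_Gh u t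
  have h1 := STF_comm_le χ cGh m1.1 m1.2 (fun ζ => Fsym σ w (shT t ζ).snd) (fun ζ => Nsym σ (shT t ζ)) cN m.1 m.2
    ε C hε hC (fun ζ => Nsym_nonneg _ _) hd
  rw [← Gh_inv u t, ← fl_jt hσ0 hσ1 hw hw1 hout u t] at h1
  have c3 : Continuous fun x : Y n × Y n => (Fsym σ w (shT t x.1).snd : ℂ) * GG χ u t x.1 x.2 -
      GG χ (fracLap σ w u) t x.1 x.2 := by
    refine Continuous.sub (Continuous.mul ?_ (slice_x (GG_cont_sz χ u) t)) (slice_x (GG_cont' χ ch B' hB') t)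
    exact ((continuous_FsymC hσ0 hw).comp (continuous_shT' t)).comp continuous_fst
  have d2 := dbl_le (ν := (volume : Measure (Y n)))
    (f := fun ζ p => (Fsym σ w (shT t ζ).snd : ℂ) * GG χ u t ζ p - GG χ (fracLap σ w u) t ζ p)
    (g := fun ζ p => STF χ (fun y => ((a (jt t p) - a (jt t y) : ℝ) : ℂ) * fracLap σ w u (jt t y)) p ζ)
    (k := fun ζ p => STF χ (fun y => ((a (jt t p) - a (jt t y) : ℝ) : ℂ) * fracLap σ w u (jt t y)) p ζ +
      (a (jt t p) : ℂ) * ((Fsym σ w (shT t ζ).snd : ℂ) * GG χ u t ζ p - GG χ (fracLap σ w u) t ζ p))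
    c3.measurable (2 * M ^ 2) 2 (by positivity) (by norm_num) (fun ζ p => by
      refine (sq_le_sq₀ (norm_nonneg _) (by positivity)).2 (norm_add_le _ _) |>.trans ?_
      rw [norm_mul, Complex.norm_real]
      generalize ‖(Fsym σ w (shT t ζ).snd : ℂ) * GG χ u t ζ p - GG χ (fracLap σ w u) t ζ p‖ = x
      generalize ‖STF χ (fun y => ((a (jt t p) - a (jt t y) : ℝ) : ℂ) * fracLap σ w u (jt t y)) p ζ‖ = y
      have h := haM (jt t p)
      rw [Real.norm_eq_abs]
      have h0 := abs_nonneg (a (jt t p))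
      have : |a (jt t p)| ^ 2 * x ^ 2 ≤ M ^ 2 * x ^ 2 := by gcongr
      nlinarith [sq_nonneg (y - |a (jt t p)| * x)])
  have d1 := dbl_le (ν := (volume : Measure (Y n)))
    (f := fun ζ p => GG χ (fun z => Lu z + (a z : ℂ) * fracLap σ w u z) t ζ p)
    (g := fun ζ p => STF χ (fun y => ((a (jt t p) - a (jt t y) : ℝ) : ℂ) * fracLap σ w u (jt t y)) p ζ +
      (a (jt t p) : ℂ) * ((Fsym σ w (shT t ζ).snd : ℂ) * GG χ u t ζ p - GG χ (fracLap σ w u) t ζ p))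
    (k := fun ζ p => HH χ σ w a u Lu t ζ p)
    (slice_x (GG_cont' χ cf _ bf) t).measurable 2 2 (by norm_num) (by norm_num) (fun ζ p => by
      rw [H_split hσ0 hσ1 hw hw1 hout hac haM χ u Lu t ζ p, add_assoc]
      refine (sq_le_sq₀ (norm_nonneg _) (by positivity)).2 (norm_add_le _ _) |>.trans ?_
      generalize ‖GG χ (fun z => Lu z + (a z : ℂ) * fracLap σ w u z) t ζ p‖ = x
      generalize ‖STF χ (fun y => ((a (jt t p) - a (jt t y) : ℝ) : ℂ) * fracLap σ w u (jt t y)) p ζ + _‖ = y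
      nlinarith [sq_nonneg (y - x)])
  refine d1.trans ?_
  have w1' : ∫⁻ ζ, ∫⁻ p, ‖GG χ (fun z => Lu z + (a z : ℂ) * fracLap σ w u z) t ζ p‖ₑ ^ 2 ≤
      winc χ * ∫⁻ y, ‖Lu (jt t y) + (a (jt t y) : ℂ) * fracLap σ w u (jt t y)‖ₑ ^ 2 := by
    simp only [one_mul, one_pow, ENNReal.ofReal_one] at w1
    exact w1
  refine add_le_add (mul_le_mul' le_rfl w1') (mul_le_mul' le_rfl (d2.trans ?_))
  exact add_le_add (mul_le_mul' le_rfl h1) (mul_le_mul' le_rfl w2)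

end mainest

section mainest2
variable {σ : ℝ} {w : E n → ℝ}

theorem lin4 {X : Type*} [MeasurableSpace X] {μ : Measure X} {f1 f2 f3 f4 : X → ℝ≥0∞} (h1 : Measurable f1)
    (h2 : Measurable f2) (h3 : Measurable f3) (h4 : Measurable f4) (c1 c2 c3 c4 : ℝ≥0∞) :
    ∫⁻ x, (c1 * f1 x + (c2 * f2 x + (c3 * f3 x + c4 * f4 x))) ∂μ =
      c1 * (∫⁻ x, f1 x ∂μ) + (c2 * (∫⁻ x, f2 x ∂μ) + (c3 * (∫⁻ x, f3 x ∂μ) + c4 * ∫⁻ x, f4 x ∂μ)) := by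
  rw [lintegral_add_left (h1.const_mul _), lintegral_add_left (h2.const_mul _), lintegral_add_left (h3.const_mul _),
    lintegral_const_mul _ h1, lintegral_const_mul _ h2, lintegral_const_mul _ h3, lintegral_const_mul _ h4]

theorem muT_le (f : ℝ → ℝ≥0∞) : ∫⁻ t, f t ∂muT ≤ ∫⁻ t, f t := setLIntegral_le_lintegral _ _

theorem muT_mono {f g : ℝ → ℝ≥0∞} (h : ∀ t, |t| ≤ 4 → f t ≤ g t) : ∫⁻ t, f t ∂muT ≤ ∫⁻ t, g t ∂muT :=
  lintegral_mono_ae ((ae_restrict_iff' measurableSet_Icc).2 (Filter.Eventually.of_forall fun t ht =>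
    h t (abs_le.2 ht)))

theorem flow_meas {F : Z n → ℂ} (hF : Continuous F) : Measurable fun t => ∫⁻ y, ‖F (jt t y)‖ₑ ^ 2 := by
  have : Measurable fun x : ℝ × Y n => ‖F (jt x.1 x.2)‖ₑ ^ 2 :=
    (hF.comp continuous_jt).measurable.enorm.pow_const 2
  exact this.lintegral_prod_right'

theorem flow_le {F : Z n → ℂ} (hF : Continuous F) :
    ∫⁻ t, (∫⁻ y, ‖F (jt t y)‖ₑ ^ 2) ∂muT ≤ ∫⁻ z, ‖F z‖ₑ ^ 2 :=
  (muT_le _).trans (lintegral_jt (f := fun z => ‖F z‖ₑ ^ 2) (hF.measurable.enorm.pow_const 2)).le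

theorem absorb {x R : ℝ≥0∞} (hx : x ≠ ⊤) (h : x ≤ ENNReal.ofReal (1 / 2) * x + R) : x ≤ ENNReal.ofReal 2 * R := by
  have e : x = ENNReal.ofReal (1 / 2) * x + ENNReal.ofReal (1 / 2) * x := by
    rw [← add_mul, ← ENNReal.ofReal_add (by norm_num) (by norm_num)]
    norm_num
  have hf : ENNReal.ofReal (1 / 2) * x ≠ ⊤ := ENNReal.mul_ne_top ENNReal.ofReal_ne_top hx
  have h2 : ENNReal.ofReal (1 / 2) * x ≤ R := by
    have : ENNReal.ofReal (1 / 2) * x + ENNReal.ofReal (1 / 2) * x ≤ ENNReal.ofReal (1 / 2) * x + R := by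
      rw [← e]; exact h
    exact (ENNReal.add_le_add_iff_left hf).1 this
  calc x = ENNReal.ofReal 2 * (ENNReal.ofReal (1 / 2) * x) := by
        rw [← mul_assoc, ← ENNReal.ofReal_mul (by norm_num)]; norm_num
    _ ≤ _ := mul_le_mul' le_rfl h2

theorem small_ex (K : ℝ) (hK : 0 ≤ K) : ∃ ε : ℝ, 0 < ε ∧ K * ε ^ 2 ≤ 1 / 4 := by
  refine ⟨1 / (2 * (1 + K)), by positivity, ?_⟩
  rw [div_pow, one_pow, mul_one_div, div_le_div_iff₀ (by positivity) (by norm_num)]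
  nlinarith

theorem two_le (p q F B : ℝ≥0∞) : p * F + q * B ≤ (p + q) * (F + B) := by
  calc p * F + q * B ≤ (p + q) * F + (p + q) * B :=
        add_le_add (mul_le_mul' le_self_add le_rfl) (mul_le_mul' le_add_self le_rfl)
    _ = _ := by ring

theorem alg_fin {c K A B F h X : ℝ≥0∞} {C0 M ε κ C1 C2 : ℝ} (hC0 : 0 ≤ C0) (hx : c * A ≠ ⊤)
    (hh : h ≤ ENNReal.ofReal 2 * A + ENNReal.ofReal 32 * B)
    (h1 : (16 * C0 * M ^ 2 + 4) * ε ^ 2 ≤ 1 / 4) (h2 : (16 * C0) * κ ^ 2 ≤ 1 / 4)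
    (hX : X ≤ ENNReal.ofReal C0 * (ENNReal.ofReal 2 * c * F + (ENNReal.ofReal 2 * ENNReal.ofReal (2 * M ^ 2) *
      ENNReal.ofReal (2 * ε ^ 2) * c * A + ((ENNReal.ofReal 2 * ENNReal.ofReal (2 * M ^ 2) *
      ENNReal.ofReal (2 * C2 ^ 2) * K + c) * B + ENNReal.ofReal 2 * ENNReal.ofReal 2 * ENNReal.ofReal (κ ^ 2) * c * h))))
    (hA : c * A ≤ ENNReal.ofReal 2 * X + ENNReal.ofReal 2 * (ENNReal.ofReal (2 * ε ^ 2) * c * A +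
      ENNReal.ofReal (2 * C1 ^ 2) * K * B)) :
    c * A ≤ ENNReal.ofReal 2 * ((ENNReal.ofReal 2 * ENNReal.ofReal C0 * ENNReal.ofReal 2 * c +
      (ENNReal.ofReal 2 * ENNReal.ofReal C0 * (ENNReal.ofReal 2 * ENNReal.ofReal (2 * M ^ 2) *
      ENNReal.ofReal (2 * C2 ^ 2) * K + c) + ENNReal.ofReal 2 * ENNReal.ofReal C0 * (ENNReal.ofReal 2 * ENNReal.ofReal 2 *
      ENNReal.ofReal (κ ^ 2) * c * ENNReal.ofReal 32) + ENNReal.ofReal 2 * (ENNReal.ofReal (2 * C1 ^ 2) * K))) * (F + B)) := by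
  refine absorb hx ?_
  have hcoef : ENNReal.ofReal 2 * ENNReal.ofReal C0 * (ENNReal.ofReal 2 * ENNReal.ofReal (2 * M ^ 2) *
      ENNReal.ofReal (2 * ε ^ 2)) + ENNReal.ofReal 2 * ENNReal.ofReal C0 * (ENNReal.ofReal 2 * ENNReal.ofReal 2 *
      ENNReal.ofReal (κ ^ 2) * ENNReal.ofReal 2) + ENNReal.ofReal 2 * ENNReal.ofReal (2 * ε ^ 2) ≤ ENNReal.ofReal (1 / 2) := by
    rw [← ENNReal.ofReal_mul (by positivity), ← ENNReal.ofReal_mul (by positivity), ← ENNReal.ofReal_mul (by positivity),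
      ← ENNReal.ofReal_mul (by positivity), ← ENNReal.ofReal_mul (by positivity), ← ENNReal.ofReal_mul (by positivity),
      ← ENNReal.ofReal_mul (by positivity), ← ENNReal.ofReal_mul (by positivity), ← ENNReal.ofReal_mul (by positivity),
      ← ENNReal.ofReal_add (by positivity) (by positivity), ← ENNReal.ofReal_add (by positivity) (by positivity)]
    apply ENNReal.ofReal_le_ofReal
    linarith
  calc c * A ≤ _ := hA
    _ ≤ ENNReal.ofReal 2 * (ENNReal.ofReal C0 * (ENNReal.ofReal 2 * c * F + (ENNReal.ofReal 2 * ENNReal.ofReal (2 * M ^ 2) *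
      ENNReal.ofReal (2 * ε ^ 2) * c * A + ((ENNReal.ofReal 2 * ENNReal.ofReal (2 * M ^ 2) *
      ENNReal.ofReal (2 * C2 ^ 2) * K + c) * B + ENNReal.ofReal 2 * ENNReal.ofReal 2 * ENNReal.ofReal (κ ^ 2) * c *
        (ENNReal.ofReal 2 * A + ENNReal.ofReal 32 * B))))) + ENNReal.ofReal 2 * (ENNReal.ofReal (2 * ε ^ 2) * c * A +
      ENNReal.ofReal (2 * C1 ^ 2) * K * B) := by
        refine add_le_add (mul_le_mul' le_rfl (hX.trans ?_)) le_rfl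
        gcongr
    _ = (ENNReal.ofReal 2 * ENNReal.ofReal C0 * (ENNReal.ofReal 2 * ENNReal.ofReal (2 * M ^ 2) *
      ENNReal.ofReal (2 * ε ^ 2)) + ENNReal.ofReal 2 * ENNReal.ofReal C0 * (ENNReal.ofReal 2 * ENNReal.ofReal 2 *
      ENNReal.ofReal (κ ^ 2) * ENNReal.ofReal 2) + ENNReal.ofReal 2 * ENNReal.ofReal (2 * ε ^ 2)) * (c * A) +
      (ENNReal.ofReal 2 * ENNReal.ofReal C0 * ENNReal.ofReal 2 * c * F + (ENNReal.ofReal 2 * ENNReal.ofReal C0 * (ENNReal.ofReal 2 * ENNReal.ofReal (2 * M ^ 2) *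
      ENNReal.ofReal (2 * C2 ^ 2) * K + c) + ENNReal.ofReal 2 * ENNReal.ofReal C0 * (ENNReal.ofReal 2 * ENNReal.ofReal 2 *
      ENNReal.ofReal (κ ^ 2) * c * ENNReal.ofReal 32) + ENNReal.ofReal 2 * (ENNReal.ofReal (2 * C1 ^ 2) * K)) * B) := by
        generalize ENNReal.ofReal 2 = o2
        generalize ENNReal.ofReal 32 = o3
        ring
    _ ≤ _ := by
      exact add_le_add (mul_le_mul' hcoef le_rfl) (two_le _ _ _ _)

theorem main_est (hσ0 : 0 < σ) (hσ1 : σ < 1) (hw : Continuous w)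
    (hw1 : ∀ η, 0 ≤ w η ∧ w η ≤ 1) (hout : ∀ η : E n, 2 ≤ ‖η‖ → w η = 1)
    {a : Z n → ℝ} (hac : Continuous a) {a₀ M L : ℝ} (ha₀ : 0 < a₀) (haLB : ∀ z, a₀ ≤ a z)
    (haM : ∀ z, |a z| ≤ M) (hL0 : 0 ≤ L) (haL : ∀ z z', |a z - a z'| ≤ L * ‖z - z'‖) :
    ∃ C : ℝ≥0∞, C ≠ ⊤ ∧ ∀ u : SchwartzMap (Z n) ℂ, (∀ z, u z ≠ 0 → tC z ∈ Set.Icc (-3 : ℝ) 3) →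
      ∫⁻ ζ, ‖(Nsym σ (mkY (xC ζ) (vC ζ)) : ℂ) * 𝓕 (u : Z n → ℂ) ζ‖ₑ ^ 2 ≤
        C * ((∫⁻ z, ‖Pop σ w a u z‖ₑ ^ 2) + ∫⁻ z, ‖u z‖ₑ ^ 2) := by
  have haM0 : a₀ ≤ M := (haLB 0).trans ((le_abs_self _).trans (haM 0))
  obtain ⟨C0, hC0, hode⟩ := ode_int (n := n) hσ0 hσ1 hw hw1 ha₀ haM0
  obtain ⟨ε, hε, hε1⟩ := small_ex (16 * C0 * M ^ 2 + 4) (by positivity)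
  obtain ⟨κ, hκ, hκ1⟩ := small_ex (16 * C0) (by positivity)
  obtain ⟨C1, hC1, hN⟩ := symb_N (n := n) hσ0 hσ1 hε
  obtain ⟨C2, hC2, hF⟩ := symb_F (n := n) hσ0 hσ1 hw1 hout hε
  obtain ⟨χ, hχ0, hχ⟩ := exists_window (n := n) (κ / (6 * (L + 1))) (by positivity)
  have hc := winc_lt_top χ
  have hK := winK_lt_top χ
  refine ⟨(winc χ)⁻¹ * (ENNReal.ofReal 2 * (ENNReal.ofReal 2 * ENNReal.ofReal C0 * ENNReal.ofReal 2 * winc χ +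
      (ENNReal.ofReal 2 * ENNReal.ofReal C0 * (ENNReal.ofReal 2 * ENNReal.ofReal (2 * M ^ 2) *
      ENNReal.ofReal (2 * C2 ^ 2) * winK χ + winc χ) + ENNReal.ofReal 2 * ENNReal.ofReal C0 * (ENNReal.ofReal 2 * ENNReal.ofReal 2 *
      ENNReal.ofReal (κ ^ 2) * winc χ * ENNReal.ofReal 32) + ENNReal.ofReal 2 * (ENNReal.ofReal (2 * C1 ^ 2) * winK χ)))), ?_, ?_⟩
  · have hc' := hc.ne
    have hK' := hK.ne
    have hi : (winc χ)⁻¹ ≠ ⊤ := ENNReal.inv_ne_top.2 hχ0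
    finiteness
  intro u hu
  obtain ⟨Lu, hL⟩ := exists_L u
  have ch := fl_cont hσ0 hσ1 hw hw1 hout u
  have cf : Continuous fun z => Lu z + (a z : ℂ) * fracLap σ w u z :=
    Lu.continuous.add ((Complex.continuous_ofReal.comp hac).mul ch)
  have eP : ∀ z, Pop σ w a u z = Lu z + (a z : ℂ) * fracLap σ w u z := fun z => by rw [Pop, hL]
  have hA : ∫⁻ t, At σ u t ∂muT = ∫⁻ ζ, ‖(Nsym σ (mkY (xC ζ) (vC ζ)) : ℂ) * 𝓕 (u : Z n → ℂ) ζ‖ₑ ^ 2 :=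
    (At_mu u hu).trans (At_total hσ0 u)
  have hB : ∫⁻ t, Bt u t ∂muT ≤ ∫⁻ z, ‖u z‖ₑ ^ 2 := (muT_le _).trans (Bt_total u).le
  have hP := flow_le cf
  have hh := (flow_le ch).trans (fl_lint_le hσ0 hσ1 hw hw1 hout u)
  simp only [eP]
  have hAfin : ∫⁻ ζ, ‖(Nsym σ (mkY (xC ζ) (vC ζ)) : ℂ) * 𝓕 (u : Z n → ℂ) ζ‖ₑ ^ 2 < ⊤ :=
    memLp_lt_top (mul_fourier_mem u (Complex.continuous_ofReal.comp (continuous_Nsym hσ0)) 2 2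
      (Nsym_norm_le hσ0 hσ1)).2
  have ode := hode a hac haLB (fun z => (le_abs_self _).trans (haM z)) χ u Lu hu hL
  have κb : ∀ t, |t| ≤ 4 → ∀ p y : Y n, χ (y - p) ≠ 0 → |a (jt t p) - a (jt t y)| ≤ κ := by
    intro t ht p y h
    refine (haL _ _).trans ?_
    have h1 := jt_lip ht p y
    have h2 := hχ _ h
    have h3 : L * ‖jt t p - jt t y‖ ≤ L * (6 * (κ / (6 * (L + 1)))) :=
      mul_le_mul_of_nonneg_left (h1.trans (by linarith)) hL0
    refine h3.trans ?_
    have : L * (6 * (κ / (6 * (L + 1)))) = κ * (L / (L + 1)) := by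
      field_simp
    rw [this]
    exact mul_le_of_le_one_right hκ.le ((div_le_one (by positivity)).2 (by linarith))
  have hGG : ∀ t, ∫⁻ ζ, ∫⁻ p, ‖GG χ u t ζ p‖ₑ ^ 2 = winc χ * Bt u t := by
    intro t
    have cGh : Continuous (Gh u t) := Continuous.comp (g := fun x : ℝ × Y n => Gh u x.1 x.2)
      (f := fun ζ => (t, ζ)) (Gh_continuous u) (by fun_prop)
    have := STF_total χ cGh (slice_Gh u t).1 (slice_Gh u t).2
    rw [← Gh_inv] at this
    exact this
  set c := winc χ
  set K := winK χ
  set A := ∫⁻ ζ, ‖(Nsym σ (mkY (xC ζ) (vC ζ)) : ℂ) * 𝓕 (u : Z n → ℂ) ζ‖ₑ ^ 2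
  set B := ∫⁻ z, ‖u z‖ₑ ^ 2
  set X := ∫⁻ t, (∫⁻ ζ, ∫⁻ p, ‖(Nsym σ (shT t ζ) : ℂ) * GG χ u t ζ p‖ₑ ^ 2) ∂muT with hXdef
  have hX : X ≤ ENNReal.ofReal C0 * (ENNReal.ofReal 2 * c * (∫⁻ z, ‖Lu z + (a z : ℂ) * fracLap σ w u z‖ₑ ^ 2) +
      (ENNReal.ofReal 2 * ENNReal.ofReal (2 * M ^ 2) *
      ENNReal.ofReal (2 * ε ^ 2) * c * A + ((ENNReal.ofReal 2 * ENNReal.ofReal (2 * M ^ 2) *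
      ENNReal.ofReal (2 * C2 ^ 2) * K + c) * B + ENNReal.ofReal 2 * ENNReal.ofReal 2 * ENNReal.ofReal (κ ^ 2) * c *
      (∫⁻ t, (∫⁻ y, ‖fracLap σ w u (jt t y)‖ₑ ^ 2) ∂muT)))) := by
    refine ode.trans (mul_le_mul' le_rfl ?_)
    refine (muT_mono fun t ht => add_le_add (H_t hσ0 hσ1 hw hw1 hout hac haM χ u Lu t κ ε C2 hκ.le (κb t ht) hε.le hC2
      (hF t ht)) (hGG t).le).trans ?_
    have := lin4 (μ := muT) (flow_meas cf) (At_meas hσ0 u) (Bt_meas u) (flow_meas ch) (ENNReal.ofReal 2 * c)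
      (ENNReal.ofReal 2 * ENNReal.ofReal (2 * M ^ 2) * ENNReal.ofReal (2 * ε ^ 2) * c)
      (ENNReal.ofReal 2 * ENNReal.ofReal (2 * M ^ 2) * ENNReal.ofReal (2 * C2 ^ 2) * K + c)
      (ENNReal.ofReal 2 * ENNReal.ofReal 2 * ENNReal.ofReal (κ ^ 2) * c)
    rw [hA] at this
    refine le_trans (le_of_eq ?_) (this.le.trans ?_)
    · congr 1; ext t
      generalize ENNReal.ofReal 2 = o2
      ring
    · gcongr
  have hA2 : c * A ≤ ENNReal.ofReal 2 * X + ENNReal.ofReal 2 * (ENNReal.ofReal (2 * ε ^ 2) * c * A +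
      ENNReal.ofReal (2 * C1 ^ 2) * K * B) := by
    have e1 : c * A = ∫⁻ t, c * At σ u t ∂muT := by rw [lintegral_const_mul _ (At_meas hσ0 u), hA]
    have mX : Measurable fun t => ∫⁻ ζ, ∫⁻ p, ‖(Nsym σ (shT t ζ) : ℂ) * GG χ u t ζ p‖ₑ ^ 2 := by
      have h1 : Measurable fun x : (ℝ × Y n) × Y n => ‖(Nsym σ (shT x.1.1 x.1.2) : ℂ) * GG χ u x.1.1 x.1.2 x.2‖ₑ ^ 2 :=
        ((NG_cont hσ0 χ u).measurable.enorm.pow_const 2).comp (g := fun x : ℝ × Y n × Y n => _)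
          (f := fun x : (ℝ × Y n) × Y n => (x.1.1, x.1.2, x.2)) (by fun_prop)
      exact h1.lintegral_prod_right'.lintegral_prod_right'
    have := lin4 (μ := muT) mX (At_meas hσ0 u) (Bt_meas u) measurable_const (f4 := fun _ => 0) (ENNReal.ofReal 2)
      (ENNReal.ofReal 2 * ENNReal.ofReal (2 * ε ^ 2) * c) (ENNReal.ofReal 2 * ENNReal.ofReal (2 * C1 ^ 2) * K) 0
    rw [hA, ← hXdef] at this
    conv_lhs => rw [e1]
    refine (muT_mono fun t ht => low_t hσ0 hσ1 χ u t ε C1 hε.le hC1 (hN t ht)).trans ?_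
    refine le_trans (le_of_eq ?_) (this.le.trans ?_)
    · congr 1; ext t
      simp only [GG]
      ring
    · simp only [zero_mul, add_zero]
      refine le_trans (add_le_add le_rfl (add_le_add le_rfl (mul_le_mul' le_rfl hB))) (le_of_eq ?_)
      ring
  have fin := alg_fin hC0 (ENNReal.mul_ne_top hc.ne hAfin.ne) hh hε1 hκ1 hX hA2
  calc A = c⁻¹ * (c * A) := by rw [← mul_assoc, ENNReal.inv_mul_cancel hχ0 hc.ne, one_mul]
    _ ≤ _ := mul_le_mul' le_rfl fin
    _ = _ := by simp only [mul_assoc]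

end mainest2

section gagliardo

theorem fchar_norm (x : ℝ) : ‖(Real.fourierChar x : ℂ) - 1‖ = 2 * |Real.sin (π * x)| := by
  rw [Real.fourierChar_apply]
  have := Complex.norm_exp_I_mul_ofReal_sub_one (2 * π * x)
  rw [mul_comm Complex.I] at this
  rw [this, norm_mul, Real.norm_eq_abs, Real.norm_eq_abs]
  norm_num
  congr 1; ring

/-- Gagliardo weight -/
def Phi (s η : ℝ) : ℝ≥0∞ :=
  ∫⁻ h in Set.Ioi (0 : ℝ), ENNReal.ofReal (h ^ (-1 - 2 * s)) * ‖(Real.fourierChar (h * η) : ℂ) - 1‖ₑ ^ 2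

/-- Gagliardo constant -/
def Iga (s : ℝ) : ℝ≥0∞ :=
  ∫⁻ h in Set.Ioi (0 : ℝ), ENNReal.ofReal (h ^ (-1 - 2 * s)) * ENNReal.ofReal ((min h 1) ^ 2)

theorem Phi_scale {s : ℝ} (hs : 0 < s) (η : ℝ) : Phi s η = ENNReal.ofReal (|η| ^ (2 * s)) * Phi s 1 := by
  rcases eq_or_ne η 0 with rfl | hη
  · simp [Phi, Real.zero_rpow (by positivity : 2 * s ≠ 0)]
  have hb : 0 < |η| := abs_pos.2 hη
  set b := |η| with hbdef
  have him : (fun h : ℝ => b * h) '' Set.Ioi 0 = Set.Ioi 0 := by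
    ext x
    simp only [Set.mem_image, Set.mem_Ioi]
    constructor
    · rintro ⟨y, hy, rfl⟩; positivity
    · intro hx; exact ⟨x / b, by positivity, by field_simp⟩
  have h1 := lintegral_image_eq_lintegral_abs_deriv_mul (s := Set.Ioi (0 : ℝ)) (f := fun h => b * h) (f' := fun _ => b)
    measurableSet_Ioi (fun x _ => by simpa using ((hasDerivAt_id x).const_mul b).hasDerivWithinAt)
    (fun x _ y _ h => mul_left_cancel₀ hb.ne' h)
    (fun h => ENNReal.ofReal (h ^ (-1 - 2 * s)) * ‖(Real.fourierChar (h * 1) : ℂ) - 1‖ₑ ^ 2)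
  rw [him] at h1
  have h2 : Phi s 1 = _ := h1
  rw [h2, ← lintegral_const_mul' _ _ ENNReal.ofReal_ne_top, Phi]
  refine setLIntegral_congr_fun measurableSet_Ioi fun h hh => ?_
  have hh : 0 < h := hh
  have e1 : ‖(Real.fourierChar (h * η) : ℂ) - 1‖ₑ = ‖(Real.fourierChar (b * h * 1) : ℂ) - 1‖ₑ := by
    rw [← ofReal_norm, ← ofReal_norm, fchar_norm, fchar_norm]
    congr 2
    rcases abs_cases η with ⟨h3, _⟩ | ⟨h3, _⟩
    · rw [hbdef, h3]; congr 2; ring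
    · rw [hbdef, h3, ← abs_neg, ← Real.sin_neg]; congr 2; ring
  rw [e1, ← mul_assoc, ← mul_assoc, ← ENNReal.ofReal_mul (by positivity), ← ENNReal.ofReal_mul (by positivity)]
  congr 2
  rw [Real.mul_rpow hb.le hh.le, abs_of_pos hb]
  have : b ^ (2 * s) * b * b ^ (-1 - 2 * s) = 1 := by
    rw [← Real.rpow_add_one hb.ne', ← Real.rpow_add hb,
      show 2 * s + 1 + (-1 - 2 * s) = 0 by ring, Real.rpow_zero]
  calc h ^ (-1 - 2 * s) = (b ^ (2 * s) * b * b ^ (-1 - 2 * s)) * h ^ (-1 - 2 * s) := by rw [this, one_mul]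
    _ = _ := by ring

theorem Iga_lt_top {s : ℝ} (hs : 0 < s) (hs1 : s < 1) : Iga s < ⊤ := by
  have h1 : IntegrableOn (fun h : ℝ => h ^ (1 - 2 * s)) (Set.Ioc 0 1) :=
    (intervalIntegrable_iff_integrableOn_Ioc_of_le (by norm_num)).1
      (intervalIntegral.intervalIntegrable_rpow' (by linarith))
  have h2 : IntegrableOn (fun h : ℝ => h ^ (-1 - 2 * s)) (Set.Ioi 1) :=
    integrableOn_Ioi_rpow_of_lt (by linarith) (by norm_num)
  have l1 : ∫⁻ h in Set.Ioc (0 : ℝ) 1, ENNReal.ofReal (h ^ (1 - 2 * s)) < ⊤ := by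
    refine lt_of_le_of_lt (lintegral_mono fun h => ?_) h1.2
    exact Real.ofReal_le_enorm _
  have l2 : ∫⁻ h in Set.Ioi (1 : ℝ), ENNReal.ofReal (h ^ (-1 - 2 * s)) < ⊤ := by
    refine lt_of_le_of_lt (lintegral_mono fun h => ?_) h2.2
    exact Real.ofReal_le_enorm _
  rw [Iga, ← Set.Ioc_union_Ioi_eq_Ioi (zero_le_one' ℝ)]
  refine lt_of_le_of_lt (lintegral_union_le _ _ _) (ENNReal.add_lt_top.2 ⟨?_, ?_⟩)
  · refine lt_of_le_of_lt (setLIntegral_mono' measurableSet_Ioc fun h hh => ?_) l1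
    rw [← ENNReal.ofReal_mul (by have := hh.1; positivity), min_eq_left hh.2]
    apply ENNReal.ofReal_le_ofReal
    rw [← Real.rpow_natCast, ← Real.rpow_add hh.1]
    apply le_of_eq; congr 1; push_cast; ring
  · refine lt_of_le_of_lt (setLIntegral_mono' measurableSet_Ioi fun h hh => ?_) l2
    have hh : 1 < h := hh
    rw [min_eq_right hh.le]; simp

theorem Phi_lt_top {s : ℝ} (hs : 0 < s) (hs1 : s < 1) : Phi s 1 < ⊤ := by
  have h1 : Phi s 1 ≤ ENNReal.ofReal ((2 * π) ^ 2) * Iga s := by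
    rw [Phi, Iga, ← lintegral_const_mul' _ _ ENNReal.ofReal_ne_top]
    refine setLIntegral_mono' measurableSet_Ioi fun h hh => ?_
    have hh : 0 < h := hh
    rw [mul_left_comm, enorm_sq_eq]
    refine mul_le_mul' le_rfl ?_
    first
      | rw [← ENNReal.ofReal_mul (by positivity)]
      | skip
    refine ENNReal.ofReal_le_ofReal ?_
    rw [fchar_norm, mul_one, ← mul_pow]
    have a1 : |Real.sin (π * h)| ≤ π * h := by
      have hp : 0 < π * h := by positivity
      have h4 : |Real.sin (π * h)| ≤ |π * h| := Real.abs_sin_le_abs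
      exact h4.trans_eq (abs_of_pos hp)
    have a2 := Real.abs_sin_le_one (π * h)
    refine pow_le_pow_left₀ (by positivity) ?_ 2
    rw [mul_assoc]
    refine mul_le_mul_of_nonneg_left ?_ (by norm_num)
    rcases min_cases h 1 with ⟨h3, _⟩ | ⟨h3, _⟩
    · rw [h3]; exact a1
    · rw [h3]; linarith [Real.pi_gt_three]
  exact h1.trans_lt (ENNReal.mul_lt_top ENNReal.ofReal_lt_top (Iga_lt_top hs hs1))

theorem Phi_ne_zero {s : ℝ} (hs : 0 < s) : Phi s 1 ≠ 0 := by
  have h1 : ∫⁻ h in Set.Icc (1 / 4 : ℝ) (1 / 2), 1 ≤ Phi s 1 := by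
    rw [Phi]
    refine le_trans (setLIntegral_mono' measurableSet_Icc fun h hh => ?_)
      (lintegral_mono_set (fun h hh => lt_of_lt_of_le (by norm_num) hh.1))
    have h0 : 0 < h := lt_of_lt_of_le (by norm_num) hh.1
    rw [enorm_sq_eq, ← ENNReal.ofReal_mul (by positivity), ← ENNReal.ofReal_one]
    apply ENNReal.ofReal_le_ofReal
    have a1 : 1 ≤ h ^ (-1 - 2 * s) :=
      Real.one_le_rpow_of_pos_of_le_one_of_nonpos h0 (by linarith [hh.2]) (by linarith)
    have a2 : 2 * h ≤ Real.sin (π * h) := by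
      have := Real.mul_le_sin (x := π * h) (by positivity) (by nlinarith [hh.2, Real.pi_pos])
      have e : 2 / π * (π * h) = 2 * h := by field_simp
      linarith
    rw [fchar_norm, mul_one]
    have a3 : 1 ≤ 2 * |Real.sin (π * h)| := by
      have := le_abs_self (Real.sin (π * h))
      linarith [hh.1]
    nlinarith
  intro h0
  rw [h0] at h1
  simp at h1
  norm_num at h1

variable {V : Type*} [NormedAddCommGroup V] [InnerProductSpace ℝ V] [FiniteDimensional ℝ V]
    [MeasurableSpace V] [BorelSpace V]

theorem trans_planch (g : SchwartzMap V ℂ) (e : V) (h : ℝ) :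
    ∫⁻ ζ, ‖(Real.fourierChar (h * inner ℝ e ζ) : ℂ) - 1‖ₑ ^ 2 * ‖𝓕 (g : V → ℂ) ζ‖ₑ ^ 2 =
      ∫⁻ z, ‖g (z + h • e) - g z‖ₑ ^ 2 := by
  have i1 : Integrable fun z => g (z + h • e) := g.integrable.comp_add_right _
  have m1 : MemLp (fun z => g (z + h • e)) 2 :=
    (g.memLp 2).comp_measurePreserving (measurePreserving_add_right volume (h • e))
  have hp := planch (f := fun z => g (z + h • e) - g z) (i1.sub g.integrable) (m1.sub (g.memLp 2))
  refine Eq.trans ?_ hp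
  congr 1; ext ζ
  rw [← mul_pow, ← enorm_mul]
  congr 2
  have e1 : 𝓕 (fun z => g (z + h • e)) ζ = Real.fourierChar (h * inner ℝ e ζ) • 𝓕 (g : V → ℂ) ζ := by
    have := congrFun (VectorFourier.fourierIntegral_comp_add_right Real.fourierChar volume (innerₗ V) g (h • e)) ζ
    rw [innerₗ_apply_apply, real_inner_smul_left] at this
    exact this
  have e2 : 𝓕 (fun z => g (z + h • e) - g z) ζ = 𝓕 (fun z => g (z + h • e)) ζ - 𝓕 (g : V → ℂ) ζ := by
    simp only [Real.fourier_eq, smul_sub]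
    exact integral_sub ((Real.fourierIntegral_convergent_iff ζ).2 i1) ((Real.fourierIntegral_convergent_iff ζ).2 g.integrable)
  rw [e2, e1, Circle.smul_def, smul_eq_mul]
  ring

theorem Phi_int (g : SchwartzMap V ℂ) (e : V) (s : ℝ) :
    ∫⁻ ζ, Phi s (inner ℝ e ζ) * ‖𝓕 (g : V → ℂ) ζ‖ₑ ^ 2 =
      ∫⁻ h in Set.Ioi (0 : ℝ), ENNReal.ofReal (h ^ (-1 - 2 * s)) * ∫⁻ z, ‖g (z + h • e) - g z‖ₑ ^ 2 := by
  have cg : Continuous (𝓕 (g : V → ℂ)) := continuous_fourier g.integrable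
  have m1 : Measurable fun x : V × ℝ => ENNReal.ofReal (x.2 ^ (-1 - 2 * s)) *
      (‖(Real.fourierChar (x.2 * inner ℝ e x.1) : ℂ) - 1‖ₑ ^ 2 * ‖𝓕 (g : V → ℂ) x.1‖ₑ ^ 2) := by
    have h1 : Measurable fun x : V × ℝ => ENNReal.ofReal (x.2 ^ (-1 - 2 * s)) :=
      (measurable_snd.pow_const _).ennreal_ofReal
    have h2 : Continuous fun x : V × ℝ => (Real.fourierChar (x.2 * inner ℝ e x.1) : ℂ) - 1 := by
      refine Continuous.sub ?_ continuous_const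
      exact continuous_subtype_val.comp (Real.continuous_fourierChar.comp (by fun_prop))
    exact h1.mul ((h2.measurable.enorm.pow_const 2).mul (((cg.comp continuous_fst).measurable).enorm.pow_const 2))
  simp_rw [← trans_planch g e]
  have e1 : ∀ h : ℝ, ENNReal.ofReal (h ^ (-1 - 2 * s)) *
      ∫⁻ ζ, ‖(Real.fourierChar (h * inner ℝ e ζ) : ℂ) - 1‖ₑ ^ 2 * ‖𝓕 (g : V → ℂ) ζ‖ₑ ^ 2 =
      ∫⁻ ζ, ENNReal.ofReal (h ^ (-1 - 2 * s)) *
        (‖(Real.fourierChar (h * inner ℝ e ζ) : ℂ) - 1‖ₑ ^ 2 * ‖𝓕 (g : V → ℂ) ζ‖ₑ ^ 2) := fun h =>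
    (lintegral_const_mul' _ _ ENNReal.ofReal_ne_top).symm
  simp_rw [e1]
  rw [← lintegral_lintegral_swap (f := fun ζ h => ENNReal.ofReal (h ^ (-1 - 2 * s)) *
        (‖(Real.fourierChar (h * inner ℝ e ζ) : ℂ) - 1‖ₑ ^ 2 * ‖𝓕 (g : V → ℂ) ζ‖ₑ ^ 2)) m1.aemeasurable]
  congr 1; ext ζ
  rw [Phi, ← lintegral_mul_const' _ _ (by finiteness)]
  simp_rw [mul_assoc]

theorem gag (g u : SchwartzMap V ℂ) (e : V) (m : V → ℝ) (s : ℝ) (hg : ∀ z, g z = (m z : ℂ) * u z)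
    (hm : ∀ z, |m z| ≤ 1) (hmL : ∀ z (h : ℝ), 0 < h → |m (z + h • e) - m z| ≤ min h 1) :
    ∫⁻ ζ, Phi s (inner ℝ e ζ) * ‖𝓕 (g : V → ℂ) ζ‖ₑ ^ 2 ≤
      ENNReal.ofReal 2 * (∫⁻ ζ, Phi s (inner ℝ e ζ) * ‖𝓕 (u : V → ℂ) ζ‖ₑ ^ 2) +
      ENNReal.ofReal 2 * (Iga s * ∫⁻ z, ‖u z‖ₑ ^ 2) := by
  have cD : Continuous fun x : ℝ × V => u (x.2 + x.1 • e) - u x.2 := by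
    have := u.continuous
    fun_prop
  have mD : Measurable fun h : ℝ => ∫⁻ z, ‖u (z + h • e) - u z‖ₑ ^ 2 := 
    Measurable.lintegral_prod_right' (f := fun x : ℝ × V => ‖u (x.2 + x.1 • e) - u x.2‖ₑ ^ 2) 
      (cD.measurable.enorm.pow_const 2)
  have mh : Measurable fun h : ℝ => ENNReal.ofReal (h ^ (-1 - 2 * s)) := (measurable_id.pow_const _).ennreal_ofReal
  have mhD : Measurable fun h : ℝ => ENNReal.ofReal 2 * (ENNReal.ofReal (h ^ (-1 - 2 * s)) *
      ∫⁻ z, ‖u (z + h • e) - u z‖ₑ ^ 2) := (mh.mul mD).const_mul _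
  have hfin : ∫⁻ z, ‖u z‖ₑ ^ 2 ≠ ⊤ := (memLp_lt_top (u.memLp 2)).ne
  rw [Phi_int, Phi_int, Iga, ← lintegral_mul_const' _ _ hfin, ← lintegral_const_mul' _ _ ENNReal.ofReal_ne_top,
    ← lintegral_const_mul' _ _ ENNReal.ofReal_ne_top, ← lintegral_add_left mhD]
  refine setLIntegral_mono' measurableSet_Ioi fun h hh => ?_
  have hh : 0 < h := hh
  have key : ∫⁻ z, ‖g (z + h • e) - g z‖ₑ ^ 2 ≤ ENNReal.ofReal 2 * (∫⁻ z, ‖u (z + h • e) - u z‖ₑ ^ 2) +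
      ENNReal.ofReal (2 * (min h 1) ^ 2) * ∫⁻ z, ‖u z‖ₑ ^ 2 := by
    have c1 : Continuous fun z : V => u (z + h • e) - u z := by
      have := u.continuous
      fun_prop
    rw [← lintegral_const_mul' _ _ ENNReal.ofReal_ne_top, ← lintegral_const_mul' _ _ ENNReal.ofReal_ne_top,
      ← lintegral_add_left ((c1.measurable.enorm.pow_const 2).const_mul _)]
    refine lintegral_mono fun z => ens2 (by norm_num) (by positivity) ?_
    have e1 : g (z + h • e) - g z = (m (z + h • e) : ℂ) * (u (z + h • e) - u z) + ((m (z + h • e) - m z : ℝ) : ℂ) * u z := by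
      rw [hg, hg]; push_cast; ring
    have n1 : ‖g (z + h • e) - g z‖ ≤ ‖u (z + h • e) - u z‖ + min h 1 * ‖u z‖ := by
      rw [e1]
      refine (norm_add_le _ _).trans ?_
      rw [norm_mul, norm_mul, Complex.norm_real, Complex.norm_real]
      refine add_le_add ?_ (mul_le_mul_of_nonneg_right (hmL z h hh) (norm_nonneg _))
      exact mul_le_of_le_one_left (norm_nonneg _) (hm _)
    refine (pow_le_pow_left₀ (norm_nonneg _) n1 2).trans ?_
    nlinarith [sq_nonneg (‖u (z + h • e) - u z‖ - min h 1 * ‖u z‖)]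
  refine (mul_le_mul' le_rfl key).trans (le_of_eq ?_)
  rw [ENNReal.ofReal_mul (by norm_num)]
  ring

end gagliardo

/-- the weight `⟨v⟩^{-1}` -/
def mw (v : E n) : ℝ := (1 + ‖v‖ ^ 2) ^ (-(1 : ℝ) / 2)

theorem mw_eq (v : E n) : mw v = (√(1 + ‖v‖ ^ 2))⁻¹ := by
  rw [mw, Real.sqrt_eq_rpow, ← Real.rpow_neg (by positivity)]
  norm_num

theorem mw_pos (v : E n) : 0 < mw v := by unfold mw; positivity

theorem sqrt_ge (v : E n) : 1 ≤ √(1 + ‖v‖ ^ 2) ∧ ‖v‖ ≤ √(1 + ‖v‖ ^ 2) := by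
  constructor
  · rw [Real.le_sqrt' (by norm_num)]; nlinarith [sq_nonneg ‖v‖]
  · exact Real.le_sqrt_of_sq_le (by linarith)

theorem mw_le (v : E n) : mw v ≤ 1 := by
  rw [mw_eq]; exact inv_le_one_of_one_le₀ (sqrt_ge v).1

theorem mw_mul (v : E n) : mw v * ‖v‖ ≤ 1 := by
  rw [mw_eq, inv_mul_le_iff₀ (by linarith [(sqrt_ge v).1]), mul_one]
  exact (sqrt_ge v).2

theorem mw_mul_rpow {s : ℝ} (hs : 0 < s) (hs1 : s < 1) (v : E n) : mw v * ‖v‖ ^ s ≤ 1 := by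
  rcases le_total ‖v‖ 1 with h | h
  · have h1 := Real.rpow_le_one (norm_nonneg v) h hs.le
    have := mw_le v
    have := mw_pos v
    nlinarith [Real.rpow_nonneg (norm_nonneg v) s]
  · refine le_trans (mul_le_mul_of_nonneg_left ?_ (mw_pos v).le) (mw_mul v)
    calc ‖v‖ ^ s ≤ ‖v‖ ^ (1 : ℝ) := Real.rpow_le_rpow_of_exponent_le h hs1.le
      _ = _ := Real.rpow_one _

theorem mw_lip (v v' : E n) : |mw v' - mw v| ≤ ‖v' - v‖ := by
  have h1 := sqrt_ge v
  have h2 := sqrt_ge v'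
  have q1 := Real.sq_sqrt (show 0 ≤ 1 + ‖v‖ ^ 2 by positivity)
  have q2 := Real.sq_sqrt (show 0 ≤ 1 + ‖v'‖ ^ 2 by positivity)
  rw [mw_eq, mw_eq]
  set r := √(1 + ‖v‖ ^ 2)
  set r' := √(1 + ‖v'‖ ^ 2)
  have hr : |r - r'| ≤ |‖v‖ - ‖v'‖| := by
    have e : (r - r') * (r + r') = (‖v‖ - ‖v'‖) * (‖v‖ + ‖v'‖) := by nlinarith
    have e2 : |r - r'| * (r + r') = |‖v‖ - ‖v'‖| * (‖v‖ + ‖v'‖) := by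
      rw [← abs_of_pos (show 0 < r + r' by linarith [h1.1, h2.1]), ← abs_mul, e, abs_mul,
        abs_of_nonneg (show 0 ≤ ‖v‖ + ‖v'‖ by positivity)]
    have h3 : |r - r'| * (r + r') ≤ |‖v‖ - ‖v'‖| * (r + r') := by
      rw [e2]; exact mul_le_mul_of_nonneg_left (by linarith [h1.2, h2.2]) (abs_nonneg _)
    exact le_of_mul_le_mul_right h3 (by linarith [h1.1, h2.1])
  have h0 : 0 < r := by linarith [h1.1]
  have h0' : 0 < r' := by linarith [h2.1]
  have e3 : r'⁻¹ - r⁻¹ = (r - r') / (r' * r) := by field_simp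
  rw [e3, abs_div, abs_of_pos (mul_pos h0' h0)]
  refine (div_le_self (abs_nonneg _) (by nlinarith [h1.1, h2.1])).trans (hr.trans ?_)
  rw [norm_sub_rev]; exact abs_norm_sub_norm_le v _

/-- velocity coordinates as a continuous linear map -/
def vCLM (n : ℕ) : Z n →L[ℝ] E n := LinearMap.toContinuousLinearMap
  { toFun := vC, map_add' := fun _ _ => rfl, map_smul' := fun _ _ => rfl }

theorem exists_g (u : SchwartzMap (Z n) ℂ) : ∃ g : SchwartzMap (Z n) ℂ, ∀ z, g z = (mw (vC z) : ℂ) * u z := by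
  have hg : Function.HasTemperateGrowth (fun z : Z n => mw (vC z)) := by
    have h1 := Function.hasTemperateGrowth_one_add_norm_sq_rpow (E n) (-(1 : ℝ) / 2)
    have h2 := (vCLM n).hasTemperateGrowth
    exact h1.comp h2
  refine ⟨SchwartzMap.smulLeftCLM ℂ (fun z => mw (vC z)) u, fun z => ?_⟩
  rw [SchwartzMap.smulLeftCLM_apply_apply hg, Complex.real_smul]

theorem PF_g {u g : SchwartzMap (Z n) ℂ} (hg : ∀ z, g z = (mw (vC z) : ℂ) * u z) (α : WithLp 2 (ℝ × E n)) (v : E n) :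
    PF (Jx n) g α v = (mw v : ℂ) * PF (Jx n) u α v := by
  simp only [PF, hg, Jm_Jx, vC_mkZ, Real.fourier_eq]
  rw [← integral_const_mul]
  congr 1; ext q
  simp only [Circle.smul_def, smul_eq_mul]
  ring

theorem PF_L {u Lu : SchwartzMap (Z n) ℂ} (hL : ∀ z,
    Lu z = fderiv ℝ u z eT + ∑ i : Fin n, (vC z i : ℂ) * fderiv ℝ u z (eX i)) (α : WithLp 2 (ℝ × E n)) (v : E n) :
    PF (Jx n) Lu α v = (2 * π * Complex.I) * ((α.fst + inner ℝ v α.snd : ℝ) : ℂ) * PF (Jx n) u α v := by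
  let e : WithLp 2 (ℝ × E n) := WithLp.toLp 2 (1, v)
  let φ := slice (Jx n) u v
  have h1 : ∀ q, LineDeriv.lineDerivOp e φ q = Lu (Jm (Jx n) q v) := by
    intro q
    rw [SchwartzMap.lineDerivOp_apply_eq_fderiv]
    have d1 : HasDerivAt (fun t : ℝ => φ (q + t • e)) (fderiv ℝ φ q e) 0 := by
      have a1 : HasDerivAt (fun t : ℝ => q + t • e) e 0 := by
        simpa using ((hasDerivAt_id (0 : ℝ)).smul_const e).const_add q
      have a2 : HasFDerivAt φ (fderiv ℝ φ q) (q + (0 : ℝ) • e) := by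
        rw [zero_smul, add_zero]; exact φ.differentiableAt.hasFDerivAt
      exact a2.comp_hasDerivAt (0 : ℝ) a1
    set z := Jm (Jx n) q v
    have d2 : HasDerivAt (fun t : ℝ => u (z + t • mkZ 1 v 0)) (fderiv ℝ u z (mkZ 1 v 0)) 0 := by
      have a1 : HasDerivAt (fun t : ℝ => z + t • mkZ 1 v 0) (mkZ 1 v 0) 0 := by
        simpa using ((hasDerivAt_id (0 : ℝ)).smul_const (mkZ 1 v 0)).const_add z
      have a2 : HasFDerivAt u (fderiv ℝ u z) (z + (0 : ℝ) • mkZ 1 v 0) := by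
        rw [zero_smul, add_zero]; exact u.differentiableAt.hasFDerivAt
      exact a2.comp_hasDerivAt (0 : ℝ) a1
    have e0 : (fun t : ℝ => φ (q + t • e)) = fun t : ℝ => u (z + t • mkZ 1 v 0) := by
      ext1 t
      change u (mkZ (q.fst + t * 1) (q.snd + t • v) v) = u (mkZ q.fst q.snd v + t • mkZ 1 v 0)
      rw [← mkZ_smul, ← mkZ_add, smul_zero, add_zero]
    rw [e0] at d1
    rw [d1.unique d2, hL, mkZ_one_eq, map_add, map_sum]
    congr 1
    refine Finset.sum_congr rfl fun i _ => ?_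
    rw [map_smul, Complex.real_smul]; rfl
  have h2 := SchwartzMap.fourier_lineDerivOp_eq φ e
  have h3 := DFunLike.congr_fun h2 α
  have htg : Function.HasTemperateGrowth (fun q : WithLp 2 (ℝ × E n) => inner ℝ q e) :=
    ((innerSL ℝ).flip e).hasTemperateGrowth
  rw [SchwartzMap.smul_apply, SchwartzMap.smulLeftCLM_apply_apply htg, SchwartzMap.fourier_coe,
    SchwartzMap.fourier_coe] at h3
  have e5 : (LineDeriv.lineDerivOp e φ : WithLp 2 (ℝ × E n) → ℂ) = fun q => Lu (Jm (Jx n) q v) := funext h1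
  rw [e5] at h3
  have e6 : inner ℝ α e = α.fst + inner ℝ v α.snd := by
    rw [WithLp.prod_inner_apply, real_inner_comm α.snd v]
    simp [e]
  change 𝓕 (fun q => Lu (Jm (Jx n) q v)) α = _
  rw [h3, e6, smul_eq_mul, Complex.real_smul, ← mul_assoc]
  rfl

/-- pointwise bound for the time frequency -/
theorem tau_pt {s : ℝ} (hs : 0 < s) (hs1 : s < 1) (τ : ℝ) (ξ v : E n) :
    |τ| ^ s * mw v ≤ 1 + |τ + inner ℝ v ξ| + ‖ξ‖ ^ s := by
  set p := τ + inner ℝ v ξ with hp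
  have h1 : |τ| ≤ |p| + ‖v‖ * ‖ξ‖ := by
    have e : τ = p - inner ℝ v ξ := by rw [hp]; ring
    rw [e]
    exact (abs_sub _ _).trans (by gcongr; exact abs_real_inner_le_norm v ξ)
  have h2 : |τ| ^ s ≤ |p| ^ s + ‖v‖ ^ s * ‖ξ‖ ^ s := by
    rw [← Real.mul_rpow (norm_nonneg _) (norm_nonneg _)]
    exact (Real.rpow_le_rpow (abs_nonneg _) h1 hs.le).trans
      (Real.rpow_add_le_add_rpow (abs_nonneg _) (by positivity) hs.le hs1.le)
  have h3 : |p| ^ s ≤ 1 + |p| := by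
    rcases le_total |p| 1 with h | h
    · have := Real.rpow_le_one (abs_nonneg p) h hs.le
      linarith [abs_nonneg p]
    · have := Real.rpow_le_rpow_of_exponent_le h hs1.le
      rw [Real.rpow_one] at this; linarith
  have m0 := mw_pos v
  have m1 := mw_le v
  have m2 := mw_mul_rpow hs hs1 v
  calc |τ| ^ s * mw v ≤ (|p| ^ s + ‖v‖ ^ s * ‖ξ‖ ^ s) * mw v := by gcongr
    _ = |p| ^ s * mw v + (mw v * ‖v‖ ^ s) * ‖ξ‖ ^ s := by ring
    _ ≤ |p| ^ s * 1 + 1 * ‖ξ‖ ^ s := by gcongr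
    _ ≤ _ := by linarith

theorem rpow_sum_le_sum {ι : Type*} (S : Finset ι) (f : ι → ℝ) (hf : ∀ i, 0 ≤ f i) {s : ℝ} (hs : 0 < s) (hs1 : s < 1) :
    (∑ i ∈ S, f i) ^ s ≤ ∑ i ∈ S, f i ^ s := by
  classical
  induction S using Finset.induction_on with
  | empty => simp [Real.zero_rpow hs.ne']
  | insert i S hi ih =>
    rw [Finset.sum_insert hi, Finset.sum_insert hi]
    refine (Real.rpow_add_le_add_rpow (hf i) (Finset.sum_nonneg fun j _ => hf j) hs.le hs1.le).trans ?_
    gcongr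

theorem sq_rpow {r : ℝ} (hr : 0 ≤ r) (s : ℝ) : (r ^ 2) ^ s = (r ^ s) ^ 2 := by
  rw [← Real.rpow_natCast, ← Real.rpow_natCast, ← Real.rpow_mul hr, ← Real.rpow_mul hr, mul_comm]

/-- pointwise splitting of the full weight -/
theorem weight_split {s : ℝ} (hs : 0 < s) (hs1 : s < 1) (ζ : Z n) :
    (1 + ‖ζ‖ ^ 2) ^ s ≤ 1 + ((|tC ζ| ^ s) ^ 2 + ((‖xC ζ‖ ^ s) ^ 2 + ∑ i, (|vC ζ i| ^ s) ^ 2)) := by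
  have h1 : ‖vC ζ‖ ^ 2 = ∑ i, |vC ζ i| ^ 2 := by
    rw [EuclideanSpace.norm_sq_eq]; simp
  rw [Z_norm_sq, ← sq_abs (tC ζ), add_assoc]
  have a1 := Real.rpow_add_le_add_rpow (a := 1) (b := |tC ζ| ^ 2 + (‖xC ζ‖ ^ 2 + ‖vC ζ‖ ^ 2)) (p := s)
    zero_le_one (by positivity) hs.le hs1.le
  have a2 := Real.rpow_add_le_add_rpow (a := |tC ζ| ^ 2) (b := (‖xC ζ‖ ^ 2 + ‖vC ζ‖ ^ 2)) (p := s)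
    (by positivity) (by positivity) hs.le hs1.le
  have a3 := Real.rpow_add_le_add_rpow (a := ‖xC ζ‖ ^ 2) (b := ‖vC ζ‖ ^ 2) (p := s)
    (by positivity) (by positivity) hs.le hs1.le
  have a4 := rpow_sum_le_sum Finset.univ (fun i => |vC ζ i| ^ 2) (fun i => by positivity) hs hs1
  rw [← h1] at a4
  simp only [sq_rpow (abs_nonneg _)] at a4
  rw [Real.one_rpow] at a1
  rw [sq_rpow (abs_nonneg _)] at a2
  rw [sq_rpow (norm_nonneg _)] at a3
  linarith

theorem one_planch (u : SchwartzMap (Z n) ℂ) :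
    ∫⁻ b, ∫⁻ α, ‖PF (Jx n) u α b‖ₑ ^ 2 = ∫⁻ z, ‖u z‖ₑ ^ 2 := by
  have := partial_planch (Jx n) u (ω := fun _ => 1) measurable_const
  simp only [one_mul] at this
  rw [← this, planch u.integrable (u.memLp 2)]

theorem meas_snd {s : ℝ} : Measurable fun α : WithLp 2 (ℝ × E n) => ENNReal.ofReal ((‖α.snd‖ ^ s) ^ 2) := by
  have : Continuous fun α : WithLp 2 (ℝ × E n) => α.snd := (WithLp.prod_continuous_ofLp 2 _ _).snd
  exact ((this.norm.measurable.pow_const s).pow_const 2).ennreal_ofReal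

theorem meas_fst {s : ℝ} : Measurable fun α : WithLp 2 (ℝ × E n) => ENNReal.ofReal ((|α.fst| ^ s) ^ 2) := by
  have : Continuous fun α : WithLp 2 (ℝ × E n) => α.fst := (WithLp.prod_continuous_ofLp 2 _ _).fst
  exact ((this.abs.measurable.pow_const s).pow_const 2).ennreal_ofReal

theorem PF_g_le {u g : SchwartzMap (Z n) ℂ} (hg : ∀ z, g z = (mw (vC z) : ℂ) * u z) (α : WithLp 2 (ℝ × E n)) (v : E n) :
    ‖PF (Jx n) g α v‖ₑ ^ 2 ≤ ‖PF (Jx n) u α v‖ₑ ^ 2 := by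
  rw [PF_g hg, enorm_sq_eq, enorm_sq_eq]
  refine ENNReal.ofReal_le_ofReal (pow_le_pow_left₀ (norm_nonneg _) ?_ 2)
  rw [norm_mul, Complex.norm_real, Real.norm_eq_abs, abs_of_pos (mw_pos v)]
  exact mul_le_of_le_one_left (norm_nonneg _) (mw_le v)

theorem xi_le {s : ℝ} {u g : SchwartzMap (Z n) ℂ} (hg : ∀ z, g z = (mw (vC z) : ℂ) * u z) :
    ∫⁻ ζ, ENNReal.ofReal ((‖xC ζ‖ ^ s) ^ 2) * ‖𝓕 (g : Z n → ℂ) ζ‖ₑ ^ 2 ≤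
    ∫⁻ ζ, ENNReal.ofReal ((‖xC ζ‖ ^ s) ^ 2) * ‖𝓕 (u : Z n → ℂ) ζ‖ₑ ^ 2 := by
  have h1 := partial_planch (Jx n) g (meas_snd (n := n) (s := s))
  have h2 := partial_planch (Jx n) u (meas_snd (n := n) (s := s))
  refine le_trans (le_of_eq h1) (le_trans ?_ (le_of_eq h2.symm))
  exact lintegral_mono fun v => lintegral_mono fun α => mul_le_mul' le_rfl (PF_g_le hg α v)

theorem tau_real {τs m U p X : ℝ} (h0 : 0 ≤ τs) (hm : 0 ≤ m) (hp0 : 0 ≤ p) (hX0 : 0 ≤ X)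
    (hp : τs * m ≤ 1 + p + X) :
    τs ^ 2 * (m * U) ^ 2 ≤ 3 * (U ^ 2 + ((2 * π * p * U) ^ 2 + X ^ 2 * U ^ 2)) := by
  have e1 : τs ^ 2 * (m * U) ^ 2 = (τs * m) ^ 2 * U ^ 2 := by ring
  rw [e1]
  have hT0 : 0 ≤ τs * m := mul_nonneg h0 hm
  have e2 : (τs * m) ^ 2 ≤ 3 * (1 + p ^ 2 + X ^ 2) := by
    refine (pow_le_pow_left₀ hT0 hp 2).trans ?_
    nlinarith [sq_nonneg (1 - p), sq_nonneg (1 - X), sq_nonneg (p - X)]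
  have e3 : 1 ≤ (2 * π) ^ 2 := by nlinarith [Real.pi_gt_three]
  have e4 : 0 ≤ p ^ 2 * U ^ 2 := by positivity
  have e5 : p ^ 2 * U ^ 2 ≤ (2 * π) ^ 2 * (p ^ 2 * U ^ 2) := le_mul_of_one_le_left e4 e3
  calc (τs * m) ^ 2 * U ^ 2 ≤ 3 * (1 + p ^ 2 + X ^ 2) * U ^ 2 := mul_le_mul_of_nonneg_right e2 (sq_nonneg _)
    _ = 3 * (U ^ 2 + (p ^ 2 * U ^ 2 + X ^ 2 * U ^ 2)) := by ring
    _ ≤ 3 * (U ^ 2 + ((2 * π) ^ 2 * (p ^ 2 * U ^ 2) + X ^ 2 * U ^ 2)) := by linarith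
    _ = _ := by ring

theorem tau_pt2 {s : ℝ} (hs : 0 < s) (hs1 : s < 1) {u g Lu : SchwartzMap (Z n) ℂ}
    (hg : ∀ z, g z = (mw (vC z) : ℂ) * u z) (hL : ∀ z,
      Lu z = fderiv ℝ u z eT + ∑ i : Fin n, (vC z i : ℂ) * fderiv ℝ u z (eX i))
    (α : WithLp 2 (ℝ × E n)) (v : E n) :
    ENNReal.ofReal ((|α.fst| ^ s) ^ 2) * ‖PF (Jx n) g α v‖ₑ ^ 2 ≤
    ENNReal.ofReal 3 * (‖PF (Jx n) u α v‖ₑ ^ 2 + (‖PF (Jx n) Lu α v‖ₑ ^ 2 +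
      ENNReal.ofReal ((‖α.snd‖ ^ s) ^ 2) * ‖PF (Jx n) u α v‖ₑ ^ 2)) := by
  have h1 : ‖PF (Jx n) g α v‖ = mw v * ‖PF (Jx n) u α v‖ := by
    rw [PF_g hg, norm_mul, Complex.norm_real, Real.norm_eq_abs, abs_of_pos (mw_pos v)]
  have h2 : ‖PF (Jx n) Lu α v‖ = 2 * π * |α.fst + inner ℝ v α.snd| * ‖PF (Jx n) u α v‖ := by
    rw [PF_L hL, norm_mul, norm_mul, Complex.norm_real, Real.norm_eq_abs]
    congr 2
    simp [abs_of_pos Real.pi_pos]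
  have hp := tau_pt hs hs1 α.fst α.snd v
  rw [enorm_sq_eq, enorm_sq_eq, enorm_sq_eq, h1, h2]
  have q1 : 0 ≤ |α.fst| ^ s := Real.rpow_nonneg (abs_nonneg _) _
  have q2 : 0 ≤ ‖α.snd‖ ^ s := Real.rpow_nonneg (norm_nonneg _) _
  have q3 : 0 ≤ |α.fst + inner ℝ v α.snd| := abs_nonneg _
  have q4 := (mw_pos v).le
  generalize ‖PF (Jx n) u α v‖ = U at *
  generalize |α.fst + inner ℝ v α.snd| = p at *
  generalize ‖α.snd‖ ^ s = X at *
  generalize |α.fst| ^ s = T at *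
  generalize mw v = m at *
  rw [← ENNReal.ofReal_mul (by positivity), ← ENNReal.ofReal_mul (by positivity),
    ← ENNReal.ofReal_add (by positivity) (by positivity),
    ← ENNReal.ofReal_add (by positivity) (by positivity), ← ENNReal.ofReal_mul (by positivity)]
  exact ENNReal.ofReal_le_ofReal (tau_real q1 q4 q3 q2 hp)

theorem PF_cont' (u : SchwartzMap (Z n) ℂ) :
    Continuous fun x : E n × WithLp 2 (ℝ × E n) => PF (Jx n) u x.2 x.1 := by
  have h := (PF_continuous (Jx n) u).comp continuous_swap
  exact h

theorem PF_meas1 (u : SchwartzMap (Z n) ℂ) (v : E n) : Measurable fun α => ‖PF (Jx n) u α v‖ₑ ^ 2 := by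
  have h : Continuous fun α => PF (Jx n) u α v :=
    continuous_fourier (slice (Jx n) u v).integrable
  exact h.measurable.enorm.pow_const 2

theorem tau_le {s : ℝ} (hs : 0 < s) (hs1 : s < 1) {u g Lu : SchwartzMap (Z n) ℂ}
    (hg : ∀ z, g z = (mw (vC z) : ℂ) * u z) (hL : ∀ z,
      Lu z = fderiv ℝ u z eT + ∑ i : Fin n, (vC z i : ℂ) * fderiv ℝ u z (eX i)) :
    ∫⁻ ζ, ENNReal.ofReal ((|tC ζ| ^ s) ^ 2) * ‖𝓕 (g : Z n → ℂ) ζ‖ₑ ^ 2 ≤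
    ENNReal.ofReal 3 * ((∫⁻ z, ‖u z‖ₑ ^ 2) + ((∫⁻ z, ‖Lu z‖ₑ ^ 2) +
      ∫⁻ ζ, ENNReal.ofReal ((‖xC ζ‖ ^ s) ^ 2) * ‖𝓕 (u : Z n → ℂ) ζ‖ₑ ^ 2)) := by
  have h1 : ∫⁻ ζ, ENNReal.ofReal ((|tC ζ| ^ s) ^ 2) * ‖𝓕 (g : Z n → ℂ) ζ‖ₑ ^ 2 = 
      ∫⁻ v, ∫⁻ α, ENNReal.ofReal ((|α.fst| ^ s) ^ 2) * ‖PF (Jx n) g α v‖ₑ ^ 2 :=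
    partial_planch (Jx n) g (meas_fst (n := n) (s := s))
  have h2 : ∫⁻ ζ, ENNReal.ofReal ((‖xC ζ‖ ^ s) ^ 2) * ‖𝓕 (u : Z n → ℂ) ζ‖ₑ ^ 2 = 
      ∫⁻ v, ∫⁻ α, ENNReal.ofReal ((‖α.snd‖ ^ s) ^ 2) * ‖PF (Jx n) u α v‖ₑ ^ 2 :=
    partial_planch (Jx n) u (meas_snd (n := n) (s := s))
  rw [h1, h2]
  have cu : Continuous fun x : E n × WithLp 2 (ℝ × E n) => PF (Jx n) u x.2 x.1 :=
    PF_cont' u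
  have cL : Continuous fun x : E n × WithLp 2 (ℝ × E n) => PF (Jx n) Lu x.2 x.1 :=
    PF_cont' Lu
  have mu : Measurable fun x : E n × WithLp 2 (ℝ × E n) => ‖PF (Jx n) u x.2 x.1‖ₑ ^ 2 :=
    cu.measurable.enorm.pow_const 2
  have mL : Measurable fun x : E n × WithLp 2 (ℝ × E n) => ‖PF (Jx n) Lu x.2 x.1‖ₑ ^ 2 :=
    cL.measurable.enorm.pow_const 2
  rw [← one_planch u, ← one_planch Lu, ← lintegral_add_left mL.lintegral_prod_right',
    ← lintegral_add_left mu.lintegral_prod_right', ← lintegral_const_mul' _ _ ENNReal.ofReal_ne_top]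
  refine lintegral_mono fun v => ?_
  have mu' : Measurable fun α => ‖PF (Jx n) u α v‖ₑ ^ 2 := PF_meas1 u v
  have mL' : Measurable fun α => ‖PF (Jx n) Lu α v‖ₑ ^ 2 := PF_meas1 Lu v
  rw [← lintegral_add_left mL', ← lintegral_add_left mu', ← lintegral_const_mul' _ _ ENNReal.ofReal_ne_top]
  refine lintegral_mono fun α => ?_
  exact tau_pt2 hs hs1 hg hL α v

/-- unit vector in a velocity direction -/
def eV (i : Fin n) : Z n := EuclideanSpace.single (Sum.inr (Sum.inr i)) 1

theorem inner_eV (i : Fin n) (ζ : Z n) : inner ℝ (eV i) ζ = vC ζ i := by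
  rw [eV, EuclideanSpace.inner_single_left]; simp [vC]

theorem vC_eV (i : Fin n) : ‖vC (eV i)‖ ≤ 1 := by
  have h := Z_norm_sq (eV i)
  have h1 : ‖eV (n := n) i‖ = 1 := by simp [eV]
  rw [h1] at h
  nlinarith [sq_nonneg (tC (eV i)), sq_nonneg ‖xC (eV i)‖, norm_nonneg (vC (eV i))]

theorem eta_le {s : ℝ} (hs : 0 < s) (hs1 : s < 1) {u g : SchwartzMap (Z n) ℂ}
    (hg : ∀ z, g z = (mw (vC z) : ℂ) * u z) (i : Fin n) :
    ∫⁻ ζ, ENNReal.ofReal ((|vC ζ i| ^ s) ^ 2) * ‖𝓕 (g : Z n → ℂ) ζ‖ₑ ^ 2 ≤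
    ENNReal.ofReal 2 * (∫⁻ ζ, ENNReal.ofReal ((|vC ζ i| ^ s) ^ 2) * ‖𝓕 (u : Z n → ℂ) ζ‖ₑ ^ 2) +
      ((Phi s 1)⁻¹ * ENNReal.ofReal 2 * Iga s) * ∫⁻ z, ‖u z‖ₑ ^ 2 := by
  have h := gag g u (eV i) (fun z => mw (vC z)) s hg
    (fun z => by rw [abs_of_pos (mw_pos _)]; exact mw_le _)
    (fun z h hh => by
      refine le_min ?_ ?_
      · refine (mw_lip _ _).trans ?_
        rw [vC_add, add_sub_cancel_left]
        change ‖h • vC (eV i)‖ ≤ h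
        rw [norm_smul, Real.norm_eq_abs, abs_of_pos hh]
        exact mul_le_of_le_one_right hh.le (vC_eV i)
      · rw [abs_le]
        constructor <;> linarith [mw_pos (vC (z + h • eV i)), mw_pos (vC z), mw_le (vC (z + h • eV i)), mw_le (vC z)])
  have hP0 := Phi_ne_zero hs
  have hPt := (Phi_lt_top hs hs1).ne
  have key : ∀ f : SchwartzMap (Z n) ℂ, ∫⁻ ζ, Phi s (inner ℝ (eV i) ζ) * ‖𝓕 (f : Z n → ℂ) ζ‖ₑ ^ 2 =
      Phi s 1 * ∫⁻ ζ, ENNReal.ofReal ((|vC ζ i| ^ s) ^ 2) * ‖𝓕 (f : Z n → ℂ) ζ‖ₑ ^ 2 := by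
    intro f
    rw [← lintegral_const_mul' _ _ hPt]
    congr 1; ext ζ
    rw [inner_eV, Phi_scale hs, mul_comm 2 s, Real.rpow_mul (abs_nonneg _), Real.rpow_ofNat]
    ring
  rw [key, key] at h
  have h' := mul_le_mul' (le_refl (Phi s 1)⁻¹) h
  rw [← mul_assoc, ENNReal.inv_mul_cancel hP0 hPt, one_mul] at h'
  refine h'.trans (le_of_eq ?_)
  rw [mul_add, mul_left_comm (ENNReal.ofReal 2), ← mul_assoc, ENNReal.inv_mul_cancel hP0 hPt, one_mul]
  ring

section assembly

variable {σ : ℝ}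

/-- the controlled quantity -/
def AA (σ : ℝ) (u : SchwartzMap (Z n) ℂ) : ℝ≥0∞ :=
  ∫⁻ ζ, ‖(Nsym σ (mkY (xC ζ) (vC ζ)) : ℂ) * 𝓕 (u : Z n → ℂ) ζ‖ₑ ^ 2

theorem wt_le_AA (u : SchwartzMap (Z n) ℂ) {ω : Z n → ℝ} (hω : ∀ ζ, 0 ≤ ω ζ)
    (h : ∀ ζ, ω ζ ≤ Nsym σ (mkY (xC ζ) (vC ζ))) :
    ∫⁻ ζ, ENNReal.ofReal (ω ζ ^ 2) * ‖𝓕 (u : Z n → ℂ) ζ‖ₑ ^ 2 ≤ AA σ u := by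
  refine lintegral_mono fun ζ => ?_
  rw [enorm_sq_eq, enorm_sq_eq, ← ENNReal.ofReal_mul (sq_nonneg _), ← mul_pow]
  refine ENNReal.ofReal_le_ofReal (pow_le_pow_left₀ (mul_nonneg (hω ζ) (norm_nonneg _)) ?_ 2)
  rw [norm_mul, Complex.norm_real, Real.norm_eq_abs, abs_of_nonneg (Nsym_nonneg _ _)]
  exact mul_le_mul_of_nonneg_right (h ζ) (norm_nonneg _)

theorem wt_le_AA' (u : SchwartzMap (Z n) ℂ) {ω : Z n → ℝ} (hω : ∀ ζ, 0 ≤ ω ζ)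
    (h : ∀ ζ, ω ζ ≤ 1 + Nsym σ (mkY (xC ζ) (vC ζ))) :
    ∫⁻ ζ, ENNReal.ofReal (ω ζ ^ 2) * ‖𝓕 (u : Z n → ℂ) ζ‖ₑ ^ 2 ≤
      ENNReal.ofReal 2 * ((∫⁻ z, ‖u z‖ₑ ^ 2) + AA σ u) := by
  have c2 := (continuous_fourier u.integrable).measurable.enorm.pow_const 2
  rw [← planch u.integrable (u.memLp 2), AA, ← lintegral_add_left c2, ← lintegral_const_mul' _ _ ENNReal.ofReal_ne_top]
  refine lintegral_mono fun ζ => ?_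
  rw [mul_add, enorm_sq_eq, enorm_sq_eq, ← ENNReal.ofReal_mul (sq_nonneg _), ← mul_pow,
    ← ENNReal.ofReal_mul (by norm_num), ← ENNReal.ofReal_mul (by norm_num),
    ← ENNReal.ofReal_add (by positivity) (by positivity)]
  refine ENNReal.ofReal_le_ofReal ?_
  rw [norm_mul, Complex.norm_real, Real.norm_eq_abs, abs_of_nonneg (Nsym_nonneg _ _)]
  have h1 := h ζ
  have h2 := hω ζ
  have h3 := Nsym_nonneg σ (mkY (xC ζ) (vC ζ))
  have h4 := norm_nonneg (𝓕 (u : Z n → ℂ) ζ)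
  generalize Nsym σ (mkY (xC ζ) (vC ζ)) = N at *
  generalize ‖𝓕 (u : Z n → ℂ) ζ‖ = U at *
  generalize ω ζ = W at *
  refine (pow_le_pow_left₀ (mul_nonneg h2 h4) (mul_le_mul_of_nonneg_right h1 h4) 2).trans ?_
  nlinarith [sq_nonneg (U - N * U)]

theorem v_le_N (η : E n) (ξ : E n) : ‖η‖ ^ (2 * σ) ≤ Nsym σ (mkY ξ η) := by
  rw [Nsym, mkY_fst, mkY_snd]
  have : 0 ≤ ‖ξ‖ ^ (2 * σ / (2 * σ + 1)) := by positivity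
  linarith

theorem x_le_N (η : E n) (ξ : E n) : ‖ξ‖ ^ (2 * σ / (2 * σ + 1)) ≤ Nsym σ (mkY ξ η) := by
  rw [Nsym, mkY_fst, mkY_snd]
  have : 0 ≤ ‖η‖ ^ (2 * σ) := by positivity
  linarith

theorem vi_le (hσ0 : 0 < σ) (η : E n) (i : Fin n) : |η i| ^ (2 * σ / (2 * σ + 1)) ≤ 1 + ‖η‖ ^ (2 * σ) := by
  have h1 : |η i| ≤ ‖η‖ := PiLp.norm_apply_le η i
  have h2 := Real.rpow_le_rpow (abs_nonneg _) h1 (sexp_pos hσ0).le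
  refine h2.trans ?_
  have h3 : 0 ≤ ‖η‖ ^ (2 * σ) := by positivity
  rcases le_total ‖η‖ 1 with h | h
  · have := Real.rpow_le_one (norm_nonneg η) h (sexp_pos hσ0).le
    linarith
  · have : ‖η‖ ^ (2 * σ / (2 * σ + 1)) ≤ ‖η‖ ^ (2 * σ) :=
      Real.rpow_le_rpow_of_exponent_le h (div_le_self (by linarith) (by linarith))
    linarith

/-- the second term -/
theorem term2 (hσ0 : 0 < σ) (hσ1 : σ < 1) (u : SchwartzMap (Z n) ℂ) :
    ∫⁻ ζ, ‖(((1 + ‖vC ζ‖ ^ 2) ^ σ : ℝ) : ℂ) * 𝓕 (u : Z n → ℂ) ζ‖ₑ ^ 2 ≤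
      ENNReal.ofReal 2 * ((∫⁻ z, ‖u z‖ₑ ^ 2) + AA σ u) := by
  refine le_trans (le_of_eq ?_) (wt_le_AA' (σ := σ) u (ω := fun ζ => (1 + ‖vC ζ‖ ^ 2) ^ σ) (fun ζ => by positivity)
    (fun ζ => ?_))
  · congr 1; ext ζ
    rw [enorm_mul, mul_pow]
    congr 1
    rw [enorm_sq_eq, Complex.norm_real, Real.norm_eq_abs, sq_abs]
  · have h1 := Real.rpow_add_le_add_rpow (a := 1) (b := ‖vC ζ‖ ^ 2) (p := σ) zero_le_one (by positivity) hσ0.le hσ1.le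
    have h2 := v_le_N (σ := σ) (vC ζ) (xC ζ)
    have e : (‖vC ζ‖ ^ 2) ^ σ = ‖vC ζ‖ ^ (2 * σ) := by
      rw [← Real.rpow_natCast, ← Real.rpow_mul (norm_nonneg _)]; norm_num
    rw [Real.one_rpow, e] at h1
    linarith

/-- the first term -/
theorem term1 (hσ0 : 0 < σ) : ∃ K : ℝ≥0∞, K ≠ ⊤ ∧ ∀ u g Lu : SchwartzMap (Z n) ℂ,
    (∀ z, g z = (mw (vC z) : ℂ) * u z) →
    (∀ z, Lu z = fderiv ℝ u z eT + ∑ i : Fin n, (vC z i : ℂ) * fderiv ℝ u z (eX i)) →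
    ∫⁻ ζ, ‖(((1 + ‖ζ‖ ^ 2) ^ (σ / (2 * σ + 1)) : ℝ) : ℂ) * 𝓕 (g : Z n → ℂ) ζ‖ₑ ^ 2 ≤
      K * ((∫⁻ z, ‖u z‖ₑ ^ 2) + ((∫⁻ z, ‖Lu z‖ₑ ^ 2) + AA σ u)) := by
  set s := 2 * σ / (2 * σ + 1) with hsdef
  have hs : 0 < s := sexp_pos hσ0
  have hs1 : s < 1 := sexp_lt hσ0
  have hP0 := Phi_ne_zero hs
  have hI := (Iga_lt_top hs hs1).ne
  set κ : ℝ≥0∞ := (Phi s 1)⁻¹ * ENNReal.ofReal 2 * Iga s with hκ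
  have hκt : κ ≠ ⊤ := ENNReal.mul_ne_top (ENNReal.mul_ne_top (ENNReal.inv_ne_top.2 hP0) ENNReal.ofReal_ne_top) hI
  refine ⟨1 + (ENNReal.ofReal 3 + (1 + (n : ℝ≥0∞) * (ENNReal.ofReal 2 * ENNReal.ofReal 2 + κ))), ?_, ?_⟩
  · have h2 : (n : ℝ≥0∞) ≠ ⊤ := ENNReal.natCast_ne_top n
    finiteness
  intro u g Lu hg hL
  set B := ∫⁻ z, ‖u z‖ₑ ^ 2
  set ℓ := ∫⁻ z, ‖Lu z‖ₑ ^ 2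
  set A := AA σ u
  set S := B + (ℓ + A) with hS
  have hBS : B ≤ S := le_self_add
  have hAS : A ≤ S := by rw [hS]; exact le_add_left (le_add_left le_rfl)
  have hBAS : B + A ≤ S := by rw [hS]; exact add_le_add le_rfl (le_add_left le_rfl)
  have bx : ∫⁻ ζ, ENNReal.ofReal ((‖xC ζ‖ ^ s) ^ 2) * ‖𝓕 (u : Z n → ℂ) ζ‖ₑ ^ 2 ≤ A :=
    wt_le_AA u (fun ζ => by positivity) (fun ζ => x_le_N _ _)
  have t0 : ∫⁻ ζ, ‖𝓕 (g : Z n → ℂ) ζ‖ₑ ^ 2 ≤ S := by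
    rw [planch g.integrable (g.memLp 2)]
    refine (lintegral_mono fun z => ?_).trans hBS
    rw [hg, enorm_sq_eq, enorm_sq_eq]
    refine ENNReal.ofReal_le_ofReal (pow_le_pow_left₀ (norm_nonneg _) ?_ 2)
    rw [norm_mul, Complex.norm_real, Real.norm_eq_abs, abs_of_pos (mw_pos _)]
    exact mul_le_of_le_one_left (norm_nonneg _) (mw_le _)
  have t1 : ∫⁻ ζ, ENNReal.ofReal ((|tC ζ| ^ s) ^ 2) * ‖𝓕 (g : Z n → ℂ) ζ‖ₑ ^ 2 ≤ ENNReal.ofReal 3 * S := by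
    refine (tau_le hs hs1 hg hL).trans (mul_le_mul' le_rfl ?_)
    exact add_le_add le_rfl (add_le_add le_rfl bx)
  have t2 : ∫⁻ ζ, ENNReal.ofReal ((‖xC ζ‖ ^ s) ^ 2) * ‖𝓕 (g : Z n → ℂ) ζ‖ₑ ^ 2 ≤ 1 * S := by
    rw [one_mul]; exact (xi_le hg).trans (bx.trans hAS)
  have t3 : ∀ i : Fin n, ∫⁻ ζ, ENNReal.ofReal ((|vC ζ i| ^ s) ^ 2) * ‖𝓕 (g : Z n → ℂ) ζ‖ₑ ^ 2 ≤
      (ENNReal.ofReal 2 * ENNReal.ofReal 2 + κ) * S := by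
    intro i
    refine (eta_le hs hs1 hg i).trans ?_
    rw [add_mul, mul_assoc (ENNReal.ofReal 2)]
    refine add_le_add (mul_le_mul' le_rfl ?_) (mul_le_mul' le_rfl hBS)
    refine (wt_le_AA' (σ := σ) u (ω := fun ζ => |vC ζ i| ^ s) (fun ζ => by positivity) (fun ζ => ?_)).trans
      (mul_le_mul' le_rfl hBAS)
    exact (vi_le hσ0 (vC ζ) i).trans (by linarith [v_le_N (σ := σ) (vC ζ) (xC ζ)])
  have mg : Measurable fun ζ => ‖𝓕 (g : Z n → ℂ) ζ‖ₑ ^ 2 :=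
    (continuous_fourier g.integrable).measurable.enorm.pow_const 2
  have m1 : Measurable fun ζ : Z n => ENNReal.ofReal ((|tC ζ| ^ s) ^ 2) * ‖𝓕 (g : Z n → ℂ) ζ‖ₑ ^ 2 := by
    have : Continuous fun ζ : Z n => tC ζ := continuous_tC
    exact ((this.abs.measurable.pow_const s).pow_const 2).ennreal_ofReal.mul mg
  have m2 : Measurable fun ζ : Z n => ENNReal.ofReal ((‖xC ζ‖ ^ s) ^ 2) * ‖𝓕 (g : Z n → ℂ) ζ‖ₑ ^ 2 := by
    have : Continuous fun ζ : Z n => xC ζ := continuous_xC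
    exact ((this.norm.measurable.pow_const s).pow_const 2).ennreal_ofReal.mul mg
  have m3 : ∀ i : Fin n, Measurable fun ζ : Z n =>
      ENNReal.ofReal ((|vC ζ i| ^ s) ^ 2) * ‖𝓕 (g : Z n → ℂ) ζ‖ₑ ^ 2 := by
    intro i
    have : Continuous fun ζ : Z n => vC ζ i := (vCL i).continuous
    exact ((this.abs.measurable.pow_const s).pow_const 2).ennreal_ofReal.mul mg
  calc ∫⁻ ζ, ‖(((1 + ‖ζ‖ ^ 2) ^ (σ / (2 * σ + 1)) : ℝ) : ℂ) * 𝓕 (g : Z n → ℂ) ζ‖ₑ ^ 2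
      ≤ ∫⁻ ζ, (‖𝓕 (g : Z n → ℂ) ζ‖ₑ ^ 2 + (ENNReal.ofReal ((|tC ζ| ^ s) ^ 2) * ‖𝓕 (g : Z n → ℂ) ζ‖ₑ ^ 2 +
        (ENNReal.ofReal ((‖xC ζ‖ ^ s) ^ 2) * ‖𝓕 (g : Z n → ℂ) ζ‖ₑ ^ 2 +
          ∑ i, ENNReal.ofReal ((|vC ζ i| ^ s) ^ 2) * ‖𝓕 (g : Z n → ℂ) ζ‖ₑ ^ 2))) := by
        refine lintegral_mono fun ζ => ?_
        rw [enorm_mul, mul_pow, enorm_sq_eq, Complex.norm_real, Real.norm_eq_abs, sq_abs,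
          ← Finset.sum_mul, ← add_mul, ← add_mul, ← one_add_mul]
        refine mul_le_mul' ?_ le_rfl
        rw [← ENNReal.ofReal_sum_of_nonneg (fun i _ => by positivity), ← ENNReal.ofReal_add (by positivity) (by positivity),
          ← ENNReal.ofReal_add (by positivity) (by positivity), ← ENNReal.ofReal_one,
          ← ENNReal.ofReal_add (by positivity) (by positivity)]
        refine ENNReal.ofReal_le_ofReal ?_
        refine le_trans (le_of_eq ?_) (weight_split hs hs1 ζ)
        rw [← Real.rpow_natCast, ← Real.rpow_mul (by positivity)]
        congr 1
        rw [hsdef]; push_cast; ring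
    _ ≤ S + (ENNReal.ofReal 3 * S + (1 * S + ∑ i : Fin n, (ENNReal.ofReal 2 * ENNReal.ofReal 2 + κ) * S)) := by
        rw [lintegral_add_left mg, lintegral_add_left m1, lintegral_add_left m2,
          lintegral_finsetSum _ (fun i _ => m3 i)]
        exact add_le_add t0 (add_le_add t1 (add_le_add t2 (Finset.sum_le_sum fun i _ => t3 i)))
    _ = _ := by
        rw [Finset.sum_const, Finset.card_univ, Fintype.card_fin, nsmul_eq_mul]
        ring

theorem ell_le (hσ0 : 0 < σ) (hσ1 : σ < 1) {w : E n → ℝ} (hw : Continuous w)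
    (hw1 : ∀ η, 0 ≤ w η ∧ w η ≤ 1) (hout : ∀ η : E n, 2 ≤ ‖η‖ → w η = 1)
    {a : Z n → ℝ} {M : ℝ} (haM : ∀ z, |a z| ≤ M) (u Lu : SchwartzMap (Z n) ℂ)
    (hL : ∀ z, Lu z = fderiv ℝ u z eT + ∑ i : Fin n, (vC z i : ℂ) * fderiv ℝ u z (eX i)) :
    ∫⁻ z, ‖Lu z‖ₑ ^ 2 ≤ ENNReal.ofReal 2 * (∫⁻ z, ‖Pop σ w a u z‖ₑ ^ 2) +
      ENNReal.ofReal (2 * M ^ 2) * (ENNReal.ofReal 2 * AA σ u + ENNReal.ofReal 32 * ∫⁻ z, ‖u z‖ₑ ^ 2) := by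
  have cf := fl_cont hσ0 hσ1 hw hw1 hout u
  have mf : Measurable fun z => ENNReal.ofReal (2 * M ^ 2) * ‖fracLap σ w u z‖ₑ ^ 2 :=
    (cf.measurable.enorm.pow_const 2).const_mul _
  have h1 : ∫⁻ z, ‖Lu z‖ₑ ^ 2 ≤ ENNReal.ofReal 2 * (∫⁻ z, ‖Pop σ w a u z‖ₑ ^ 2) +
      ENNReal.ofReal (2 * M ^ 2) * ∫⁻ z, ‖fracLap σ w u z‖ₑ ^ 2 := by
    rw [← lintegral_const_mul' _ _ ENNReal.ofReal_ne_top, ← lintegral_const_mul' _ _ ENNReal.ofReal_ne_top,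
      ← lintegral_add_right _ mf]
    refine lintegral_mono fun z => ens2 (by norm_num) (by positivity) ?_
    have e : Lu z = Pop σ w a u z - (a z : ℂ) * fracLap σ w u z := by rw [hL, Pop]; ring
    have h2 : ‖Lu z‖ ≤ ‖Pop σ w a u z‖ + M * ‖fracLap σ w u z‖ := by
      rw [e]
      refine (norm_sub_le _ _).trans ?_
      rw [norm_mul, Complex.norm_real, Real.norm_eq_abs]
      exact add_le_add le_rfl (mul_le_mul_of_nonneg_right (haM z) (norm_nonneg _))
    refine (pow_le_pow_left₀ (norm_nonneg _) h2 2).trans ?_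
    nlinarith [sq_nonneg (‖Pop σ w a u z‖ - M * ‖fracLap σ w u z‖)]
  exact h1.trans (add_le_add le_rfl (mul_le_mul' le_rfl (fl_lint_le hσ0 hσ1 hw hw1 hout u)))

theorem sq_to_lin {x p q K : ℝ≥0∞} (hK : K ≠ ⊤) (h : x ^ 2 ≤ K * (p ^ 2 + q ^ 2)) :
    x ≤ ENNReal.ofReal (K.toReal + 1) * (p + q) := by
  rw [← ENNReal.pow_le_pow_left_iff (two_ne_zero), mul_pow]
  refine h.trans (mul_le_mul' ?_ ?_)
  · conv_lhs => rw [← ENNReal.ofReal_toReal hK]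
    rw [← ENNReal.ofReal_pow (by positivity)]
    refine ENNReal.ofReal_le_ofReal ?_
    nlinarith [ENNReal.toReal_nonneg (a := K)]
  · have : (p + q) ^ 2 = p ^ 2 + q ^ 2 + 2 * p * q := by ring
    rw [this]; exact le_self_add

theorem final_est (hσ0 : 0 < σ) (hσ1 : σ < 1) {w : E n → ℝ} (hw : Continuous w)
    (hw1 : ∀ η, 0 ≤ w η ∧ w η ≤ 1) (hout : ∀ η : E n, 2 ≤ ‖η‖ → w η = 1)
    {a : Z n → ℝ} (hac : Continuous a) {a₀ M L : ℝ} (ha₀ : 0 < a₀) (haLB : ∀ z, a₀ ≤ a z)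
    (haM : ∀ z, |a z| ≤ M) (hL0 : 0 ≤ L) (haL : ∀ z z', |a z - a z'| ≤ L * ‖z - z'‖) :
    ∃ C : ℝ, 0 < C ∧ ∀ u : SchwartzMap (Z n) ℂ,
      (∀ z : Z n, u z ≠ 0 → tC z ∈ Set.Icc (-3 : ℝ) 3) →
      eLpNorm (fun ζ => (((1 + ‖ζ‖ ^ 2) ^ (σ / (2 * σ + 1)) : ℝ) : ℂ) *
          FourierTransform.fourier
            (fun z : Z n => (((1 + ‖vC z‖ ^ 2) ^ (-(1 : ℝ) / 2) : ℝ) : ℂ) * u z) ζ) 2 volume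
        + eLpNorm (fun ζ => (((1 + ‖vC ζ‖ ^ 2) ^ σ : ℝ) : ℂ) *
            FourierTransform.fourier (⇑u) ζ) 2 volume
        ≤ ENNReal.ofReal C *
          (eLpNorm (Pop σ w a ⇑u) 2 volume + eLpNorm (⇑u) 2 volume) := by
  obtain ⟨C, hC, hmain⟩ := main_est hσ0 hσ1 hw hw1 hout hac ha₀ haLB haM hL0 haL
  obtain ⟨K, hK, hterm1⟩ := term1 (n := n) hσ0
  let Q1 : ℝ≥0∞ := ENNReal.ofReal 2 * (1 + C)
  let Q2 : ℝ≥0∞ := K * (1 + (ENNReal.ofReal 2 + ENNReal.ofReal (2 * M ^ 2) * (ENNReal.ofReal 2 * C + ENNReal.ofReal 32)) + C)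
  have hQ1 : Q1 ≠ ⊤ := by simp only [Q1]; finiteness
  have hQ2 : Q2 ≠ ⊤ := by simp only [Q2]; finiteness
  refine ⟨(Q2.toReal + 1) + (Q1.toReal + 1), by positivity, fun u hu => ?_⟩
  obtain ⟨g, hg⟩ := exists_g u
  obtain ⟨Lu, hL⟩ := exists_L u
  have hA : AA σ u ≤ C * ((∫⁻ z, ‖Pop σ w a u z‖ₑ ^ 2) + ∫⁻ z, ‖u z‖ₑ ^ 2) := hmain u hu
  have hell := ell_le hσ0 hσ1 hw hw1 hout haM u Lu hL
  have h1 := hterm1 u g Lu hg hL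
  have h2 := term2 hσ0 hσ1 u
  have hgf : (fun z : Z n => (((1 + ‖vC z‖ ^ 2) ^ (-(1 : ℝ) / 2) : ℝ) : ℂ) * u z) = g := by
    ext z; rw [hg]; rfl
  rw [hgf, ENNReal.ofReal_add (by positivity) (by positivity), add_mul]
  rw [← eLpNorm_two_sq, ← eLpNorm_two_sq] at hA
  rw [← eLpNorm_two_sq, ← eLpNorm_two_sq, ← eLpNorm_two_sq] at hell h1
  rw [← eLpNorm_two_sq, ← eLpNorm_two_sq] at h2
  refine add_le_add (sq_to_lin hQ2 (h1.trans ?_)) (sq_to_lin hQ1 (h2.trans ?_))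
  · generalize eLpNorm (Pop σ w a ⇑u) 2 volume ^ 2 = p at *
    generalize eLpNorm (⇑u) 2 volume ^ 2 = q at *
    generalize eLpNorm (⇑Lu) 2 volume ^ 2 = l at *
    generalize AA σ u = A at *
    have hq : q ≤ p + q := le_add_self
    have hp : p ≤ p + q := le_self_add
    simp only [Q2]
    rw [mul_assoc]
    refine mul_le_mul' le_rfl ?_
    rw [add_mul, add_mul, one_mul, add_assoc]
    refine add_le_add hq (add_le_add (hell.trans ?_) hA)
    rw [add_mul, mul_assoc (ENNReal.ofReal (2 * M ^ 2)), add_mul, mul_assoc (ENNReal.ofReal 2) C]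
    gcongr
  · generalize eLpNorm (Pop σ w a ⇑u) 2 volume ^ 2 = p at *
    generalize eLpNorm (⇑u) 2 volume ^ 2 = q at *
    generalize AA σ u = A at *
    simp only [Q1]
    rw [mul_assoc, add_mul, one_mul]
    refine mul_le_mul' le_rfl (add_le_add le_add_self hA)

end assembly

/-- weighted maximal hypoelliptic estimate, with gain
`⟨D_z⟩^{2σ/(2σ+1)}` on `⟨v⟩^{-1} w` and `⟨D_v⟩^{2σ}` on `w`, for Schwartz
functions supported in `[-3,3]` in the time variable.  The Fourier multipliers
`⟨D_z⟩^{2σ/(2σ+1)}` and `⟨D_v⟩^{2σ}` are expressed on the Fourier transform side. -/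
theorem statement17
    (n : ℕ) (hn : 1 ≤ n) (σ : ℝ) (hσ0 : 0 < σ) (hσ1 : σ < 1)
    (w₀ : E n → ℝ) (hw : ContDiff ℝ (⊤ : ℕ∞) w₀)
    (hw01 : ∀ η, 0 ≤ w₀ η ∧ w₀ η ≤ 1)
    (hwout : ∀ η : E n, 2 ≤ ‖η‖ → w₀ η = 1)
    (hwin : ∀ η : E n, ‖η‖ ≤ 1 → w₀ η = 0)
    (a : Z n → ℝ) (ha : ContDiff ℝ (⊤ : ℕ∞) a)
    (haB : ∀ k : ℕ, ∃ C : ℝ, ∀ z, ‖iteratedFDeriv ℝ k a z‖ ≤ C)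
    (a₀ : ℝ) (ha₀ : 0 < a₀) (haLB : ∀ z, a₀ ≤ a z) :
    ∃ C : ℝ, 0 < C ∧ ∀ u : SchwartzMap (Z n) ℂ,
      (∀ z : Z n, u z ≠ 0 → tC z ∈ Set.Icc (-3 : ℝ) 3) →
      eLpNorm (fun ζ => (((1 + ‖ζ‖ ^ 2) ^ (σ / (2 * σ + 1)) : ℝ) : ℂ) *
          FourierTransform.fourier
            (fun z : Z n => (((1 + ‖vC z‖ ^ 2) ^ (-(1 : ℝ) / 2) : ℝ) : ℂ) * u z) ζ) 2 volume
        + eLpNorm (fun ζ => (((1 + ‖vC ζ‖ ^ 2) ^ σ : ℝ) : ℂ) *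
            FourierTransform.fourier (⇑u) ζ) 2 volume
        ≤ ENNReal.ofReal C *
          (eLpNorm (Pop σ w₀ a ⇑u) 2 volume + eLpNorm (⇑u) 2 volume) := by
  obtain ⟨M, hM⟩ := haB 0
  obtain ⟨L, hL⟩ := haB 1
  have haM : ∀ z, |a z| ≤ M := fun z => by
    have := hM z
    rwa [norm_iteratedFDeriv_zero, Real.norm_eq_abs] at this
  have hL1 : ∀ z, ‖fderiv ℝ a z‖ ≤ L := fun z => by
    have := hL z
    rwa [norm_iteratedFDeriv_one] at this
  have hL0 : 0 ≤ L := (norm_nonneg _).trans (hL1 0)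
  have hd : Differentiable ℝ a := ha.differentiable (by simp)
  have haL : ∀ z z', |a z - a z'| ≤ L * ‖z - z'‖ := fun z z' => by
    rw [← Real.norm_eq_abs]
    exact (convex_univ : Convex ℝ (Set.univ : Set (Z n))).norm_image_sub_le_of_norm_fderiv_le
      (fun x _ => hd x) (fun x _ => hL1 x) (Set.mem_univ z') (Set.mem_univ z)
  exact final_est hσ0 hσ1 hw.continuous hw01 hwout ha.continuous ha₀ haLB haM hL0 haL
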